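/- Let m ≥ 2 be even. For f, g ∈ S(ℝ^m)⊗Cl_{0,m} define the generalized convolution (f *_{Cl} g)(x) = (2π)^{−m/2} ∫_{ℝ^m} τ_y f(x) g(y) dy, where τ_y is the generalized translation associated with the Clifford–Fourier transform F_−. If f ∈ S(ℝ^m) is real-valued and radial, then for every g ∈ S(ℝ^m)⊗Cl_{0,m}: F_−(f *_{Cl} g)(x) = F_− f(x) · F_− g(x) for all x ∈ ℝ^m, and moreover f *_{Cl} g = g *_{Cl} f. -/

import Mathlib

open scoped BigOperators
open MeasureTheory

noncomputable section

namespace CliffordFourier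

/-- Concrete model of the complexified Clifford algebra `Cl_{0,m} ⊗ ℂ`:
an element is the family of its complex coefficients on the canonical basis
`e_S = e_{i₁} ⋯ e_{i_k}` (for `S = {i₁ < … < i_k} ⊆ {0,…,m-1}`). -/
def Cl (m : ℕ) : Type := Finset (Fin m) → ℂ

variable {m : ℕ}

instance : NormedAddCommGroup (Cl m) :=
  inferInstanceAs (NormedAddCommGroup (Finset (Fin m) → ℂ))
instance : NormedSpace ℝ (Cl m) :=
  inferInstanceAs (NormedSpace ℝ (Finset (Fin m) → ℂ))
instance : Module ℂ (Cl m) := inferInstanceAs (Module ℂ (Finset (Fin m) → ℂ))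
instance : CompleteSpace (Cl m) := inferInstanceAs (CompleteSpace (Finset (Fin m) → ℂ))

/-- The coefficient of `a` on the basis element `e_S`. -/
def coeff (a : Cl m) : Finset (Fin m) → ℂ := a

/-- Build an element of the Clifford algebra from its coefficients. -/
def ofCoeff (f : Finset (Fin m) → ℂ) : Cl m := f

/-- `1 = e_∅`. -/
instance : One (Cl m) := ⟨ofCoeff fun S => if S = (∅ : Finset (Fin m)) then 1 else 0⟩

/-- Clifford multiplication, determined by the relations `e_i e_j = - e_j e_i` (`i ≠ j`)
and `e_i² = -1`; on basis elements it is given by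
`e_T · e_U = (-1)^{#{(t,u) ∈ T×U : u < t}} · (-1)^{#(T∩U)} · e_{T Δ U}`. -/
instance : Mul (Cl m) :=
  ⟨fun a b => ofCoeff fun S => ∑ T : Finset (Fin m),
    ((-1 : ℂ) ^ ((((T ×ˢ (symmDiff T S)).filter fun p : Fin m × Fin m => p.2 < p.1).card)
        + (T ∩ (symmDiff T S)).card))
      * coeff a T * coeff b (symmDiff T S)⟩

/-- The generator `e_i`. -/
def e (m : ℕ) (i : Fin m) : Cl m := ofCoeff fun S => if S = {i} then 1 else 0

/-- The embedding of a vector `x ∈ ℝ^m` as `x = Σ_i x_i e_i` in the Clifford algebra. -/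
def vec (m : ℕ) (x : Fin m → ℝ) : Cl m := ∑ i : Fin m, (x i : ℂ) • e m i

/-- The Euclidean inner product `⟨x,y⟩ = Σ_i x_i y_i`. -/
def ip (x y : Fin m → ℝ) : ℝ := ∑ i, x i * y i

/-- The Euclidean norm `|x|`. -/
def nrm (x : Fin m → ℝ) : ℝ := Real.sqrt (ip x x)

/-- The wedge product `x∧y = Σ_{j<k} e_j e_k (x_j y_k - x_k y_j)`. -/
def wedge (m : ℕ) (x y : Fin m → ℝ) : Cl m :=
  ∑ j : Fin m, ∑ k : Fin m,
    if j < k then ((x j * y k - x k * y j : ℝ) : ℂ) • (e m j * e m k) else 0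

/-- Complex conjugation of the coefficients. -/
def cconj (a : Cl m) : Cl m := ofCoeff fun S => starRingEnd ℂ (coeff a S)

/-- The Gegenbauer polynomial `C_k^λ(w)`, defined through the standard three-term
recurrence, equivalent to the generating function `(1-2wt+t²)^{-λ} = Σ_k C_k^λ(w) t^k`. -/
def geg (lam : ℝ) : ℕ → ℝ → ℝ
  | 0, _ => 1
  | 1, w => 2 * lam * w
  | (k+2), w => (2 * ((k : ℝ) + 1 + lam) * w * geg lam (k+1) w
      - ((k : ℝ) + 2 * lam) * geg lam k w) / ((k : ℝ) + 2)

/-- The Bessel function of the first kind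
`J_a(z) = Σ_{j≥0} (-1)^j (z/2)^{2j+a} / (j! Γ(j+a+1))`. -/
def besselJ (a z : ℝ) : ℝ :=
  ∑' j : ℕ, ((-1 : ℝ)^j * (z/2) ^ (2*(j:ℝ) + a)) / (j.factorial * Real.Gamma ((j : ℝ) + a + 1))

/-- The entire function `J̃_a(t) = t^{-a} J_a(t) = Σ_{j≥0} (-1)^j (t/2)^{2j} / (j! Γ(j+a+1) 2^a)`
(for `t > 0` this is literally `t^{-a} J_a(t)`). -/
def besselJt (a t : ℝ) : ℝ :=
  ∑' j : ℕ, ((-1 : ℝ)^j * (t/2) ^ (2*j)) / (j.factorial * Real.Gamma ((j : ℝ) + a + 1) * (2:ℝ)^a)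

/-- The renormalized Gegenbauer polynomial `((k+λ)/λ) C_k^λ = C_k^{λ+1} - C_{k-2}^{λ+1}`
(the right-hand side also makes sense for `λ = 0`, i.e. `m = 2`). -/
def gegT (lam : ℝ) (k : ℕ) (w : ℝ) : ℝ :=
  geg (lam + 1) k w - (if 2 ≤ k then geg (lam + 1) (k - 2) w else 0)

/-- `A_λ(w,z) = 2^{λ-1} Γ(λ+1) Σ_{k≥0} (u + (-1)^k) z^{-λ} J_{k+λ}(z) C_k^λ(w)`, where `u = i^m`;
here written using `z^{-λ} J_{k+λ}(z) = z^k J̃_{k+λ}(z)`, which makes the formula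
well defined for all `z ≥ 0` (and all `m ≥ 2`). -/
def AfunR (u : ℂ) (lam w z : ℝ) : ℂ :=
  (((2:ℝ)^(lam - 1) * Real.Gamma (lam + 1) : ℝ) : ℂ) *
    ∑' k : ℕ, (u + (-1 : ℂ)^k) * ((z^k * besselJt ((k : ℝ) + lam) z * geg lam k w : ℝ) : ℂ)

/-- `B_λ(w,z) = -2^{λ-1} Γ(λ) Σ_{k≥0} (k+λ)(u - (-1)^k) z^{-λ} J_{k+λ}(z) C_k^λ(w)`;
here written using `Γ(λ)(k+λ)C_k^λ = Γ(λ+1)(C_k^{λ+1} - C_{k-2}^{λ+1})` and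
`z^{-λ} J_{k+λ}(z) = z^k J̃_{k+λ}(z)`, which makes the formula well defined
for all `z ≥ 0` and all `m ≥ 2` (including `λ = 0`). -/
def BfunR (u : ℂ) (lam w z : ℝ) : ℂ :=
  -(((2:ℝ)^(lam - 1) * Real.Gamma (lam + 1) : ℝ) : ℂ) *
    ∑' k : ℕ, (u - (-1 : ℂ)^k) * ((z^k * besselJt ((k : ℝ) + lam) z * gegT lam k w : ℝ) : ℂ)

/-- `C_λ(w,z) = -2^{λ-1} Γ(λ) Σ_{k≥0} (u + (-1)^k) z^{-λ-1} J_{k+λ}(z) (C_k^λ)'(w)`;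
here written using `Γ(λ) (C_k^λ)' = 2 Γ(λ+1) C_{k-1}^{λ+1}` and
`z^{-λ-1} J_{k+λ}(z) = z^{k-1} J̃_{k+λ}(z)`, which makes the formula well defined
for all `z ≥ 0` and all `m ≥ 2` (including `λ = 0`). -/
def CfunR (u : ℂ) (lam w z : ℝ) : ℂ :=
  -(((2:ℝ)^lam * Real.Gamma (lam + 1) : ℝ) : ℂ) *
    ∑' k : ℕ, (u + (-1 : ℂ)^k) *
      ((z^(k - 1) * besselJt ((k : ℝ) + lam) z
        * (if 1 ≤ k then geg (lam + 1) (k - 1) w else 0) : ℝ) : ℂ)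

/-- The Clifford-Fourier kernel
`K_-(x,y) = A_λ(w,z) + B_λ(w,z) + (x∧y) C_λ(w,z)`
with `λ = (m-2)/2`, `z = |x||y|`, `w = ⟨x,y⟩/(|x||y|)`. -/
def Kminus (m : ℕ) (x y : Fin m → ℝ) : Cl m :=
  (AfunR (Complex.I ^ m) (((m:ℝ) - 2)/2) (ip x y / (nrm x * nrm y)) (nrm x * nrm y)
    + BfunR (Complex.I ^ m) (((m:ℝ) - 2)/2) (ip x y / (nrm x * nrm y)) (nrm x * nrm y)) • (1 : Cl m)
  + CfunR (Complex.I ^ m) (((m:ℝ) - 2)/2) (ip x y / (nrm x * nrm y)) (nrm x * nrm y) • wedge m x y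

/-- The Clifford-Fourier transform `F_- f(y) = (2π)^{-m/2} ∫ K_-(x,y) f(x) dx`. -/
def Fm (m : ℕ) (f : (Fin m → ℝ) → Cl m) (y : Fin m → ℝ) : Cl m :=
  ((2*Real.pi) ^ (-(m:ℝ)/2)) • ∫ x : Fin m → ℝ, Kminus m x y * f x

/-- The generalized translation operator
`τ_y f(x) = (2π)^{-m/2} ∫ conj(K_-(ξ,x)) K_-(y,ξ) (F_- f)(ξ) dξ`. -/
def tau (m : ℕ) (f : (Fin m → ℝ) → Cl m) (y x : Fin m → ℝ) : Cl m :=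
  ((2*Real.pi) ^ (-(m:ℝ)/2)) •
    ∫ ξ : Fin m → ℝ, cconj (Kminus m ξ x) * (Kminus m y ξ * Fm m f ξ)

/-- The generalized convolution `(f *_{Cl} g)(x) = (2π)^{-m/2} ∫ τ_y f(x) g(y) dy`. -/
def conv (m : ℕ) (f g : (Fin m → ℝ) → Cl m) (x : Fin m → ℝ) : Cl m :=
  ((2*Real.pi) ^ (-(m:ℝ)/2)) • ∫ y : Fin m → ℝ, tau m f y x * g y

section Aux

set_option linter.all false

/-! ### The Clifford algebra -/

def eps (t u : Fin m) : ℂ := if u ≤ t then -1 else 1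

def sg (T U : Finset (Fin m)) : ℂ := ∏ t ∈ T, ∏ u ∈ U, eps t u

lemma eps_sq (t u : Fin m) : eps t u * eps t u = 1 := by
  unfold eps; split_ifs <;> simp

lemma prod_symmDiff_sq (f : Fin m → ℂ) (hf : ∀ i, f i * f i = 1) (T U : Finset (Fin m)) :
    ∏ t ∈ symmDiff T U, f t = (∏ t ∈ T, f t) * ∏ t ∈ U, f t := by
  have h1 : symmDiff T U = (T \ U) ∪ (U \ T) := rfl
  have hd : Disjoint (T \ U) (U \ T) := disjoint_sdiff_sdiff
  have hT : ∏ t ∈ T, f t = (∏ t ∈ T \ U, f t) * ∏ t ∈ T ∩ U, f t := by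
    rw [← Finset.prod_union (Finset.disjoint_sdiff_inter T U), Finset.sdiff_union_inter]
  have hU : ∏ t ∈ U, f t = (∏ t ∈ U \ T, f t) * ∏ t ∈ T ∩ U, f t := by
    rw [Finset.inter_comm, ← Finset.prod_union (Finset.disjoint_sdiff_inter U T),
      Finset.sdiff_union_inter]
  have hI : (∏ t ∈ T ∩ U, f t) * ∏ t ∈ T ∩ U, f t = 1 := by
    rw [← Finset.prod_mul_distrib]; exact Finset.prod_eq_one fun i _ => hf i
  rw [h1, Finset.prod_union hd, hT, hU]
  linear_combination -(∏ t ∈ T \ U, f t) * (∏ t ∈ U \ T, f t) * hI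

lemma sg_symm_right (T U V : Finset (Fin m)) : sg T (symmDiff U V) = sg T U * sg T V := by
  unfold sg
  rw [← Finset.prod_mul_distrib]
  exact Finset.prod_congr rfl fun t _ => prod_symmDiff_sq _ (fun i => eps_sq t i) U V

lemma sg_symm_left (T U V : Finset (Fin m)) : sg (symmDiff T U) V = sg T V * sg U V := by
  unfold sg
  refine prod_symmDiff_sq _ (fun i => ?_) T U
  rw [← Finset.prod_mul_distrib]; exact Finset.prod_eq_one fun j _ => eps_sq i j

lemma sg_sq (T U : Finset (Fin m)) : sg T U * sg T U = 1 := by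
  rw [← sg_symm_right]; simp [sg]

lemma sg_eq (T U : Finset (Fin m)) :
    (-1 : ℂ) ^ ((((T ×ˢ U).filter fun p : Fin m × Fin m => p.2 < p.1).card)
        + (T ∩ U).card) = sg T U := by
  have h1 : sg T U = ∏ p ∈ T ×ˢ U,
      (if p.2 < p.1 then (-1 : ℂ) else 1) * (if p.1 = p.2 then (-1 : ℂ) else 1) := by
    unfold sg
    rw [Finset.prod_product]
    refine Finset.prod_congr rfl fun t _ => Finset.prod_congr rfl fun u _ => ?_
    unfold eps
    rcases lt_trichotomy u t with h | h | h
    · simp [h, h.le, h.ne']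
    · simp [h]
    · simp [h.not_ge, h.not_gt, h.ne]
  rw [h1, Finset.prod_mul_distrib, pow_add]
  congr 1
  · rw [Finset.prod_ite]; simp
  · rw [Finset.prod_product]
    have : ∀ t ∈ T, (∏ u ∈ U, if t = u then (-1 : ℂ) else 1) = if t ∈ U then -1 else 1 := by
      intro t _
      rw [Finset.prod_ite_eq]
    rw [Finset.prod_congr rfl this, Finset.prod_ite]
    simp [Finset.filter_mem_eq_inter]

lemma mul_coeff (a b : Cl m) (S : Finset (Fin m)) :
    (a * b) S = ∑ T : Finset (Fin m), sg T (symmDiff T S) * a T * b (symmDiff T S) := by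
  change (∑ T : Finset (Fin m), _) = _
  refine Finset.sum_congr rfl fun T _ => ?_
  rw [sg_eq]; rfl

lemma Cl_ext {a b : Cl m} (h : ∀ S, a S = b S) : a = b := funext h

lemma add_coeff (a b : Cl m) (S : Finset (Fin m)) : (a + b) S = a S + b S := rfl
lemma smul_coeff (r : ℂ) (b : Cl m) (S : Finset (Fin m)) : (r • b) S = r * b S := rfl
lemma rsmul_coeff (r : ℝ) (b : Cl m) (S : Finset (Fin m)) : (r • b) S = (r : ℂ) * b S := 
  Complex.real_smul
lemma zero_coeff (S : Finset (Fin m)) : (0 : Cl m) S = 0 := rfl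
lemma one_coeff (S : Finset (Fin m)) : (1 : Cl m) S = if S = ∅ then 1 else 0 := rfl
lemma e_coeff (i : Fin m) (S : Finset (Fin m)) : (e m i) S = if S = {i} then 1 else 0 := rfl

lemma rsmul_eq (r : ℝ) (a : Cl m) : r • a = (r : ℂ) • a :=
  Cl_ext fun S => by rw [rsmul_coeff, smul_coeff]

lemma cl_mul_assoc (a b c : Cl m) : a * b * c = a * (b * c) := by
  refine Cl_ext fun S => ?_
  simp only [mul_coeff, Finset.mul_sum, Finset.sum_mul]
  rw [Finset.sum_comm]
  refine Finset.sum_congr rfl fun R _ => ?_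
  refine Fintype.sum_equiv ((symmDiff_right_involutive R).toPerm) _ _ fun T => ?_
  simp only [Function.Involutive.coe_toPerm]
  have h1 : symmDiff (symmDiff R T) (symmDiff R S) = symmDiff T S := by
    rw [symmDiff_assoc, symmDiff_left_comm T, symmDiff_symmDiff_cancel_left]
  have h2 : symmDiff R S = symmDiff (symmDiff R T) (symmDiff T S) := by
    rw [symmDiff_assoc, symmDiff_symmDiff_cancel_left]
  rw [h1, sg_symm_left R T]
  have h3 : sg R (symmDiff R S) = sg R (symmDiff R T) * sg R (symmDiff T S) := by
    rw [h2, sg_symm_right R (symmDiff R T)]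
  rw [h3]
  have := sg_sq R (symmDiff T S)
  linear_combination (-sg R (symmDiff R T) * sg T (symmDiff T S) * a R * b (symmDiff R T) * c (symmDiff T S)) * this

lemma single_mul_coeff (a : ℂ) (A : Finset (Fin m)) (x b : Cl m) (hx : ∀ S, x S = if S = A then a else 0)
    (S : Finset (Fin m)) : (x * b) S = sg A (symmDiff A S) * a * b (symmDiff A S) := by
  rw [mul_coeff, Finset.sum_eq_single A]
  · simp [hx]
  · intro T _ hT; simp [hx, hT]
  · simp

lemma cl_one_mul (a : Cl m) : 1 * a = a := by
  refine Cl_ext fun S => ?_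
  rw [single_mul_coeff 1 ∅ 1 a one_coeff]
  have : symmDiff ∅ S = S := bot_symmDiff S
  simp [this, sg]

lemma cl_mul_one (a : Cl m) : a * 1 = a := by
  refine Cl_ext fun S => ?_
  rw [mul_coeff, Finset.sum_eq_single S]
  · have : symmDiff S S = ∅ := symmDiff_self S
    simp [this, one_coeff, sg]
  · intro T _ hT
    have : symmDiff T S ≠ ∅ := by
      intro h; exact hT (symmDiff_eq_bot.1 h)
    simp [one_coeff, this]
  · simp

@[reducible] def clRing : Ring (Cl m) :=
  { (inferInstance : AddCommGroup (Cl m)) with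
    mul := (· * ·)
    one := 1
    mul_assoc := cl_mul_assoc
    one_mul := cl_one_mul
    mul_one := cl_mul_one
    left_distrib := fun a b c => Cl_ext fun S => by
      simp only [mul_coeff, add_coeff, mul_add, Finset.sum_add_distrib]
    right_distrib := fun a b c => Cl_ext fun S => by
      simp only [mul_coeff, add_coeff, mul_add, add_mul, Finset.sum_add_distrib]
    zero_mul := fun a => Cl_ext fun S => by
      simp only [mul_coeff, zero_coeff, mul_zero, zero_mul, Finset.sum_const_zero]
    mul_zero := fun a => Cl_ext fun S => by
      simp only [mul_coeff, zero_coeff, mul_zero, zero_mul, Finset.sum_const_zero] }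
attribute [local instance] clRing


@[reducible] def clAlgR : Algebra ℝ (Cl m) := Algebra.ofModule
  (fun r a b => Cl_ext fun S => by
    simp only [mul_coeff, rsmul_coeff, Finset.mul_sum]
    exact Finset.sum_congr rfl fun _ _ => by ring)
  (fun r a b => Cl_ext fun S => by
    simp only [mul_coeff, rsmul_coeff, Finset.mul_sum]
    exact Finset.sum_congr rfl fun _ _ => by ring)
attribute [local instance] clAlgR


@[reducible] def clAlgC : Algebra ℂ (Cl m) := Algebra.ofModule
  (fun r a b => Cl_ext fun S => by
    simp only [mul_coeff, smul_coeff, Finset.mul_sum]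
    exact Finset.sum_congr rfl fun _ _ => by ring)
  (fun r a b => Cl_ext fun S => by
    simp only [mul_coeff, smul_coeff, Finset.mul_sum]
    exact Finset.sum_congr rfl fun _ _ => by ring)
attribute [local instance] clAlgC


lemma clTower : IsScalarTower ℝ ℂ (Cl m) := ⟨fun r z a => by simp only [rsmul_eq, smul_smul]; simp⟩
attribute [local instance] clTower

lemma clComm : SMulCommClass ℝ ℂ (Cl m) := ⟨fun r z a => by simp only [rsmul_eq, smul_smul, mul_comm]⟩
attribute [local instance] clComm

@[reducible] def clNSC : NormedSpace ℂ (Cl m) := ⟨fun r a => 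
  (norm_smul_le r (show Finset (Fin m) → ℂ from a))⟩
attribute [local instance] clNSC

lemma clFD : FiniteDimensional ℝ (Cl m) :=
  inferInstanceAs (FiniteDimensional ℝ (Finset (Fin m) → ℂ))
attribute [local instance] clFD


lemma norm_smulC (r : ℂ) (a : Cl m) : ‖r • a‖ = ‖r‖ * ‖a‖ := norm_smul r a

/-- multiplication as a continuous bilinear map -/
def mulB (m : ℕ) : Cl m →L[ℝ] Cl m →L[ℝ] Cl m :=
  LinearMap.toContinuousLinearMap
    ((LinearMap.toContinuousLinearMap : (Cl m →ₗ[ℝ] Cl m) ≃ₗ[ℝ] (Cl m →L[ℝ] Cl m)).toLinearMap ∘ₗ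
      (LinearMap.mul ℝ (Cl m)))

@[simp] lemma mulB_apply (a b : Cl m) : mulB m a b = a * b := rfl

lemma norm_mul_le_cl : ∃ C : ℝ, 1 ≤ C ∧ ∀ a b : Cl m, ‖a * b‖ ≤ C * ‖a‖ * ‖b‖ :=
  ⟨max 1 ‖mulB m‖, le_max_left _ _, fun a b => by
    have := (mulB m).le_opNorm₂ a b
    rw [mulB_apply] at this
    refine this.trans ?_
    gcongr
    exact le_max_right _ _⟩

lemma clCM : ContinuousMul (Cl m) := ⟨by
  have : Continuous fun p : Cl m × Cl m => mulB m p.1 p.2 := by fun_prop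
  exact this⟩
attribute [local instance] clCM


lemma e_sq (i : Fin m) : e m i * e m i = -1 := by
  refine Cl_ext fun S => ?_
  rw [single_mul_coeff 1 {i} (e m i) (e m i) (e_coeff i), e_coeff]
  change _ = -(1 : Cl m) S
  rw [one_coeff]
  by_cases h : S = ∅
  · subst h
    have : symmDiff ({i} : Finset (Fin m)) ∅ = {i} := symmDiff_bot _
    simp [this, sg, eps]
  · have : symmDiff ({i} : Finset (Fin m)) S ≠ {i} := by
      intro h'; apply h
      have := congrArg (symmDiff {i}) h'
      rw [symmDiff_symmDiff_cancel_left, symmDiff_self] at this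
      exact this
    simp [this, h]

lemma e_anti {i j : Fin m} (hij : i ≠ j) : e m i * e m j = -(e m j * e m i) := by
  refine Cl_ext fun S => ?_
  change _ = -((e m j * e m i) S)
  rw [single_mul_coeff 1 {i} (e m i) (e m j) (e_coeff i), e_coeff,
    single_mul_coeff 1 {j} (e m j) (e m i) (e_coeff j), e_coeff]
  by_cases h : symmDiff {i} S = {j}
  · have hS : S = symmDiff {i} {j} := by rw [← h, symmDiff_symmDiff_cancel_left]
    have h2 : symmDiff {j} S = {i} := by
      rw [hS, symmDiff_comm ({i} : Finset (Fin m)), symmDiff_symmDiff_cancel_left]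
    rw [h, h2]
    simp only [sg, eps, Finset.prod_singleton]
    rcases lt_or_gt_of_ne hij with h | h
    · simp [h.le, h.not_ge]
    · simp [h.le, h.not_ge]
  · have h2 : symmDiff {j} S ≠ {i} := by
      intro h'; apply h
      have hS : S = symmDiff {j} {i} := by rw [← h', symmDiff_symmDiff_cancel_left]
      rw [hS, symmDiff_comm ({j} : Finset (Fin m)), symmDiff_symmDiff_cancel_left]
    simp [h, h2]

lemma e_mul_e (i j : Fin m) : e m i * e m j + e m j * e m i = if i = j then -2 else 0 := by
  split_ifs with h
  · subst h; rw [e_sq]; norm_num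
  · rw [e_anti h]; simp

lemma vec_mul_e (x : Fin m → ℝ) (j : Fin m) :
    vec m x * e m j = -(e m j * vec m x) - (2 * (x j : ℂ)) • (1 : Cl m) := by
  have h : vec m x * e m j + e m j * vec m x = -((2 * (x j : ℂ)) • (1 : Cl m)) := by
    unfold vec
    rw [Finset.sum_mul, Finset.mul_sum, ← Finset.sum_add_distrib]
    have : ∀ i ∈ Finset.univ, (x i : ℂ) • e m i * e m j + e m j * ((x i : ℂ) • e m i) =
        if i = j then (x i : ℂ) • (-2 : Cl m) else 0 := by
      intro i _
      rw [smul_mul_assoc, mul_smul_comm, ← smul_add, e_mul_e]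
      split_ifs <;> simp
    rw [Finset.sum_congr rfl this]
    rw [Finset.sum_ite_eq' Finset.univ j]
    simp only [Finset.mem_univ, if_true]
    rw [mul_comm, mul_smul, ← smul_neg]
    congr 1
    rw [show (-2 : Cl m) = -(2 : ℂ) • 1 by
      rw [neg_smul, ← Algebra.algebraMap_eq_smul_one, map_ofNat]]
    simp
  rw [← eq_sub_iff_add_eq] at h
  rw [h]; abel

lemma vec_mul_vec (x y : Fin m → ℝ) :
    vec m x * vec m y = -(vec m y * vec m x) - (2 * (ip x y : ℂ)) • (1 : Cl m) := by
  conv_lhs => rw [show vec m y = ∑ i : Fin m, (y i : ℂ) • e m i from rfl]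
  rw [Finset.mul_sum]
  simp only [mul_smul_comm, vec_mul_e]
  simp only [smul_sub, smul_neg, Finset.sum_sub_distrib, Finset.sum_neg_distrib]
  congr 1
  · conv_rhs => rw [show vec m y = ∑ i : Fin m, (y i : ℂ) • e m i from rfl]
    rw [Finset.sum_mul]; simp only [smul_mul_assoc]
  · unfold ip
    push_cast
    rw [Finset.mul_sum, Finset.sum_smul]
    refine Finset.sum_congr rfl fun i _ => ?_
    rw [smul_smul]; congr 1; ring

lemma vec_sq (x : Fin m → ℝ) : vec m x * vec m x = -((ip x x : ℂ) • (1 : Cl m)) := by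
  have h := vec_mul_vec x x
  have h2 : (2 : ℂ) • (vec m x * vec m x) = (2 : ℂ) • (-((ip x x : ℂ) • (1 : Cl m))) := by
    rw [two_smul, smul_neg, smul_smul]
    nth_rewrite 1 [h]; abel
  exact smul_right_injective _ (two_ne_zero) h2

lemma sum_e_vec_e (y : Fin m → ℝ) :
    ∑ j, e m j * vec m y * e m j = ((m : ℂ) - 2) • vec m y := by
  have : ∀ j ∈ Finset.univ, e m j * vec m y * e m j = vec m y - (2 : ℂ) • ((y j : ℂ) • e m j) := by
    intro j _
    rw [mul_assoc, vec_mul_e, mul_sub, mul_neg, ← mul_assoc, e_sq, mul_smul_comm, mul_one, smul_smul]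
    simp
  rw [Finset.sum_congr rfl this, Finset.sum_sub_distrib, ← Finset.smul_sum]
  rw [sub_smul]
  simp only [Finset.sum_const, Finset.card_univ, Fintype.card_fin]
  rw [← Nat.cast_smul_eq_nsmul ℂ]
  rfl

lemma wedge_eq (x y : Fin m → ℝ) :
    wedge m x y = vec m x * vec m y + (ip x y : ℂ) • (1 : Cl m) := by
  have h1 : vec m x * vec m y = ∑ j, ∑ k, ((x j : ℂ) * (y k : ℂ)) • (e m j * e m k) := by
    unfold vec
    rw [Finset.sum_mul]
    refine Finset.sum_congr rfl fun j _ => ?_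
    rw [Finset.mul_sum]
    refine Finset.sum_congr rfl fun k _ => ?_
    rw [smul_mul_assoc, mul_smul_comm, smul_smul]
  have h2 : (ip x y : ℂ) • (1 : Cl m) = ∑ j, ∑ k, if j = k then ((x j : ℂ) * y k) • (1 : Cl m) else 0 := by
    unfold ip
    push_cast
    rw [Finset.sum_smul]
    refine Finset.sum_congr rfl fun j _ => ?_
    rw [Finset.sum_ite_eq]; simp
  have h3 : ∀ j k : Fin m, ((x j : ℂ) * (y k : ℂ)) • (e m j * e m k) =
      (if j < k then ((x j : ℂ) * (y k : ℂ)) • (e m j * e m k) else 0)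
      + (if k < j then ((x j : ℂ) * (y k : ℂ)) • (e m j * e m k) else 0)
      - (if j = k then ((x j : ℂ) * (y k : ℂ)) • (1 : Cl m) else 0) := by
    intro j k
    rcases lt_trichotomy j k with h | h | h
    · simp [h, h.not_gt, h.ne]
    · subst h; simp [e_sq]
    · simp [h, h.not_gt, h.ne']
  have h4 : vec m x * vec m y + (ip x y : ℂ) • (1 : Cl m) =
      (∑ j, ∑ k, if j < k then ((x j : ℂ) * (y k : ℂ)) • (e m j * e m k) else 0) +
      ∑ j, ∑ k, if k < j then ((x j : ℂ) * (y k : ℂ)) • (e m j * e m k) else 0 := by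
    rw [h1, h2]
    rw [Finset.sum_congr rfl fun j _ => Finset.sum_congr rfl fun k _ => h3 j k]
    simp only [Finset.sum_add_distrib, Finset.sum_sub_distrib]
    abel
  rw [h4, Finset.sum_comm (f := fun j k => if k < j then ((x j : ℂ) * (y k : ℂ)) • (e m j * e m k) else 0),
    ← Finset.sum_add_distrib]
  unfold wedge
  refine Finset.sum_congr rfl fun j _ => ?_
  rw [← Finset.sum_add_distrib]
  refine Finset.sum_congr rfl fun k _ => ?_
  split_ifs with h
  · rw [e_anti h.ne']
    push_cast
    rw [sub_smul, smul_neg]; abel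
  · simp

lemma hs_congr {f g : ℕ → ℝ} {a : ℝ} (h : HasSum f a) (e : ∀ j, g j = f j) : HasSum g a := by
  rwa [show g = f from funext e]

lemma hs_congrC {f g : ℕ → ℂ} {a : ℂ} (h : HasSum f a) (e : ∀ j, g j = f j) : HasSum g a := by
  rwa [show g = f from funext e]

/-! ### exponential generating series -/

lemma egf_summable (c : ℕ → ℝ) (hc : ∀ j, |c j| ≤ 1) (r : ℝ) :
    Summable (fun j : ℕ => c j * (r ^ j / (j.factorial : ℝ))) := by
  refine Summable.of_norm_bounded (g := fun j : ℕ => |r| ^ j / (j.factorial : ℝ))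
    (Real.summable_pow_div_factorial |r|) (fun j => ?_)
  rw [norm_mul, Real.norm_eq_abs, Real.norm_eq_abs, abs_div, abs_pow, Nat.abs_cast]
  exact mul_le_of_le_one_left (by positivity) (hc j)

def egf (c : ℕ → ℝ) (r : ℝ) : ℝ := ∑' j : ℕ, c j * (r ^ j / (j.factorial : ℝ))

lemma egf_hasSum (c : ℕ → ℝ) (hc : ∀ j, |c j| ≤ 1) (r : ℝ) :
    HasSum (fun j : ℕ => c j * (r ^ j / (j.factorial : ℝ))) (egf c r) :=
  (egf_summable c hc r).hasSum

lemma egf_hasDerivAt (c : ℕ → ℝ) (hc : ∀ j, |c j| ≤ 1) (r : ℝ) :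
    HasDerivAt (egf c) (egf (fun j => c (j + 1)) r) r := by
  set R : ℝ := |r| + 1
  have hR : 0 ≤ R := by positivity
  let u : ℕ → ℝ := fun j => if j = 0 then 0 else R ^ (j - 1) / ((j - 1).factorial : ℝ)
  have hu : Summable u := by
    rw [← summable_nat_add_iff 1]
    simpa [u] using Real.summable_pow_div_factorial R
  have hd : ∀ (j : ℕ) (y : ℝ), HasDerivAt (fun y : ℝ => c j * (y ^ j / (j.factorial : ℝ)))
      (c j * ((j : ℝ) * y ^ (j - 1) / (j.factorial : ℝ))) y := fun j y =>
    ((hasDerivAt_pow j y).div_const _).const_mul _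
  have h := hasDerivAt_tsum_of_isPreconnected (u := u) (t := Metric.ball (0:ℝ) R)
    (g := fun j y => c j * (y ^ j / (j.factorial : ℝ)))
    (g' := fun j y => c j * ((j : ℝ) * y ^ (j - 1) / (j.factorial : ℝ)))
    (y₀ := 0) (y := r) hu Metric.isOpen_ball
    (convex_ball (0:ℝ) R).isPreconnected (fun j y _ => hd j y) ?_ (by simp [R]; positivity)
    (egf_summable c hc 0) (by simp [R])
  · refine h.congr_deriv ?_
    unfold egf
    rw [ Summable.tsum_eq_zero_add]
    · simp only [Nat.cast_zero, zero_mul, zero_div, mul_zero, zero_add]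
      refine tsum_congr fun j => ?_
      rw [Nat.factorial_succ]
      have : (j.factorial : ℝ) ≠ 0 := by positivity
      simp only [Nat.add_sub_cancel]
      push_cast
      field_simp
    · rw [← summable_nat_add_iff 1]
      refine (egf_summable (fun j => c (j+1)) (fun j => hc _) r).congr fun j => ?_
      rw [Nat.factorial_succ]
      have : (j.factorial : ℝ) ≠ 0 := by positivity
      simp only [Nat.add_sub_cancel]
      push_cast
      field_simp
  · intro j y hy
    rw [norm_mul]
    refine (mul_le_of_le_one_left (norm_nonneg _) (hc j)).trans ?_
    rcases j with _ | j
    · simp [u]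
    · simp only [u, Nat.add_sub_cancel, if_neg (Nat.succ_ne_zero j)]
      rw [Nat.factorial_succ, norm_div, norm_mul, norm_pow]
      have hy' : ‖y‖ ≤ R := by simpa using (mem_ball_zero_iff.1 hy).le
      have hf : (0:ℝ) < (j.factorial : ℝ) := by positivity
      have e1 : ‖((j + 1 : ℕ) : ℝ)‖ = (j:ℝ) + 1 := by
        rw [Real.norm_eq_abs, Nat.abs_cast]; push_cast; ring
      have e2 : ‖(((j + 1) * j.factorial : ℕ) : ℝ)‖ = ((j:ℝ) + 1) * j.factorial := by
        rw [Real.norm_eq_abs, Nat.abs_cast]; push_cast; ring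
      rw [e1, e2, mul_div_mul_left _ _ (by positivity)]
      gcongr

/-! ### the functions Φ -/

def dk (k : ℕ) : ℝ := (k.factorial : ℝ) / ((2 * k).factorial : ℝ)

lemma dk_succ (k : ℕ) : dk k = (4 * (k:ℝ) + 2) * dk (k + 1) := by
  unfold dk
  have h : (2 * (k+1)).factorial = (2*k+2) * ((2*k+1) * (2*k).factorial) := by
    rw [show 2 * (k+1) = 2*k+1+1 by ring, Nat.factorial_succ, Nat.factorial_succ]
  rw [h, Nat.factorial_succ]
  have : ((2*k).factorial : ℝ) ≠ 0 := by positivity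
  push_cast
  field_simp
  ring

lemma dk_pos (k : ℕ) : 0 < dk k := by unfold dk; positivity

lemma dk_le (k : ℕ) : dk k ≤ 1 := by
  unfold dk
  rw [div_le_one (by positivity)]
  exact_mod_cast Nat.factorial_le (by omega)

def pc (n j : ℕ) : ℝ := (-1) ^ j * dk (j + n)

lemma pc_abs (n j : ℕ) : |pc n j| ≤ 1 := by
  unfold pc
  rw [abs_mul, abs_pow, abs_neg, abs_one, one_pow, one_mul, abs_of_pos (dk_pos _)]
  exact dk_le _

def Phi (n : ℕ) (r : ℝ) : ℝ := egf (pc n) r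

lemma Phi_hasDerivAt (n : ℕ) (r : ℝ) : HasDerivAt (Phi n) (- Phi (n + 1) r) r := by
  have := egf_hasDerivAt (pc n) (pc_abs n) r
  refine this.congr_deriv ?_
  unfold Phi egf
  rw [← tsum_neg]
  refine tsum_congr fun j => ?_
  unfold pc
  beta_reduce
  rw [show j + 1 + n = j + (n + 1) by ring]
  ring

lemma Phi_continuous (n : ℕ) : Continuous (Phi n) :=
  continuous_iff_continuousAt.2 fun r => (Phi_hasDerivAt n r).continuousAt

lemma Phi_rec0 (r : ℝ) : 4 * r * Phi 2 r - 2 * Phi 1 r + Phi 0 r = 0 := by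
  have h2 := (egf_hasSum (pc 2) (pc_abs 2) r).mul_left (4 * r)
  have h1 := (egf_hasSum (pc 1) (pc_abs 1) r).mul_left 2
  have h0 := egf_hasSum (pc 0) (pc_abs 0) r
  have h3 : HasSum (fun j : ℕ => 4 * (j : ℝ) * (-(pc 1 j)) * (r ^ j / (j.factorial : ℝ)))
      (4 * r * egf (pc 2) r) := by
    rw [← hasSum_nat_add_iff' 1]
    simp only [Finset.sum_range_one, Nat.cast_zero, mul_zero, zero_mul, sub_zero]
    refine hs_congr h2 fun j => ?_
    have : (j.factorial : ℝ) ≠ 0 := by positivity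
    rw [Nat.factorial_succ]
    unfold pc
    rw [show j + 1 + 1 = j + 2 by ring]
    push_cast
    field_simp
    ring
  have h := (h3.sub h1).add h0
  refine h.unique ?_
  refine hs_congr hasSum_zero fun j => ?_
  unfold pc
  rw [add_zero, dk_succ j]
  ring

lemma Phi_rec (n : ℕ) (r : ℝ) :
    4 * r * Phi (n + 2) r - (4 * n + 2) * Phi (n + 1) r + Phi n r = 0 := by
  induction n generalizing r with
  | zero => simpa using Phi_rec0 r
  | succ n ih =>
    have h1 : HasDerivAt (fun r => 4 * r * Phi (n + 2) r - (4 * n + 2) * Phi (n + 1) r + Phi n r)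
        (4 * 1 * Phi (n+2) r + 4 * r * (- Phi (n + 2 + 1) r)
          - (4 * n + 2) * (- Phi (n + 1 + 1) r) + - Phi (n + 1) r) r :=
      (((((hasDerivAt_id r).const_mul 4).mul (Phi_hasDerivAt (n+2) r)).sub
        ((Phi_hasDerivAt (n+1) r).const_mul _))).add (Phi_hasDerivAt n r)
    have h2 : HasDerivAt (fun r => 4 * r * Phi (n + 2) r - (4 * n + 2) * Phi (n + 1) r + Phi n r)
        0 r := by
      have : (fun r => 4 * r * Phi (n + 2) r - (4 * n + 2) * Phi (n + 1) r + Phi n r)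
        = fun _ => 0 := funext ih
      rw [this]; exact hasDerivAt_const _ _
    have h3 := h1.unique h2
    push_cast
    rw [show n + 1 + 2 = n + 2 + 1 by ring]
    rw [show n + 1 + 1 = n + 2 by ring] at *
    linarith

lemma Phi0_eq (t : ℝ) : Phi 0 (t ^ 2) = Real.cos t := by
  refine (egf_hasSum (pc 0) (pc_abs 0) (t^2)).unique ?_
  refine hs_congr (Real.hasSum_cos t) fun j => ?_
  unfold pc dk
  have : (j.factorial : ℝ) ≠ 0 := by positivity
  simp only [add_zero]
  field_simp
  ring

lemma Phi1_eq (t : ℝ) : 2 * t * Phi 1 (t ^ 2) = Real.sin t := by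
  refine ((egf_hasSum (pc 1) (pc_abs 1) (t^2)).mul_left (2 * t)).unique ?_
  refine hs_congr (Real.hasSum_sin t) fun j => ?_
  unfold pc dk
  have : (j.factorial : ℝ) ≠ 0 := by positivity
  have : ((2 * j + 1).factorial : ℝ) ≠ 0 := by positivity
  rw [show 2 * (j+1) = 2*j+1+1 by ring, Nat.factorial_succ, Nat.factorial_succ (2*j+1)]
  push_cast
  field_simp
  ring

lemma Phi_bdd (n : ℕ) : ∃ C, ∀ r, 0 ≤ r → |Phi n r| ≤ C := by
  suffices h : ∀ n, (∃ C, ∀ r, 1 ≤ r → |Phi n r| ≤ C) ∧ (∃ C, ∀ r, 1 ≤ r → |Phi (n+1) r| ≤ C) by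
    obtain ⟨C, hC⟩ := (h n).1
    obtain ⟨D, hD⟩ := (isCompact_Icc (a := (0:ℝ)) (b := 1)).exists_bound_of_continuousOn
      (Phi_continuous n).continuousOn
    refine ⟨max C D, fun r hr => ?_⟩
    rcases le_total 1 r with h1 | h1
    · exact (hC r h1).trans (le_max_left _ _)
    · exact (hD r ⟨hr, h1⟩).trans (le_max_right _ _)
  intro n
  induction n with
  | zero =>
    refine ⟨⟨1, fun r hr => ?_⟩, ⟨1, fun r hr => ?_⟩⟩
    · rw [← Real.sq_sqrt (by linarith : (0:ℝ) ≤ r), Phi0_eq]; exact Real.abs_cos_le_one _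
    · have h1 : 1 ≤ Real.sqrt r := by rwa [Real.one_le_sqrt]
      have := Phi1_eq (Real.sqrt r)
      rw [Real.sq_sqrt (by linarith : (0:ℝ) ≤ r)] at this
      have h2 : |2 * Real.sqrt r * Phi 1 r| ≤ 1 := by rw [this]; exact Real.abs_sin_le_one _
      rw [abs_mul, abs_of_nonneg (by linarith)] at h2
      simp only [zero_add]
      nlinarith [abs_nonneg (Phi 1 r)]
  | succ n ih =>
    obtain ⟨⟨C, hC⟩, ⟨D, hD⟩⟩ := ih
    refine ⟨⟨D, hD⟩, ⟨(4 * n + 2) * D + C, fun r hr => ?_⟩⟩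
    have h := Phi_rec n r
    have h1 : 4 * r * Phi (n + 2) r = (4 * n + 2) * Phi (n + 1) r - Phi n r := by linarith
    have h2 : |4 * r * Phi (n+2) r| ≤ (4 * n + 2) * D + C := by
      rw [h1]
      refine (abs_sub _ _).trans ?_
      rw [abs_mul, abs_of_nonneg (by positivity : (0:ℝ) ≤ 4 * n + 2)]
      gcongr
      exacts [hD r hr, hC r hr]
    rw [abs_mul, abs_of_nonneg (by linarith)] at h2
    rw [show n + 1 + 1 = n + 2 by ring]
    nlinarith [abs_nonneg (Phi (n+2) r)]

/-! ### formal differential algebra -/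

inductive Gen : Type
  | s | q | S | C
  | E (n : ℕ)

abbrev Pl := MvPolynomial Gen ℂ

def gX (g : Gen) : Pl := MvPolynomial.X g
def gI : Pl := MvPolynomial.C Complex.I

def dsG : Gen → Pl
  | .s => 1
  | .q => 0
  | .S => 0
  | .C => 0
  | .E n => - gI * gX .C * gX (.E n) + 2 * gX .s * gX .S ^ 2 * gX (.E (n + 1))

def dqG : Gen → Pl
  | .s => 0
  | .q => 1
  | .S => 0
  | .C => 0
  | .E n => - gX .S ^ 2 * gX (.E (n + 1))

def dtG : Gen → Pl
  | .s => 0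
  | .q => 0
  | .S => gX .C
  | .C => - gX .S
  | .E n => gI * gX .s * gX .S * gX (.E n)
      - 2 * (gX .q - gX .s ^ 2) * gX .S * gX .C * gX (.E (n + 1))

def ds : Derivation ℂ Pl Pl := MvPolynomial.mkDerivation ℂ dsG
def dq : Derivation ℂ Pl Pl := MvPolynomial.mkDerivation ℂ dqG
def dt : Derivation ℂ Pl Pl := MvPolynomial.mkDerivation ℂ dtG

lemma ds_X (g : Gen) : ds (gX g) = dsG g := MvPolynomial.mkDerivation_X _ _ _
lemma dq_X (g : Gen) : dq (gX g) = dqG g := MvPolynomial.mkDerivation_X _ _ _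
lemma dt_X (g : Gen) : dt (gX g) = dtG g := MvPolynomial.mkDerivation_X _ _ _
lemma d_I (D : Derivation ℂ Pl Pl) : D gI = 0 := by
  unfold gI; exact MvPolynomial.derivation_C _ _
lemma d_two (D : Derivation ℂ Pl Pl) : D 2 = 0 := by
  exact_mod_cast D.map_natCast 2

lemma lei (D : Derivation ℂ Pl Pl) (a b : Pl) : D (a * b) = a * D b + b * D a := by
  rw [Derivation.leibniz]; rfl

lemma dsq (D : Derivation ℂ Pl Pl) (a : Pl) : D (a ^ 2) = 2 * a * D a := by
  rw [pow_two, lei]; ring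

lemma comm_of (D1 D2 : Derivation ℂ Pl Pl) (h : ∀ g, D1 (D2 (gX g)) = D2 (D1 (gX g))) (p : Pl) :
    D1 (D2 p) = D2 (D1 p) := by
  have : ⁅D1, D2⁆ = 0 := by
    apply MvPolynomial.derivation_ext
    intro g
    rw [Derivation.commutator_apply]
    exact sub_eq_zero.2 (h g)
  have h2 := congrArg (fun D : Derivation ℂ Pl Pl => D p) this
  simp only [Derivation.commutator_apply, Derivation.coe_zero, Pi.zero_apply] at h2
  exact sub_eq_zero.1 h2

lemma ds_dq (p : Pl) : ds (dq p) = dq (ds p) := by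
  refine comm_of _ _ (fun g => ?_) p
  cases g <;> simp [dq_X, ds_X, dqG, dsG, lei, dsq, d_I, d_two] <;> ring

lemma dt_ds (p : Pl) : dt (ds p) = ds (dt p) := by
  refine comm_of _ _ (fun g => ?_) p
  cases g with
  | E n => simp [dt_X, ds_X, dtG, dsG, lei, dsq, d_I, d_two]; ring
  | _ => simp [dt_X, ds_X, dtG, dsG, lei, dsq, d_I, d_two]

/-! evaluation -/

def En (n : ℕ) (s q t : ℝ) : ℂ :=
  Complex.exp (-Complex.I * s * Real.cos t) * (Phi n ((q - s ^ 2) * Real.sin t ^ 2) : ℂ)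

def evG (s q t : ℝ) : Gen → ℂ
  | .s => s
  | .q => q
  | .S => (Real.sin t : ℂ)
  | .C => (Real.cos t : ℂ)
  | .E n => En n s q t

def ev (p : Pl) (s q t : ℝ) : ℂ := MvPolynomial.eval (evG s q t) p

lemma ev_X (g : Gen) (s q t : ℝ) : ev (gX g) s q t = evG s q t g := MvPolynomial.eval_X _
lemma ev_I (s q t : ℝ) : ev gI s q t = Complex.I := MvPolynomial.eval_C _
lemma ev_mul (a b : Pl) (s q t : ℝ) : ev (a * b) s q t = ev a s q t * ev b s q t := map_mul _ _ _
lemma ev_add (a b : Pl) (s q t : ℝ) : ev (a + b) s q t = ev a s q t + ev b s q t := map_add _ _ _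
lemma ev_sub (a b : Pl) (s q t : ℝ) : ev (a - b) s q t = ev a s q t - ev b s q t := map_sub _ _ _
lemma ev_neg (a : Pl) (s q t : ℝ) : ev (-a) s q t = - ev a s q t := map_neg _ _
lemma ev_one (s q t : ℝ) : ev 1 s q t = 1 := map_one _
lemma ev_zero (s q t : ℝ) : ev 0 s q t = 0 := map_zero _
lemma ev_nat (n : ℕ) (s q t : ℝ) : ev (n : Pl) s q t = n := map_natCast _ _
lemma ev_two (s q t : ℝ) : ev 2 s q t = 2 := by exact_mod_cast ev_nat 2 s q t
lemma ev_four (s q t : ℝ) : ev 4 s q t = 4 := by exact_mod_cast ev_nat 4 s q t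
lemma ev_pow (a : Pl) (n : ℕ) (s q t : ℝ) : ev (a ^ n) s q t = ev a s q t ^ n := map_pow _ _ _

lemma hasDerivAt_ofReal' {f : ℝ → ℝ} {f' x : ℝ} (h : HasDerivAt f f' x) :
    HasDerivAt (fun y => (f y : ℂ)) (f' : ℂ) x := h.ofReal_comp

lemma ev_ds (p : Pl) (s q t : ℝ) : HasDerivAt (fun s => ev p s q t) (ev (ds p) s q t) s := by
  induction p using MvPolynomial.induction_on with
  | C a =>
    rw [show ds (MvPolynomial.C a) = 0 from MvPolynomial.derivation_C _ _, ev_zero]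
    simp only [ev, MvPolynomial.eval_C]
    exact hasDerivAt_const _ _
  | add p r hp hr =>
    rw [map_add, ev_add]; simp only [ev_add]; exact hp.add hr
  | mul_X p g hp =>
    have hg : HasDerivAt (fun s => ev (gX g) s q t) (ev (ds (gX g)) s q t) s := by
      simp only [ev_X, ds_X]
      cases g with
      | s => simpa [evG, dsG, ev_one] using (hasDerivAt_id s).ofReal_comp
      | q => simpa [evG, dsG, ev_zero] using hasDerivAt_const _ _
      | S => simpa [evG, dsG, ev_zero] using hasDerivAt_const _ _
      | C => simpa [evG, dsG, ev_zero] using hasDerivAt_const _ _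
      | E n =>
        simp only [evG, dsG, En]
        have h1 : HasDerivAt (fun s : ℝ => -Complex.I * (s:ℂ) * (Real.cos t : ℂ))
          (-Complex.I * ((1:ℝ):ℂ) * (Real.cos t : ℂ)) s :=
          ((hasDerivAt_id s).ofReal_comp.const_mul _).mul_const _
        have h2 : HasDerivAt (fun s : ℝ => (q - s ^ 2) * Real.sin t ^ 2)
          ((-(((2:ℕ):ℝ) * s ^ (2-1))) * Real.sin t ^ 2) s :=
          (((hasDerivAt_pow 2 s).const_sub q)).mul_const _
        have h3 := ((Phi_hasDerivAt n _).comp s h2).ofReal_comp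
        refine ((h1.cexp).mul h3).congr_deriv ?_
        simp only [ev_add, ev_mul, ev_neg, ev_I, ev_X, evG, En, ev_two, ev_four, ev_pow, Function.comp]
        push_cast
        ring
    have h4 : HasDerivAt (fun s => ev (p * gX g) s q t) (ev (ds (p * gX g)) s q t) s := by
      simp only [lei, ev_add, ev_mul]
      exact (hp.mul hg).congr_deriv (by ring)
    exact h4

lemma ev_dq (p : Pl) (s q t : ℝ) : HasDerivAt (fun q => ev p s q t) (ev (dq p) s q t) q := by
  induction p using MvPolynomial.induction_on with
  | C a =>
    rw [show dq (MvPolynomial.C a) = 0 from MvPolynomial.derivation_C _ _, ev_zero]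
    simp only [ev, MvPolynomial.eval_C]
    exact hasDerivAt_const _ _
  | add p r hp hr =>
    rw [map_add, ev_add]; simp only [ev_add]; exact hp.add hr
  | mul_X p g hp =>
    have hg : HasDerivAt (fun q => ev (gX g) s q t) (ev (dq (gX g)) s q t) q := by
      simp only [ev_X, dq_X]
      cases g with
      | q => simpa [evG, dqG, ev_one] using (hasDerivAt_id q).ofReal_comp
      | s => simpa [evG, dqG, ev_zero] using hasDerivAt_const _ _
      | S => simpa [evG, dqG, ev_zero] using hasDerivAt_const _ _
      | C => simpa [evG, dqG, ev_zero] using hasDerivAt_const _ _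
      | E n =>
        simp only [evG, dqG, En]
        have h2 : HasDerivAt (fun q : ℝ => (q - s ^ 2) * Real.sin t ^ 2)
          (1 * Real.sin t ^ 2) q :=
          (((hasDerivAt_id q).sub_const _)).mul_const _
        have h3 := ((Phi_hasDerivAt n _).comp q h2).ofReal_comp
        refine (h3.const_mul _).congr_deriv ?_
        simp only [ev_add, ev_mul, ev_neg, ev_I, ev_X, evG, En, ev_two, ev_four, ev_pow, Function.comp]
        push_cast
        ring
    have h4 : HasDerivAt (fun q => ev (p * gX g) s q t) (ev (dq (p * gX g)) s q t) q := by
      simp only [lei, ev_add, ev_mul]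
      exact (hp.mul hg).congr_deriv (by ring)
    exact h4

lemma ev_dt (p : Pl) (s q t : ℝ) : HasDerivAt (fun t => ev p s q t) (ev (dt p) s q t) t := by
  induction p using MvPolynomial.induction_on with
  | C a =>
    rw [show dt (MvPolynomial.C a) = 0 from MvPolynomial.derivation_C _ _, ev_zero]
    simp only [ev, MvPolynomial.eval_C]
    exact hasDerivAt_const _ _
  | add p r hp hr =>
    rw [map_add, ev_add]; simp only [ev_add]; exact hp.add hr
  | mul_X p g hp =>
    have hg : HasDerivAt (fun t => ev (gX g) s q t) (ev (dt (gX g)) s q t) t := by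
      simp only [ev_X, dt_X]
      cases g with
      | q => simpa [evG, dtG, ev_zero] using hasDerivAt_const _ _
      | s => simpa [evG, dtG, ev_zero] using hasDerivAt_const _ _
      | S => simpa only [evG, dtG, ev_X] using (Real.hasDerivAt_sin t).ofReal_comp
      | C => simpa only [evG, dtG, ev_X, ev_neg, Complex.ofReal_neg] using
          (Real.hasDerivAt_cos t).ofReal_comp
      | E n =>
        simp only [evG, dtG, En]
        have h1 : HasDerivAt (fun t : ℝ => -Complex.I * (s:ℂ) * (Real.cos t : ℂ))
          (-Complex.I * (s:ℂ) * ((-Real.sin t : ℝ) : ℂ)) t :=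
          (Real.hasDerivAt_cos t).ofReal_comp.const_mul _
        have h2 : HasDerivAt (fun t : ℝ => (q - s ^ 2) * Real.sin t ^ 2)
          ((q - s ^ 2) * (((2:ℕ):ℝ) * Real.sin t ^ (2-1) * Real.cos t)) t :=
          ((Real.hasDerivAt_sin t).pow 2).const_mul _
        have h3 := ((Phi_hasDerivAt n _).comp t h2).ofReal_comp
        refine ((h1.cexp).mul h3).congr_deriv ?_
        simp only [ev_add, ev_sub, ev_mul, ev_neg, ev_I, ev_X, evG, En, ev_two, ev_four, ev_pow, Function.comp]
        push_cast
        ring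
    have h4 : HasDerivAt (fun t => ev (p * gX g) s q t) (ev (dt (p * gX g)) s q t) t := by
      simp only [lei, ev_add, ev_mul]
      exact (hp.mul hg).congr_deriv (by ring)
    exact h4

lemma ev_cont (p : Pl) : Continuous (fun v : ℝ × ℝ × ℝ => ev p v.1 v.2.1 v.2.2) := by
  induction p using MvPolynomial.induction_on with
  | C a => simp only [ev, MvPolynomial.eval_C]; exact continuous_const
  | add p r hp hr => simp only [ev_add]; exact hp.add hr
  | mul_X p g hp =>
    have hg : Continuous (fun v : ℝ × ℝ × ℝ => ev (gX g) v.1 v.2.1 v.2.2) := by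
      simp only [ev_X]
      cases g with
      | E n =>
        simp only [evG, En]
        have := Phi_continuous n
        fun_prop
      | _ => simp only [evG]; fun_prop
    have : Continuous (fun v : ℝ × ℝ × ℝ => ev (p * gX g) v.1 v.2.1 v.2.2) := by
      simp only [ev_mul]; exact hp.mul hg
    exact this

/-- polynomial growth on the region `s² ≤ q ≤ ρ²`, `1 ≤ ρ` -/
lemma ev_bound (p : Pl) : ∃ (K : ℝ) (N : ℕ), 0 ≤ K ∧ ∀ s q t rho : ℝ, 1 ≤ rho → s ^ 2 ≤ q →
    q ≤ rho ^ 2 → ‖ev p s q t‖ ≤ K * rho ^ N := by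
  induction p using MvPolynomial.induction_on with
  | C a => exact ⟨‖a‖, 0, norm_nonneg _, fun s q t rho _ _ _ => by simp [ev]⟩
  | add p r hp hr =>
    obtain ⟨K, N, hK, h⟩ := hp
    obtain ⟨K', N', hK', h'⟩ := hr
    refine ⟨K + K', N + N', by positivity, fun s q t rho h1 h2 h3 => ?_⟩
    rw [ev_add]
    refine (norm_add_le _ _).trans ?_
    have e1 : rho ^ N ≤ rho ^ (N + N') := pow_le_pow_right₀ h1 (by omega)
    have e2 : rho ^ N' ≤ rho ^ (N + N') := pow_le_pow_right₀ h1 (by omega)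
    have := h s q t rho h1 h2 h3
    have := h' s q t rho h1 h2 h3
    nlinarith
  | mul_X p g hp =>
    obtain ⟨K, N, hK, h⟩ := hp
    have hg : ∃ K' : ℝ, 0 ≤ K' ∧ ∀ s q t rho : ℝ, 1 ≤ rho → s ^ 2 ≤ q →
        q ≤ rho ^ 2 → ‖ev (gX g) s q t‖ ≤ K' * rho ^ 2 := by
      simp only [ev_X]
      cases g with
      | s => exact ⟨1, by norm_num, fun s q t rho h1 h2 h3 => by
          simp only [evG, Complex.norm_real, Real.norm_eq_abs]
          have : |s| ≤ rho := abs_le_of_sq_le_sq (by linarith) (by linarith)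
          nlinarith⟩
      | q => exact ⟨1, by norm_num, fun s q t rho h1 h2 h3 => by
          simp only [evG, Complex.norm_real, Real.norm_eq_abs]
          rw [abs_le]; constructor <;> nlinarith⟩
      | S => exact ⟨1, by norm_num, fun s q t rho h1 h2 h3 => by
          simp only [evG, Complex.norm_real, Real.norm_eq_abs]
          have := Real.abs_sin_le_one t; nlinarith⟩
      | C => exact ⟨1, by norm_num, fun s q t rho h1 h2 h3 => by
          simp only [evG, Complex.norm_real, Real.norm_eq_abs]
          have := Real.abs_cos_le_one t; nlinarith⟩
      | E n =>
        obtain ⟨B, hB⟩ := Phi_bdd n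
        have hB0 : 0 ≤ B := (abs_nonneg _).trans (hB 0 le_rfl)
        refine ⟨B, hB0, fun s q t rho h1 h2 h3 => ?_⟩
        simp only [evG, En, norm_mul, Complex.norm_real, Real.norm_eq_abs]
        rw [show -Complex.I * (s:ℂ) * (Real.cos t : ℂ) = ((-(s * Real.cos t) : ℝ) : ℂ) * Complex.I by
          push_cast; ring, Complex.norm_exp_ofReal_mul_I, one_mul]
        have := hB ((q - s^2) * Real.sin t ^ 2) (mul_nonneg (by linarith) (sq_nonneg _))
        have h4 : 1 ≤ rho ^ 2 := by nlinarith
        nlinarith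
    obtain ⟨K', hK', h'⟩ := hg
    refine ⟨K * K', N + 2, by positivity, fun s q t rho h1 h2 h3 => ?_⟩
    have : ‖ev (p * gX g) s q t‖ ≤ K * K' * rho ^ (N + 2) := by
      rw [ev_mul, norm_mul]
      calc _ ≤ (K * rho ^ N) * (K' * rho ^ 2) :=
            mul_le_mul (h s q t rho h1 h2 h3) (h' s q t rho h1 h2 h3) (norm_nonneg _) (by positivity)
        _ = _ := by ring
    exact this

/-- equality of evaluations -/
def Eqv (p r : Pl) : Prop := ∀ s q t, ev p s q t = ev r s q t

lemma Eqv.ds {p r : Pl} (h : Eqv p r) : Eqv (ds p) (ds r) := fun s q t => by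
  have h1 := ev_ds p s q t
  rw [show (fun s => ev p s q t) = fun s => ev r s q t from funext fun s => h s q t] at h1
  exact h1.unique (ev_ds r s q t)

def cL (n : ℕ) : Pl := (ds^[n]) (gX (.E 0))
def sL (n : ℕ) : Pl := (ds^[n]) (2 * gX .S * gX (.E 1))

lemma cL_succ (n : ℕ) : ds (cL n) = cL (n + 1) := (Function.iterate_succ_apply' _ _ _).symm
lemma sL_succ (n : ℕ) : ds (sL n) = sL (n + 1) := (Function.iterate_succ_apply' _ _ _).symm

lemma En_rec (n : ℕ) (s q t : ℝ) :
    4 * (((q:ℂ) - s ^ 2) * (Real.sin t : ℂ) ^ 2) * En (n + 2) s q t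
      = (4 * n + 2) * En (n + 1) s q t - En n s q t := by
  have h := Phi_rec n ((q - s ^ 2) * Real.sin t ^ 2)
  have h2 : 4 * (((q:ℂ) - s ^ 2) * (Real.sin t : ℂ) ^ 2) * (Phi (n+2) ((q - s ^ 2) * Real.sin t ^ 2) : ℂ)
      = (4 * n + 2) * (Phi (n+1) ((q - s ^ 2) * Real.sin t ^ 2) : ℂ) - (Phi n ((q - s ^ 2) * Real.sin t ^ 2) : ℂ) := by
    have h3 : 4 * ((q - s ^ 2) * Real.sin t ^ 2) * Phi (n+2) ((q - s ^ 2) * Real.sin t ^ 2)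
      = (4 * n + 2) * Phi (n+1) ((q - s ^ 2) * Real.sin t ^ 2) - Phi n ((q - s ^ 2) * Real.sin t ^ 2) := by
      linarith
    exact_mod_cast congrArg (fun x : ℝ => (x : ℂ)) h3
  unfold En
  linear_combination Complex.exp (-Complex.I * s * Real.cos t) * h2

lemma sc_C (t : ℝ) : (Real.sin t : ℂ) ^ 2 + (Real.cos t : ℂ) ^ 2 = 1 := by
  exact_mod_cast congrArg (fun x : ℝ => (x : ℂ)) (Real.sin_sq_add_cos_sq t)

lemma base_t_s : Eqv (dt (sL 0)) (gI * cL 1) := fun s q t => by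
  have h := En_rec 0 s q t
  simp only [sL, cL, Function.iterate_zero, id, Function.iterate_one, lei, dt_X, ds_X, dtG, dsG, d_two,
    ev_add, ev_sub, ev_mul, ev_neg, ev_I, ev_X, evG, ev_two, ev_four, ev_pow, ev_zero, ev_one, zero_add] at *
  simp only [Nat.cast_zero] at h
  linear_combination (-(Real.cos t : ℂ)) * h + (Real.cos t : ℂ) * En 0 s q t * Complex.I_sq

lemma base_t_c : Eqv (dt (cL 0))
    (gI * (gX .s * sL 0 + (gX .s ^ 2 - gX .q) * sL 1)) := fun s q t => by
  have h := En_rec 0 s q t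
  simp only [sL, cL, Function.iterate_zero, id, Function.iterate_one, lei, dt_X, ds_X, dtG, dsG, d_two,
    ev_add, ev_sub, ev_mul, ev_neg, ev_I, ev_X, evG, ev_two, ev_four, ev_pow, ev_zero, ev_one, zero_add] at *
  simp only [Nat.cast_zero] at h
  linear_combination (Complex.I * (Real.sin t : ℂ) * s) * h
    + (2 * (s^2 - q : ℂ) * (Real.sin t : ℂ) * (Real.cos t : ℂ) * En 1 s q t) * Complex.I_sq

lemma d_nat (D : Derivation ℂ Pl Pl) (n : ℕ) : D (n : Pl) = 0 := D.map_natCast n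
lemma d_four (D : Derivation ℂ Pl Pl) : D 4 = 0 := by exact_mod_cast D.map_natCast 4
lemma d_eight (D : Derivation ℂ Pl Pl) : D 8 = 0 := by exact_mod_cast D.map_natCast 8
lemma ev_eight (s q t : ℝ) : ev 8 s q t = 8 := by exact_mod_cast ev_nat 8 s q t

lemma t_s (n : ℕ) : Eqv (dt (sL n)) (gI * cL (n + 1)) := by
  induction n with
  | zero => exact base_t_s
  | succ n ih =>
    have h := ih.ds
    intro s q t
    have := h s q t
    rw [← dt_ds, sL_succ, lei, d_I, cL_succ] at this
    simpa using this

lemma t_c (n : ℕ) : Eqv (dt (cL n))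
    (gI * (((2 * n + 1 : ℕ) : Pl) * gX .s * sL n + (gX .s ^ 2 - gX .q) * sL (n + 1)
      + ((n * n : ℕ) : Pl) * sL (n - 1))) := by
  induction n with
  | zero =>
    intro s q t
    have := base_t_c s q t
    simpa using this
  | succ n ih =>
    intro s q t
    have := ih.ds s q t
    rw [← dt_ds, cL_succ] at this
    rw [this]
    rcases n with _ | n
    · simp only [lei, d_I, map_add, map_sub, dsq, d_nat, ds_X, dsG, sL_succ, ev_add, ev_sub, ev_mul, ev_neg,
        ev_two, ev_pow, ev_zero, ev_one, ev_nat, Nat.add_sub_cancel, Nat.zero_add]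
      push_cast
      ring
    · simp only [lei, d_I, map_add, map_sub, dsq, d_nat, ds_X, dsG, sL_succ, ev_add, ev_sub, ev_mul, ev_neg,
        ev_two, ev_pow, ev_zero, ev_one, ev_nat, Nat.add_sub_cancel]
      push_cast
      ring

/-- Helmholtz operator -/
def Hz (k : ℕ) (p : Pl) : Pl :=
  ds (ds p) + 4 * gX .s * ds (dq p) + 4 * gX .q * dq (dq p) + (k : Pl) * dq p + p

lemma Hz_ds (k : ℕ) (p : Pl) (h : Eqv (Hz k p) 0) : Eqv (Hz (k + 4) (ds p)) 0 := by
  intro s q t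
  have := h.ds s q t
  rw [map_zero, ev_zero] at this
  rw [ev_zero, ← this]
  simp only [Hz, map_add, lei, d_four, d_nat, ds_X, dsG, ← ds_dq, ev_add, ev_mul, ev_zero, ev_one, ev_nat, ev_four]
  push_cast
  ring

lemma Hz_c0 : Eqv (Hz 4 (cL 0)) 0 := by
  intro s q t
  have h := En_rec 0 s q t
  have h2 := sc_C t
  simp only [Hz, cL, sL, Function.iterate_zero, id, Function.iterate_one, map_add, map_sub, map_neg, lei, dsq, ds_X,
    dq_X, dqG, dsG, d_two, d_four, d_I, d_nat,
    ev_add, ev_sub, ev_mul, ev_neg, ev_I, ev_X, evG, ev_two, ev_four, ev_pow, ev_zero, ev_one, zero_add,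
    ev_nat, Nat.cast_zero] at *
  push_cast at *
  linear_combination ((Complex.sin t : ℂ) ^ 2) * h + En 0 s q t * (Complex.cos t)^2 * Complex.I_sq
   - En 0 s q t * h2

lemma Hz_s0 : Eqv (Hz 8 (sL 0)) 0 := by
  intro s q t
  have h := En_rec 1 s q t
  have h2 := sc_C t
  simp only [Hz, cL, sL, Function.iterate_zero, id, Function.iterate_one, map_add, map_sub, map_neg, lei, dsq, ds_X,
    dq_X, dqG, dsG, d_two, d_four, d_I, d_nat,
    ev_add, ev_sub, ev_mul, ev_neg, ev_I, ev_X, evG, ev_two, ev_four, ev_pow, ev_zero, ev_one, zero_add,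
    ev_nat, Nat.cast_one, map_zero] at *
  push_cast at *
  linear_combination (2 * (Complex.sin t : ℂ) ^ 3) * h + 2 * (Complex.sin t) * En 1 s q t * (Complex.cos t)^2 * Complex.I_sq
   - 2 * Complex.sin t * En 1 s q t * h2

lemma Hz_c (n : ℕ) : Eqv (Hz (4 + 4 * n) (cL n)) 0 := by
  induction n with
  | zero => exact Hz_c0
  | succ n ih =>
    have := Hz_ds _ _ ih
    rw [cL_succ] at this
    exact this

lemma Hz_s (n : ℕ) : Eqv (Hz (8 + 4 * n) (sL n)) 0 := by
  induction n with
  | zero => exact Hz_s0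
  | succ n ih =>
    have := Hz_ds _ _ ih
    rw [sL_succ] at this
    exact this

def pa (n : ℕ) : Pl := cL n - (n : Pl) * sL (n - 1)
def pb (n : ℕ) : Pl := sL n

lemma Hz_a (n : ℕ) : Eqv (Hz (4 + 4 * n) (pa n)) 0 := by
  intro s q t
  have h1 := Hz_c n s q t
  rcases n with _ | n
  · have : pa 0 = cL 0 := by simp [pa]
    rw [this]; exact h1
  · have h2 := Hz_s n s q t
    simp only [pa, Hz, Nat.add_sub_cancel, map_sub, lei, d_nat, ev_add, ev_sub, ev_mul, ev_nat, ev_zero, mul_zero, add_zero, map_zero] at *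
    push_cast at *
    linear_combination h1 - ((n:ℂ) + 1) * h2

lemma Hz_b (n : ℕ) : Eqv (Hz (8 + 4 * n) (pb n)) 0 := Hz_s n

lemma t_b (n : ℕ) (s q t : ℝ) : ev (dt (pb n)) s q t
    = Complex.I * (ev (ds (pa n)) s q t + n * ev (pb n) s q t) := by
  have h := t_s n s q t
  unfold pb pa
  rw [h, map_sub, cL_succ, lei, d_nat]
  rcases n with _ | n
  · simp [ev_mul, ev_I, ev_sub, ev_nat, ev_add, ev_zero]
  · rw [Nat.add_sub_cancel, sL_succ]
    simp only [ev_mul, ev_I, ev_sub, ev_nat, ev_add, ev_zero]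
    ring

lemma t_a (n : ℕ) (s q t : ℝ) : ev (dt (pa n)) s q t
    = Complex.I * ((2 * n + 1) * s * ev (pb n) s q t + (s ^ 2 - q) * ev (ds (pb n)) s q t
        - n * ev (pa n) s q t) := by
  have h := t_c n s q t
  unfold pb pa
  rw [map_sub, ev_sub, h, sL_succ, lei, d_nat]
  rcases n with _ | n
  · simp [ev_mul, ev_I, ev_sub, ev_nat, ev_add, ev_zero, ev_X, evG, ev_pow]
  · have h2 := t_s n s q t
    simp only [Nat.add_sub_cancel, ev_add, ev_mul, h2]
    simp only [ev_mul, ev_I, ev_sub, ev_nat, ev_add, ev_zero, ev_X, evG, ev_pow]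
    push_cast
    ring

/-! ### Bessel coefficients -/

def bt (N : ℕ) (q : ℝ) : ℝ :=
  ∑' j : ℕ, (-1) ^ j * (q / 4) ^ j / ((j.factorial : ℝ) * ((j + N).factorial : ℝ) * 2 ^ N)

lemma bt_term_le (N : ℕ) (q : ℝ) (j : ℕ) :
    ‖(-1) ^ j * (q / 4) ^ j / ((j.factorial : ℝ) * ((j + N).factorial : ℝ) * 2 ^ N)‖
      ≤ (|q| / 4) ^ j / (j.factorial : ℝ) * (1 / (N.factorial : ℝ)) := by
  rw [norm_div, norm_mul, norm_pow, norm_neg, norm_one, one_pow, one_mul, norm_pow, norm_div]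
  rw [Real.norm_eq_abs, Real.norm_of_nonneg (by norm_num : (0:ℝ) ≤ 4),
    Real.norm_of_nonneg (by positivity), div_mul_div_comm, mul_one]
  have h1 : (N.factorial : ℝ) ≤ ((j + N).factorial : ℝ) := by
    exact_mod_cast Nat.factorial_le (by omega)
  have h2 : (1:ℝ) ≤ 2 ^ N := one_le_pow₀ (by norm_num)
  refine div_le_div_of_nonneg_left (by positivity) (by positivity) ?_
  rw [mul_assoc]
  refine mul_le_mul_of_nonneg_left ?_ (by positivity)
  nlinarith [(by positivity : (0:ℝ) < (N.factorial : ℝ))]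

lemma bt_maj (N : ℕ) (q : ℝ) :
    HasSum (fun j : ℕ => (|q| / 4) ^ j / (j.factorial : ℝ) * (1 / (N.factorial : ℝ)))
      (Real.exp (|q| / 4) * (1 / (N.factorial : ℝ))) := by
  refine HasSum.mul_right _ ?_
  have := NormedSpace.expSeries_div_hasSum_exp (|q| / 4)
  rwa [← Real.exp_eq_exp_ℝ] at this

lemma bt_summable (N : ℕ) (q : ℝ) : Summable (fun j : ℕ =>
    (-1) ^ j * (q / 4) ^ j / ((j.factorial : ℝ) * ((j + N).factorial : ℝ) * 2 ^ N)) :=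
  Summable.of_norm_bounded (bt_maj N q).summable (bt_term_le N q)

lemma bt_le (N : ℕ) (q : ℝ) : |bt N q| ≤ Real.exp (|q| / 4) * (1 / (N.factorial : ℝ)) :=
  tsum_of_norm_bounded (bt_maj N q) (bt_term_le N q)

lemma besselJt_eq (k n : ℕ) (z : ℝ) : besselJt ((k:ℝ) + (n:ℝ)) z = bt (k + n) (z ^ 2) := by
  unfold besselJt bt
  refine tsum_congr fun j => ?_
  have h1 : Real.Gamma ((j:ℝ) + ((k:ℝ) + (n:ℝ)) + 1) = ((j + (k + n)).factorial : ℝ) := by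
    rw [← Real.Gamma_nat_eq_factorial]; push_cast; rfl
  have h2 : (2:ℝ) ^ ((k:ℝ) + (n:ℝ)) = 2 ^ (k + n) := by
    rw [← Nat.cast_add, Real.rpow_natCast]
  rw [h1, h2, pow_mul]
  congr 3
  ring

/-! ### homogeneous Gegenbauer polynomials -/

def Pk (l : ℝ) : ℕ → ℝ → ℝ → ℝ
  | 0, _, _ => 1
  | 1, s, _ => 2 * l * s
  | (k+2), s, q => (2 * ((k : ℝ) + 1 + l) * s * Pk l (k+1) s q
      - ((k : ℝ) + 2 * l) * q * Pk l k s q) / ((k : ℝ) + 2)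

lemma Pk_rec (l : ℝ) (k : ℕ) (s q : ℝ) : ((k:ℝ) + 2) * Pk l (k+2) s q =
    2 * ((k : ℝ) + 1 + l) * s * Pk l (k+1) s q - ((k : ℝ) + 2 * l) * q * Pk l k s q := by
  rw [Pk]; field_simp

lemma Pk_geg (l : ℝ) (k : ℕ) (w z : ℝ) : z ^ k * geg l k w = Pk l k (z * w) (z ^ 2) := by
  induction k using Nat.twoStepInduction with
  | zero => simp [geg, Pk]
  | one => simp [geg, Pk]; ring
  | more k h1 h2 =>
    rw [geg, Pk, ← h1, ← h2]
    field_simp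
    ring

lemma Pk_two (l : ℝ) (hl : 0 ≤ l) (k : ℕ) (s q : ℝ) :
    l * (Pk (l+1) (k+2) s q - q * Pk (l+1) k s q) = ((k:ℝ) + 2 + l) * Pk l (k+2) s q := by
  induction k using Nat.twoStepInduction with
  | zero => simp [Pk]; ring
  | one => simp [Pk]; ring
  | more k h1 h2 =>
    have r1 := Pk_rec l (k+2) s q
    have r2 := Pk_rec (l+1) (k+2) s q
    have r3 := Pk_rec (l+1) k s q
    push_cast at *
    rw [show k + 2 + 1 = k + 3 by ring, show k + 1 + 2 = k + 3 by ring] at *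
    set X2 := Pk (l+1) (k+2) s q
    set X1 := Pk (l+1) (k+1) s q
    set X0 := Pk (l+1) k s q
    have h3 : Pk l (k+2) s q = X2 - 2 * s * X1 + q * X0 := by
      have : ((k:ℝ) + 2 + l) ≠ 0 := by positivity
      apply mul_left_cancel₀ this
      rw [← h1]
      linear_combination -r3
    have hk : ((k:ℝ) + 2 + 2) ≠ 0 := by positivity
    apply mul_left_cancel₀ hk
    linear_combination (-((k:ℝ) + 2 + 2 + l)) * r1 + l * r2 + 2 * s * ((k:ℝ) + 2 + 2 + l) * h2
      + q * ((k:ℝ) + 2 + 2 + l) * (h1 - l * h3) * (-1)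

lemma Pk_deriv (l : ℝ) (hl : 0 ≤ l) (k : ℕ) (s q : ℝ) :
    HasDerivAt (fun s => Pk l k s q) (if k = 0 then 0 else 2 * l * Pk (l + 1) (k - 1) s q) s := by
  induction k using Nat.twoStepInduction with
  | zero => simpa [Pk] using hasDerivAt_const _ _
  | one => simpa [Pk] using (hasDerivAt_id s).const_mul (2 * l)
  | more k h1 h2 =>
    simp only [Pk]
    have h : HasDerivAt (fun s => (2 * ((k : ℝ) + 1 + l) * s * Pk l (k+1) s q
      - ((k : ℝ) + 2 * l) * q * Pk l k s q) / ((k : ℝ) + 2)) _ s :=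
      (((((hasDerivAt_id s).const_mul (2 * ((k : ℝ) + 1 + l))).mul h2).sub
        (h1.const_mul (((k : ℝ) + 2 * l) * q)))).div_const _
    refine h.congr_deriv ?_
    rw [div_eq_iff (by positivity)]
    rcases k with _ | k
    · simp [Pk]; ring
    · have e1 := Pk_two l hl k s q
      have e2 := Pk_rec (l+1) k s q
      simp only [Nat.add_sub_cancel, if_neg (Nat.succ_ne_zero _), id, show k + 1 + 1 = k + 2 by ring,
        show k + 1 + 2 - 1 = k + 2 by omega]
      push_cast
      linear_combination (-2) * e1 - 2 * l * e2

lemma Pk_bound (l : ℝ) (hl : 0 ≤ l) (R : ℝ) (hR : 0 ≤ R) (k : ℕ) (s q : ℝ) (hs : |s| ≤ R)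
    (hq : |q| ≤ R) : |Pk l k s q| ≤ (4 * (1 + l) * R + 1) ^ k := by
  set M := 4 * (1 + l) * R + 1 with hM
  have hlR : 0 ≤ l * R := by positivity
  have hM1 : 1 ≤ M := by nlinarith
  induction k using Nat.twoStepInduction with
  | zero => simp [Pk]
  | one =>
    simp only [Pk, pow_one]
    rw [abs_mul, abs_of_nonneg (by positivity : 0 ≤ 2 * l)]
    nlinarith
  | more k h1 h2 =>
    rw [Pk, abs_div, abs_of_pos (by positivity : (0:ℝ) < (k:ℝ) + 2), div_le_iff₀ (by positivity)]
    refine (abs_sub _ _).trans ?_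
    rw [abs_mul _ (Pk l (k+1) s q), abs_mul _ s, abs_mul _ (Pk l k s q), abs_mul _ q,
      abs_of_nonneg (by positivity : 0 ≤ 2 * ((k:ℝ) + 1 + l)),
      abs_of_nonneg (by positivity : 0 ≤ (k:ℝ) + 2 * l)]
    have hp : 0 ≤ M ^ k := by positivity
    have a1 : |s| * |Pk l (k+1) s q| ≤ R * M ^ (k + 1) := mul_le_mul hs h2 (abs_nonneg _) hR
    have a2 : |q| * |Pk l k s q| ≤ R * M ^ k := mul_le_mul hq h1 (abs_nonneg _) hR
    have hk : (0:ℝ) ≤ k := by positivity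
    calc _ = 2 * ((k:ℝ) + 1 + l) * (|s| * |Pk l (k+1) s q|) + ((k:ℝ) + 2 * l) * (|q| * |Pk l k s q|) := by ring
      _ ≤ 2 * ((k:ℝ) + 1 + l) * (R * M ^ (k+1)) + ((k:ℝ) + 2 * l) * (R * M ^ k) := by gcongr
      _ = M ^ k * (2 * ((k:ℝ) + 1 + l) * R * M + ((k:ℝ) + 2 * l) * R) := by ring
      _ ≤ M ^ k * (M ^ 2 * ((k:ℝ) + 2)) := by
        refine mul_le_mul_of_nonneg_left ?_ hp
        have b1 : ((k:ℝ) + 2 * l) * R ≤ ((k:ℝ) + 2 * l) * R * M := le_mul_of_one_le_right (by positivity) hM1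
        have b2 : 2 * ((k:ℝ) + 1 + l) * R + ((k:ℝ) + 2 * l) * R ≤ M * ((k:ℝ) + 2) := by
          rw [hM]; nlinarith [mul_nonneg hk hR, mul_nonneg hk hlR]
        calc _ ≤ (2 * ((k:ℝ) + 1 + l) * R + ((k:ℝ) + 2 * l) * R) * M := by linarith
          _ ≤ (M * ((k:ℝ) + 2)) * M := by gcongr
          _ = _ := by ring
      _ = _ := by ring

/-! ### differentiating the series in `s` -/

lemma ser_summable (w : ℕ → ℝ) (hw : ∀ k, |w k| ≤ 2) (N : ℕ) (q : ℝ) (X : ℕ → ℝ)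
    (K M : ℝ) (hK : 0 ≤ K) (hM : 0 ≤ M) (hX : ∀ k, |X k| ≤ K * M ^ k) :
    (∀ k, ‖w k * bt (k + N) q * X k‖ ≤ 2 * Real.exp (|q| / 4) * K * (M ^ k / (k.factorial : ℝ))) ∧
    Summable (fun k => w k * bt (k + N) q * X k) := by
  have h : ∀ k, ‖w k * bt (k + N) q * X k‖ ≤ 2 * Real.exp (|q| / 4) * K * (M ^ k / (k.factorial : ℝ)) := by
    intro k
    rw [norm_mul, norm_mul, Real.norm_eq_abs, Real.norm_eq_abs, Real.norm_eq_abs]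
    have h1 := bt_le (k + N) q
    have h2 : 1 / ((k + N).factorial : ℝ) ≤ 1 / (k.factorial : ℝ) := by
      apply one_div_le_one_div_of_le (by positivity)
      exact_mod_cast Nat.factorial_le (by omega)
    calc _ ≤ 2 * (Real.exp (|q| / 4) * (1 / (k.factorial : ℝ))) * (K * M ^ k) := by
          gcongr
          · exact hw k
          · exact h1.trans (by gcongr)
          · exact hX k
      _ = _ := by ring
  exact ⟨h, Summable.of_norm_bounded ((Real.summable_pow_div_factorial M).mul_left _) h⟩

lemma ser_deriv (w : ℕ → ℝ) (hw : ∀ k, |w k| ≤ 2) (N : ℕ) (q : ℝ) (X X' : ℕ → ℝ → ℝ)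
    (s R K M : ℝ) (hs : |s| < R) (hK : 0 ≤ K) (hM : 0 ≤ M)
    (hd : ∀ k s, HasDerivAt (X k) (X' k s) s)
    (hX : ∀ k s, |s| ≤ R → |X k s| ≤ K * M ^ k) (hX' : ∀ k s, |s| ≤ R → |X' k s| ≤ K * M ^ k) :
    HasDerivAt (fun s => ∑' k, w k * bt (k + N) q * X k s) (∑' k, w k * bt (k + N) q * X' k s) s := by
  refine hasDerivAt_tsum_of_isPreconnected (t := Metric.ball (0:ℝ) R)
    (u := fun k => 2 * Real.exp (|q| / 4) * K * (M ^ k / (k.factorial : ℝ)))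
    (g := fun k s => w k * bt (k + N) q * X k s) (g' := fun k s => w k * bt (k + N) q * X' k s)
    (y₀ := s) ((Real.summable_pow_div_factorial M).mul_left _) Metric.isOpen_ball
    (convex_ball (0:ℝ) R).isPreconnected (fun k y _ => (hd k y).const_mul _) ?_ (by simpa using hs)
    ((ser_summable w hw N q (fun k => X k s) K M hK hM (fun k => hX k s hs.le)).2) (by simpa using hs)
  intro k y hy
  have hy' : |y| ≤ R := by simpa using (mem_ball_zero_iff.1 hy).le
  exact (ser_summable w hw N q (fun k => X' k y) K M hK hM (fun k => hX' k y hy')).1 k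

/-! ### the base case -/

def splitEquiv : (ℕ × ℕ) ⊕ (ℕ × ℕ) ≃ ℕ × ℕ where
  toFun := Sum.elim (fun p => (p.2 + p.1, p.2)) (fun p => (p.2, p.2 + (p.1 + 1)))
  invFun p := if p.2 ≤ p.1 then Sum.inl (p.1 - p.2, p.2) else Sum.inr (p.2 - p.1 - 1, p.1)
  left_inv := by
    rintro (⟨k, j⟩ | ⟨k, j⟩)
    · simp
    · simp
  right_inv := by
    rintro ⟨i, j⟩
    by_cases h : j ≤ i
    · simp [h]
    · simp only [h, if_false, Sum.elim_inr, Prod.mk.injEq, true_and]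
      omega

def hk (q : ℝ) (k : ℕ) : ℂ := ((2 ^ k * bt k q : ℝ) : ℂ)

lemma hk_hasSum (q : ℝ) (k : ℕ) :
    HasSum (fun j : ℕ => (-(q / 4 : ℂ)) ^ j / ((j.factorial : ℂ) * ((j + k).factorial : ℂ))) (hk q k) := by
  have h := (bt_summable k q).hasSum.mul_left (2 ^ k)
  have h2 := h.map Complex.ofRealCLM Complex.ofRealCLM.continuous
  refine hs_congrC h2 fun j => ?_
  simp only [Function.comp, Complex.ofRealCLM_apply]
  have h3 : (j.factorial : ℂ) ≠ 0 := by exact_mod_cast Nat.factorial_ne_zero _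
  have h4 : ((j + k).factorial : ℂ) ≠ 0 := by exact_mod_cast Nat.factorial_ne_zero _
  push_cast
  rw [neg_pow]
  field_simp

lemma hasSum_prod_mul {f g : ℕ → ℂ} {A B : ℂ} (hf : HasSum f A) (hg : HasSum g B)
    (hf' : Summable fun n => ‖f n‖) (hg' : Summable fun n => ‖g n‖) :
    HasSum (fun p : ℕ × ℕ => f p.1 * g p.2) (A * B) := by
  have h1 : Summable (fun p : ℕ × ℕ => f p.1 * g p.2) := summable_mul_of_summable_norm hf' hg'
  have h2 := tsum_mul_tsum_of_summable_norm hf' hg'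
  rw [hf.tsum_eq, hg.tsum_eq] at h2
  rw [h2]
  exact h1.hasSum

def ex (z : ℂ) (n : ℕ) : ℂ := z ^ n / (n.factorial : ℂ)

lemma ex_hasSum (z : ℂ) : HasSum (ex z) (Complex.exp z) := by
  have := NormedSpace.expSeries_div_hasSum_exp z
  rwa [← Complex.exp_eq_exp_ℂ] at this

lemma ex_norm (z : ℂ) : Summable fun n => ‖ex z n‖ := NormedSpace.norm_expSeries_div_summable z

lemma split_sum (F : ℕ × ℕ → ℂ) (A : ℂ) (hF : HasSum F A) (u v : ℕ → ℂ)
    (hu : ∀ k, HasSum (fun j => F (j + k, j)) (u k))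
    (hv : ∀ k, HasSum (fun j => F (j, j + (k + 1))) (v k)) :
    HasSum (fun k => u k + v k) A := by
  have h1 := (splitEquiv.hasSum_iff (f := F)).2 hF
  have hs := h1.summable
  have hl := hs.comp_injective (Sum.inl_injective (β := ℕ × ℕ))
  have hr := hs.comp_injective (Sum.inr_injective (α := ℕ × ℕ))
  have htot := hl.hasSum.sum hr.hasSum
  have heq := htot.unique h1
  have f1 := HasSum.prod_fiberwise hl.hasSum hu
  have f2 := HasSum.prod_fiberwise hr.hasSum hv
  have := f1.add f2
  rwa [heq] at this

lemma exp_split (q : ℝ) (a b : ℂ) (hab : a * b = q / 4) :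
    HasSum (fun k : ℕ => a ^ k * hk q k + (-b) ^ (k + 1) * hk q (k + 1)) (Complex.exp (a - b)) := by
  have hnab : (-b) * a = -(q / 4 : ℂ) := by rw [← hab]; ring
  have hprod : HasSum (fun p : ℕ × ℕ => ex a p.1 * ex (-b) p.2) (Complex.exp (a - b)) := by
    rw [sub_eq_add_neg, Complex.exp_add]
    exact hasSum_prod_mul (ex_hasSum a) (ex_hasSum (-b)) (ex_norm a) (ex_norm (-b))
  refine split_sum _ _ hprod _ _ (fun k => ?_) (fun k => ?_)
  · refine hs_congrC ((hk_hasSum q k).mul_left (a ^ k)) fun j => ?_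
    simp only [ex]
    rw [← hnab, mul_pow, pow_add]
    have h3 : (j.factorial : ℂ) ≠ 0 := by exact_mod_cast Nat.factorial_ne_zero _
    have h4 : ((j + k).factorial : ℂ) ≠ 0 := by exact_mod_cast Nat.factorial_ne_zero _
    field_simp
  · refine hs_congrC ((hk_hasSum q (k + 1)).mul_left ((-b) ^ (k + 1))) fun j => ?_
    simp only [ex]
    rw [← hnab, mul_pow, pow_add (-b) j]
    have h3 : (j.factorial : ℂ) ≠ 0 := by exact_mod_cast Nat.factorial_ne_zero _
    have h4 : ((j + (k + 1)).factorial : ℂ) ≠ 0 := by exact_mod_cast Nat.factorial_ne_zero _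
    field_simp

lemma exists_roots (s q : ℝ) : ∃ a b : ℂ, a + b = s ∧ a * b = q / 4 ∧ (a - b) ^ 2 = (s:ℂ) ^ 2 - q := by
  obtain ⟨d, hd⟩ := IsAlgClosed.exists_pow_nat_eq ((s:ℂ) ^ 2 - q) (n := 2) (by norm_num)
  refine ⟨(s + d) / 2, (s - d) / 2, by ring, by linear_combination (-1/4) * hd, by rw [← hd]; ring⟩

lemma cosh_Phi (r : ℝ) (d : ℂ) (hd : d ^ 2 = -(r:ℂ)) : Complex.cosh d = (Phi 0 r : ℂ) := by
  refine (Complex.hasSum_cosh d).unique ?_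
  have h := (egf_hasSum (pc 0) (pc_abs 0) r).map Complex.ofRealCLM Complex.ofRealCLM.continuous
  refine hs_congrC h fun j => ?_
  simp only [Function.comp, Complex.ofRealCLM_apply, pc, dk, add_zero]
  have h3 : (j.factorial : ℂ) ≠ 0 := by exact_mod_cast Nat.factorial_ne_zero _
  have h4 : ((2*j).factorial : ℂ) ≠ 0 := by exact_mod_cast Nat.factorial_ne_zero _
  rw [pow_mul, hd, neg_pow]
  push_cast
  field_simp

lemma sinh_Phi (r : ℝ) (d : ℂ) (hd : d ^ 2 = -(r:ℂ)) : Complex.sinh d = d * (2 * (Phi 1 r : ℂ)) := by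
  refine (Complex.hasSum_sinh d).unique ?_
  have h := ((egf_hasSum (pc 1) (pc_abs 1) r).map Complex.ofRealCLM Complex.ofRealCLM.continuous).mul_left (d * 2)
  rw [← mul_assoc]
  refine hs_congrC h fun j => ?_
  simp only [Function.comp, Complex.ofRealCLM_apply, pc, dk]
  have h3 : (j.factorial : ℂ) ≠ 0 := by exact_mod_cast Nat.factorial_ne_zero _
  have h4 : ((2*j+1).factorial : ℂ) ≠ 0 := by exact_mod_cast Nat.factorial_ne_zero _
  have h5 : (j : ℂ) + 1 ≠ 0 := by exact_mod_cast Nat.succ_ne_zero j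
  rw [pow_succ, pow_mul, hd, neg_pow, show 2 * (j+1) = 2*j+1+1 by ring, Nat.factorial_succ j, Nat.factorial_succ (2*j+1)]
  push_cast
  rw [show (2 * (j:ℂ) + 1 + 1) = 2 * (j + 1) by ring]
  field_simp

/-! power sums -/
def TT (l : ℝ) (k : ℕ) (s q : ℝ) : ℝ :=
  Pk (l + 1) k s q - (if 2 ≤ k then q * Pk (l + 1) (k - 2) s q else 0)

lemma P1_rec (k : ℕ) (s q : ℝ) : Pk 1 (k+2) s q = 2 * s * Pk 1 (k+1) s q - q * Pk 1 k s q := by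
  have h := Pk_rec 1 k s q
  have hk : ((k:ℝ) + 2) ≠ 0 := by positivity
  apply mul_left_cancel₀ hk
  linear_combination h

lemma Pk_diff (s q : ℝ) (a b : ℂ) (h1 : a + b = s) (h2 : a * b = q / 4) (k : ℕ) :
    2 ^ k * (a ^ (k+1) - b ^ (k+1)) = (a - b) * (Pk 1 k s q : ℂ) := by
  induction k using Nat.twoStepInduction with
  | zero => simp [Pk]
  | one => simp [Pk]; rw [← h1]; ring
  | more k e1 e2 =>
    rw [P1_rec]
    push_cast
    have hq : (q:ℂ) = 4 * (a * b) := by rw [h2]; ring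
    have : (a - b) * (2 * (s:ℂ) * (Pk 1 (k+1) s q : ℂ) - q * (Pk 1 k s q : ℂ))
      = 2 * s * ((a - b) * (Pk 1 (k+1) s q : ℂ)) - q * ((a - b) * (Pk 1 k s q : ℂ)) := by ring
    rw [this, ← e1, ← e2, ← h1, hq]
    ring

lemma TT_sum (s q : ℝ) (a b : ℂ) (h1 : a + b = s) (h2 : a * b = q / 4) (k : ℕ) :
    2 ^ (k+1) * (a ^ (k+1) + b ^ (k+1)) = (TT 0 (k+1) s q : ℂ) := by
  have hq : (q:ℂ) = 4 * (a * b) := by rw [h2]; ring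
  induction k using Nat.twoStepInduction with
  | zero => simp [TT, Pk]; rw [← h1]
  | one =>
    simp [TT, Pk]; rw [← h1, hq]; ring
  | more k e1 e2 =>
    have : TT 0 (k+2+1) s q = 2 * s * TT 0 (k+1+1) s q - q * TT 0 (k+1) s q := by
      rcases k with _ | k
      · simp [TT, Pk]; ring
      · simp only [TT, zero_add]
        rw [if_pos (by omega), if_pos (by omega), if_pos (by omega)]
        rw [show k + 1 + 2 + 1 - 2 = k + 2 by omega, show k + 1 + 1 + 1 - 2 = k + 1 by omega,
          show k + 1 + 1 - 2 = k by omega, show k + 1 + 2 + 1 = (k+2)+2 by ring, P1_rec (k+2), P1_rec k]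
        rw [show k + 1 + 1 + 1 = k + 2 + 1 by ring]
        ring_nf
    rw [this]
    push_cast
    rw [← e1, ← e2, ← h1, hq]
    ring

lemma shift_sum {F G : ℕ → ℂ} {A : ℂ} (hF : Summable F) (h : HasSum (fun k => F k + G (k + 1)) A) :
    HasSum (fun k => F (k + 1) + G (k + 1)) (A - F 0) := by
  have h1 := h.sub hF.hasSum
  have h2 := (hasSum_nat_add_iff' 1).2 hF.hasSum
  have h3 := h1.add h2
  have e : A - ∑' k, F k + (∑' k, F k - ∑ i ∈ Finset.range 1, F i) = A - F 0 := by simp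
  rw [e] at h3
  exact hs_congrC h3 fun k => by ring

lemma hk_summable (q : ℝ) (a : ℂ) (c : ℕ → ℂ) (hc : ∀ k, ‖c k‖ ≤ 2) :
    Summable (fun k => c k * (a ^ k * hk q k)) := by
  refine Summable.of_norm_bounded
    (g := fun k => 2 * Real.exp (|q| / 4) * ((2 * ‖a‖) ^ k / (k.factorial : ℝ)))
    ((Real.summable_pow_div_factorial _).mul_left _) fun k => ?_
  have h1 := bt_le k q
  have h2 : ‖hk q k‖ ≤ 2 ^ k * (Real.exp (|q| / 4) * (1 / (k.factorial : ℝ))) := by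
    rw [hk, Complex.norm_real, norm_mul, norm_pow, Real.norm_of_nonneg (by norm_num : (0:ℝ) ≤ 2), Real.norm_eq_abs]
    gcongr
  rw [norm_mul, norm_mul, norm_pow]
  calc _ ≤ 2 * (‖a‖ ^ k * (2 ^ k * (Real.exp (|q| / 4) * (1 / (k.factorial : ℝ))))) := by
        gcongr
        exact hc k
    _ = _ := by rw [mul_pow]; ring

lemma neg1_norm (k : ℕ) : ‖(1 + (-1) ^ k : ℂ)‖ ≤ 2 := by
  rcases Nat.even_or_odd k with h | h <;> simp [h.neg_one_pow] ; norm_num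
lemma neg1_norm' (k : ℕ) : ‖(1 - (-1) ^ k : ℂ)‖ ≤ 2 := by
  rcases Nat.even_or_odd k with h | h <;> simp [h.neg_one_pow] ; norm_num

lemma shift_sum' (F G H P : ℕ → ℂ) {A B : ℂ} (hF : Summable F) (h : HasSum P A)
    (hP : ∀ k, P k = F k + G (k + 1)) (hH : ∀ k, H k = F (k + 1) + G (k + 1)) (hB : B = A - F 0) :
    HasSum H B := by
  rw [hB]
  exact hs_congrC (shift_sum hF (hs_congrC h fun k => (hP k).symm)) hH

lemma cosh_sum (q : ℝ) (a b : ℂ) (hab : a * b = q / 4) :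
    HasSum (fun k : ℕ => (1 + (-1) ^ (k+1)) * hk q (k+1) * (a ^ (k+1) + b ^ (k+1)))
      (2 * Complex.cosh (a - b) - 2 * hk q 0) := by
  have h1 := exp_split q a b hab
  have h2 := exp_split q (-a) (-b) (by rw [← hab]; ring)
  have hs := hk_summable q a (fun k => 1 + (-1) ^ k) neg1_norm
  generalize hk q = h at *
  refine shift_sum' _ (fun k => (1 + (-1) ^ k) * (b ^ k * h k)) _ _ hs (h1.add h2) ?_ ?_ ?_
  · intro k
    simp only [neg_neg]
    rw [neg_pow a, neg_pow b]; ring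
  · intro k; ring
  · rw [Complex.two_cosh, neg_sub, show b - a = -a - -b by ring, pow_zero, pow_zero]; ring

lemma sinh_sum (q : ℝ) (a b : ℂ) (hab : a * b = q / 4) :
    HasSum (fun k : ℕ => (1 - (-1) ^ (k+1)) * hk q (k+1) * (a ^ (k+1) - b ^ (k+1)))
      (2 * Complex.sinh (a - b)) := by
  have h1 := exp_split q a b hab
  have h2 := exp_split q (-a) (-b) (by rw [← hab]; ring)
  have hs := hk_summable q a (fun k => 1 - (-1) ^ k) neg1_norm'
  generalize hk q = h at *
  refine shift_sum' _ (fun k => -((1 - (-1) ^ k) * (b ^ k * h k))) _ _ hs (h1.sub h2) ?_ ?_ ?_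
  · intro k
    simp only [neg_neg]
    rw [neg_pow a, neg_pow b]; ring
  · intro k; ring
  · rw [Complex.two_sinh, neg_sub, show b - a = -a - -b by ring, pow_zero, pow_zero]; ring

/-! the series -/
def SS (u : ℝ) (n : ℕ) (s q : ℝ) : ℝ := ∑' k : ℕ, (u - (-1) ^ k) * bt (k + (n + 1)) q * Pk ((n:ℝ) + 1) k s q
def SB (u : ℝ) (n : ℕ) (s q : ℝ) : ℝ := ∑' k : ℕ, (u - (-1) ^ k) * bt (k + n) q * TT n k s q

lemma wt_le {u : ℝ} (hu : |u| ≤ 1) (k : ℕ) : |u - (-1) ^ k| ≤ 2 := by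
  refine (abs_sub _ _).trans ?_
  rw [abs_pow, abs_neg, abs_one, one_pow]; linarith

lemma TT_bound (l : ℝ) (hl : 0 ≤ l) (R : ℝ) (hR : 1 ≤ R) (k : ℕ) (s q : ℝ) (hs : |s| ≤ R)
    (hq : |q| ≤ R) : |TT l k s q| ≤ (1 + R) * (4 * (2 + l) * R + 1) ^ k := by
  have h : ∀ k, |Pk (l+1) k s q| ≤ (4 * (2 + l) * R + 1) ^ k := fun k => by
    have := Pk_bound (l+1) (by linarith) R (by linarith) k s q hs hq
    rwa [show 1 + (l + 1) = 2 + l by ring] at this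
  have hM : 1 ≤ 4 * (2 + l) * R + 1 := by
    have : 0 ≤ (2 + l) * R := by positivity
    linarith
  rw [TT]
  refine (abs_sub _ _).trans ?_
  rw [add_mul, one_mul]
  refine add_le_add (h k) ?_
  split_ifs with h2
  · rw [abs_mul]
    refine mul_le_mul hq ((h _).trans (pow_le_pow_right₀ hM (by omega))) (abs_nonneg _) (by linarith)
  · simp; positivity

def dPk (l : ℝ) (k : ℕ) (s q : ℝ) : ℝ := if k = 0 then 0 else 2 * l * Pk (l + 1) (k - 1) s q
def dTT (l : ℝ) (k : ℕ) (s q : ℝ) : ℝ := if k = 0 then 0 else 2 * (l + 1) * TT (l + 1) (k - 1) s q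

lemma TT_deriv (l : ℝ) (hl : 0 ≤ l) (k : ℕ) (s q : ℝ) :
    HasDerivAt (fun s => TT l k s q) (dTT l k s q) s := by
  have h1 := Pk_deriv (l+1) (by linarith) k s q
  unfold TT dTT
  by_cases h2 : 2 ≤ k
  · have h3 := Pk_deriv (l+1) (by linarith) (k-2) s q
    simp only [h2, if_true]
    refine (h1.sub (h3.const_mul q)).congr_deriv ?_
    rw [if_neg (by omega), if_neg (by omega : ¬ k = 0)]
    by_cases h4 : k = 2
    · subst h4; simp [TT]
    · rw [if_neg (by omega), TT, if_pos (by omega), show k - 1 - 2 = k - 2 - 1 by omega]; ring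
  · simp only [h2, if_false, sub_zero]
    refine h1.congr_deriv ?_
    by_cases h4 : k = 0
    · simp [h4]
    · have : k = 1 := by omega
      subst this; simp [TT]

lemma tsum_shift (w : ℕ → ℝ) (h0 : w 0 = 0) (hw : Summable w) : ∑' k, w k = ∑' k, w (k+1) := by
  rw [hw.tsum_eq_zero_add, h0, zero_add]

lemma SS_deriv (u : ℝ) (hu : |u| ≤ 1) (n : ℕ) (s q : ℝ) :
    HasDerivAt (fun s => SS u n s q) (-(2 * (n + 1)) * SS (-u) (n + 1) s q) s := by
  set R : ℝ := |s| + |q| + 1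
  have hR : 1 ≤ R := by simp only [R]; linarith [abs_nonneg s, abs_nonneg q]
  have hq : |q| ≤ R := by simp only [R]; linarith [abs_nonneg s, abs_nonneg q]
  have hs : |s| < R := by simp only [R]; linarith [abs_nonneg s, abs_nonneg q]
  set M : ℝ := 4 * (3 + n) * R + 1
  have hM : 1 ≤ M := by
    have : 0 ≤ (3 + (n:ℝ)) * R := by positivity
    simp only [M]; linarith
  have b1 : ∀ k s, |s| ≤ R → |Pk ((n:ℝ)+1) k s q| ≤ (2 * (n + 1)) * M ^ k := fun k s hs => by
    refine (Pk_bound _ (by positivity) R (by linarith) k s q hs hq).trans ?_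
    have : (4 * (1 + ((n:ℝ)+1)) * R + 1) ^ k ≤ M ^ k := by
      simp only [M]; gcongr ?_ ^ k; nlinarith
    refine this.trans (le_mul_of_one_le_left (by positivity) (by linarith [(Nat.cast_nonneg n : (0:ℝ) ≤ n)]))
  have b2 : ∀ k s, |s| ≤ R → |dPk ((n:ℝ)+1) k s q| ≤ (2 * (n + 1)) * M ^ k := fun k s hs => by
    unfold dPk
    split_ifs
    · simp; positivity
    · rw [abs_mul, abs_of_nonneg (by positivity : 0 ≤ 2 * ((n:ℝ) + 1))]
      have h1 := Pk_bound ((n:ℝ)+1+1) (by positivity) R (by linarith) (k-1) s q hs hq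
      rw [show 4 * (1 + ((n:ℝ)+1+1)) * R + 1 = M by simp only [M]; ring] at h1
      gcongr
      exact h1.trans (pow_le_pow_right₀ hM (by omega))
  have h := ser_deriv (fun k => u - (-1) ^ k) (wt_le hu) (n + 1) q (fun k s => Pk ((n:ℝ)+1) k s q)
    (fun k s => dPk ((n:ℝ)+1) k s q) s R (2 * (n + 1)) M hs (by positivity) (by linarith)
    (fun k s => Pk_deriv _ (by positivity) k s q) b1 b2
  refine h.congr_deriv ?_
  have hsum := (ser_summable (fun k => u - (-1) ^ k) (wt_le hu) (n+1) q (fun k => dPk ((n:ℝ)+1) k s q)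
    (2 * (n + 1)) M (by positivity) (by linarith) (fun k => b2 k s hs.le)).2
  rw [tsum_shift _ (by simp [dPk]) hsum, SS, ← tsum_mul_left]
  refine tsum_congr fun k => ?_
  simp only [dPk, if_neg (Nat.succ_ne_zero k), Nat.add_sub_cancel]
  rw [show k + 1 + (n + 1) = k + (n + 1 + 1) by ring]
  push_cast; ring

lemma SB_deriv (u : ℝ) (hu : |u| ≤ 1) (n : ℕ) (s q : ℝ) :
    HasDerivAt (fun s => SB u n s q) (-(2 * (n + 1)) * SB (-u) (n + 1) s q) s := by
  set R : ℝ := |s| + |q| + 1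
  have hR : 1 ≤ R := by simp only [R]; linarith [abs_nonneg s, abs_nonneg q]
  have hq : |q| ≤ R := by simp only [R]; linarith [abs_nonneg s, abs_nonneg q]
  have hs : |s| < R := by simp only [R]; linarith [abs_nonneg s, abs_nonneg q]
  set M : ℝ := 4 * (3 + n) * R + 1
  have hM : 1 ≤ M := by
    have : 0 ≤ (3 + (n:ℝ)) * R := by positivity
    simp only [M]; linarith
  have b1 : ∀ k s, |s| ≤ R → |TT n k s q| ≤ (2 * (n + 1) * (1 + R)) * M ^ k := fun k s hs => by
    refine (TT_bound _ (by positivity) R (by linarith) k s q hs hq).trans ?_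
    have : (4 * (2 + (n:ℝ)) * R + 1) ^ k ≤ M ^ k := by
      simp only [M]; gcongr ?_ ^ k; nlinarith
    calc _ ≤ (1 + R) * M ^ k := by gcongr
      _ ≤ _ := by
        gcongr
        exact le_mul_of_one_le_left (by positivity) (by linarith [(Nat.cast_nonneg n : (0:ℝ) ≤ n)])
  have b2 : ∀ k s, |s| ≤ R → |dTT n k s q| ≤ (2 * (n + 1) * (1 + R)) * M ^ k := fun k s hs => by
    unfold dTT
    split_ifs
    · simp; positivity
    · rw [abs_mul, abs_of_nonneg (by positivity : 0 ≤ 2 * ((n:ℝ) + 1))]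
      have h1 := TT_bound ((n:ℝ)+1) (by positivity) R (by linarith) (k-1) s q hs hq
      rw [show 4 * (2 + ((n:ℝ)+1)) * R + 1 = M by simp only [M]; ring] at h1
      rw [mul_assoc (2 * ((n:ℝ)+1))]
      gcongr
      refine h1.trans ?_
      gcongr
      exact (by omega : k - 1 ≤ k)
  have h := ser_deriv (fun k => u - (-1) ^ k) (wt_le hu) n q (fun k s => TT n k s q)
    (fun k s => dTT n k s q) s R (2 * (n + 1) * (1 + R)) M hs (by positivity) (by linarith)
    (fun k s => TT_deriv _ (by positivity) k s q) b1 b2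
  refine h.congr_deriv ?_
  have hsum := (ser_summable (fun k => u - (-1) ^ k) (wt_le hu) n q (fun k => dTT n k s q)
    (2 * (n + 1) * (1 + R)) M (by positivity) (by linarith) (fun k => b2 k s hs.le)).2
  rw [tsum_shift _ (by simp [dTT]) hsum, SB, ← tsum_mul_left]
  refine tsum_congr fun k => ?_
  simp only [dTT, if_neg (Nat.succ_ne_zero k), Nat.add_sub_cancel]
  rw [show k + 1 + n = k + (n + 1) by ring]
  push_cast; ring

lemma SB_zero (s q : ℝ) : SB (-1) 0 s q = -2 * Phi 0 (q - s ^ 2) := by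
  obtain ⟨a, b, h1, h2, h3⟩ := exists_roots s q
  have hc := cosh_sum q a b h2
  rw [cosh_Phi (q - s^2) (a - b) (by rw [h3]; push_cast; ring)] at hc
  have hc2 : HasSum (fun k => (((-1 - (-1) ^ (k+1)) * bt (k + 1 + 0) q * TT (0:ℕ) (k+1) s q : ℝ) : ℂ))
      (-(2 * (Phi 0 (q - s^2) : ℂ) - 2 * hk q 0)) := by
    refine hs_congrC hc.neg fun k => ?_
    have := TT_sum s q a b h1 h2 k
    push_cast
    rw [← this, hk]
    push_cast
    rw [add_zero]
    ring
  have hc3 : HasSum (fun k => ((-1 - (-1) ^ (k+1)) * bt (k + 1 + 0) q * TT (0:ℕ) (k+1) s q : ℝ))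
      (-(2 * (Phi 0 (q - s^2)) - 2 * bt 0 q)) := by
    rw [← Complex.hasSum_ofReal]
    simpa [hk] using hc2
  have hc4 := (hasSum_nat_add_iff (f := fun k => ((-1 - (-1) ^ k) * bt (k + 0) q * TT (0:ℕ) k s q : ℝ)) 1).1 hc3
  rw [SB, hc4.tsum_eq]
  simp [TT, Pk]
  ring

lemma SS_zero_aux (s q : ℝ) (hsq : q ≠ s ^ 2) : SS (-1) 0 s q = -2 * Phi 1 (q - s ^ 2) := by
  obtain ⟨a, b, h1, h2, h3⟩ := exists_roots s q
  have hc := sinh_sum q a b h2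
  rw [sinh_Phi (q - s^2) (a - b) (by rw [h3]; push_cast; ring)] at hc
  have hab : a - b ≠ 0 := by
    intro h
    rw [h] at h3
    apply hsq
    have h4 : (q:ℂ) = ((s^2 : ℝ) : ℂ) := by push_cast; linear_combination h3
    exact_mod_cast h4
  have hc2 : HasSum (fun k => (((-1 - (-1) ^ k) * bt (k + (0 + 1)) q * Pk ((0:ℕ)+1) k s q : ℝ) : ℂ))
      ((-(2 * (a - b)))⁻¹ * (2 * ((a - b) * (2 * (Phi 1 (q - s^2) : ℂ))))) := by
    refine hs_congrC (hc.mul_left _) fun k => ?_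
    have := Pk_diff s q a b h1 h2 k
    rw [hk]
    push_cast
    rw [zero_add, show (a ^ (k+1) - b ^ (k+1)) = (a - b) * (Pk 1 k s q : ℂ) / 2 ^ k by
      rw [← this]; field_simp]
    field_simp
    ring
  rw [SS]
  have hc3 : HasSum (fun k => ((-1 - (-1) ^ k) * bt (k + (0 + 1)) q * Pk ((0:ℕ)+1) k s q : ℝ))
      (-2 * Phi 1 (q - s^2)) := by
    rw [← Complex.hasSum_ofReal]
    have e : ((-2 * Phi 1 (q - s^2) : ℝ) : ℂ) = (-(2 * (a - b)))⁻¹ * (2 * ((a - b) * (2 * (Phi 1 (q - s^2) : ℂ)))) := by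
      push_cast; field_simp
    rw [e]; exact hc2
  exact hc3.tsum_eq

lemma SS_zero (s q : ℝ) : SS (-1) 0 s q = -2 * Phi 1 (q - s ^ 2) := by
  have hc1 : Continuous (fun s => SS (-1) 0 s q) :=
    continuous_iff_continuousAt.2 fun s => (SS_deriv (-1) (by simp) 0 s q).continuousAt
  have hc2 : Continuous (fun s => -2 * Phi 1 (q - s ^ 2)) :=
    continuous_const.mul ((Phi_continuous 1).comp (by fun_prop))
  have hd : Dense ({Real.sqrt q, -Real.sqrt q}ᶜ : Set ℝ) :=
    Set.Countable.dense_compl ℝ ((Set.finite_singleton _).insert _).countable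
  have := Continuous.ext_on hd hc1 hc2 fun x hx => by
    refine SS_zero_aux x q ?_
    rintro rfl
    apply hx
    rw [Real.sqrt_sq_eq_abs]
    rcases abs_choice x with h | h <;> simp [h]
  exact congrFun this s

lemma neg1_abs (n : ℕ) : |((-1:ℝ)) ^ n| ≤ 1 := by simp

lemma ev_cL (n : ℕ) : ∀ s q : ℝ, ev (cL n) s q (Real.pi / 2)
    = (((-1) ^ (n+1) * (2 ^ n * (n.factorial : ℝ) / 2) * SB ((-1) ^ (n+1)) n s q : ℝ) : ℂ) := by
  induction n with
  | zero =>
    intro s q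
    have h := SB_zero s q
    simp only [zero_add, pow_one] at *
    rw [h]
    simp [cL, ev_X, evG, En]
  | succ n ih =>
    intro s q
    rw [← cL_succ]
    refine (ev_ds (cL n) s q (Real.pi/2)).unique ?_
    have h := hasDerivAt_ofReal' ((SB_deriv ((-1)^(n+1)) (neg1_abs _) n s q).const_mul
      ((-1) ^ (n+1) * (2 ^ n * (n.factorial : ℝ) / 2)))
    have h2 : (fun s => ev (cL n) s q (Real.pi/2)) = _ := funext fun s => ih s q
    rw [h2]
    refine h.congr_deriv ?_
    rw [show -(-1:ℝ) ^ (n+1) = (-1) ^ (n+1+1) by ring, Nat.factorial_succ]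
    push_cast; ring

lemma ev_sL (n : ℕ) : ∀ s q : ℝ, ev (sL n) s q (Real.pi / 2)
    = (((-1) ^ (n+1) * (2 ^ n * (n.factorial : ℝ)) * SS ((-1) ^ (n+1)) n s q : ℝ) : ℂ) := by
  induction n with
  | zero =>
    intro s q
    have h := SS_zero s q
    simp only [zero_add, pow_one] at *
    rw [h]
    simp [sL, ev_mul, ev_two, ev_X, evG, En]
  | succ n ih =>
    intro s q
    rw [← sL_succ]
    refine (ev_ds (sL n) s q (Real.pi/2)).unique ?_
    have h := hasDerivAt_ofReal' ((SS_deriv ((-1)^(n+1)) (neg1_abs _) n s q).const_mul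
      ((-1) ^ (n+1) * (2 ^ n * (n.factorial : ℝ))))
    have h2 : (fun s => ev (sL n) s q (Real.pi/2)) = _ := funext fun s => ih s q
    rw [h2]
    refine h.congr_deriv ?_
    rw [show -(-1:ℝ) ^ (n+1) = (-1) ^ (n+1+1) by ring, Nat.factorial_succ]
    push_cast; ring

lemma zTT (n : ℕ) (k : ℕ) (z w : ℝ) : z ^ k * gegT n k w = TT n k (z * w) (z ^ 2) := by
  rw [gegT, TT, mul_sub, Pk_geg]
  congr 1
  split_ifs with h
  · rw [← Pk_geg, ← mul_assoc, ← pow_add, show 2 + (k - 2) = k by omega]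
  · simp

lemma Cfun_eq (n : ℕ) (w z : ℝ) :
    CfunR ((-1) ^ (n+1)) n w z = ((-(2 ^ n * (n.factorial : ℝ)) * SS ((-1) ^ (n+1)) n (z * w) (z^2) : ℝ) : ℂ) := by
  rw [CfunR, Real.Gamma_nat_eq_factorial, Real.rpow_natCast]
  have : ∑' k : ℕ, ((-1) ^ (n+1) + (-1 : ℂ)^k) *
      ((z^(k - 1) * besselJt ((k : ℝ) + n) z
        * (if 1 ≤ k then geg ((n:ℝ) + 1) (k - 1) w else 0) : ℝ) : ℂ)
      = ((SS ((-1) ^ (n+1)) n (z * w) (z^2) : ℝ) : ℂ) := by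
    rw [SS, Complex.ofReal_tsum, ← Function.Injective.tsum_eq (g := Nat.succ) Nat.succ_injective]
    · refine tsum_congr fun k => ?_
      have h1 : besselJt (((Nat.succ k : ℕ) : ℝ) + n) z = bt (k + (n+1)) (z^2) := by
        rw [besselJt_eq, show Nat.succ k + n = k + (n+1) by omega]
      rw [h1, ← Pk_geg]
      simp only [Nat.succ_eq_add_one, Nat.add_sub_cancel, if_pos (Nat.le_add_left 1 k)]
      push_cast; ring
    · intro k hk
      rcases k with _ | k
      · exfalso; simp at hk
      · exact ⟨k, rfl⟩
  rw [this]; push_cast; ring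

lemma two_rpow (n : ℕ) : (2:ℝ) ^ ((n:ℝ) - 1) = 2 ^ n / 2 := by
  rw [Real.rpow_sub_one (by norm_num), Real.rpow_natCast]

lemma Bfun_eq (n : ℕ) (w z : ℝ) :
    BfunR ((-1) ^ (n+1)) n w z = ((-(2 ^ n * (n.factorial : ℝ) / 2) * SB ((-1) ^ (n+1)) n (z * w) (z^2) : ℝ) : ℂ) := by
  rw [BfunR, Real.Gamma_nat_eq_factorial, two_rpow]
  have : ∑' k : ℕ, ((-1) ^ (n+1) - (-1 : ℂ)^k) *
      ((z^k * besselJt ((k : ℝ) + n) z * gegT n k w : ℝ) : ℂ)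
      = ((SB ((-1) ^ (n+1)) n (z * w) (z^2) : ℝ) : ℂ) := by
    rw [SB, Complex.ofReal_tsum]
    refine tsum_congr fun k => ?_
    rw [besselJt_eq, ← zTT]
    push_cast; ring
  rw [this]; push_cast; ring

lemma Afun_eq (n : ℕ) (w z : ℝ) :
    AfunR ((-1) ^ (n+2)) (n+1:ℕ) w z
      = ((-(2 ^ n * ((n+1).factorial : ℝ)) * SS ((-1) ^ (n+1)) n (z * w) (z^2) : ℝ) : ℂ) := by
  rw [AfunR, Real.Gamma_nat_eq_factorial, two_rpow]
  have : ∑' k : ℕ, ((-1) ^ (n+2) + (-1 : ℂ)^k) *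
      ((z^k * besselJt ((k : ℝ) + (n+1:ℕ)) z * geg (n+1:ℕ) k w : ℝ) : ℂ)
      = -((SS ((-1) ^ (n+1)) n (z * w) (z^2) : ℝ) : ℂ) := by
    rw [SS, Complex.ofReal_tsum, ← tsum_neg]
    refine tsum_congr fun k => ?_
    rw [besselJt_eq, ← Pk_geg]
    push_cast; ring
  rw [this]; push_cast; ring

lemma Pk_zero (k : ℕ) (s q : ℝ) : Pk 0 (k+1) s q = 0 := by
  induction k using Nat.twoStepInduction with
  | zero => simp [Pk]
  | one => simp [Pk]
  | more k h1 h2 => rw [Pk, h2, h1]; simp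

lemma Afun_zero (w z : ℝ) : AfunR ((-1) ^ 1) (0:ℕ) w z = 0 := by
  rw [AfunR]
  have : ∑' k : ℕ, ((-1) ^ 1 + (-1 : ℂ)^k) *
      ((z^k * besselJt ((k : ℝ) + (0:ℕ)) z * geg (0:ℕ) k w : ℝ) : ℂ) = 0 := by
    rw [← tsum_zero (α := ℂ) (β := ℕ)]
    refine tsum_congr fun k => ?_
    rcases k with _ | k
    · simp
    · have h := Pk_geg 0 (k+1) w z
      rw [Pk_zero] at h
      have : (z^(k+1) * besselJt (((k+1:ℕ) : ℝ) + (0:ℕ)) z * geg (0:ℕ) (k+1) w : ℝ) = 0 := by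
        simp only [Nat.cast_zero]
        linear_combination (besselJt (((k+1:ℕ) : ℝ) + (0)) z) * h
      rw [this]; simp
  rw [this, mul_zero]

lemma AB_eq (n : ℕ) (w z : ℝ) :
    AfunR ((-1) ^ (n+1)) n w z + BfunR ((-1) ^ (n+1)) n w z
      = (-1) ^ n * ev (pa n) (z * w) (z ^ 2) (Real.pi / 2) := by
  rw [Bfun_eq, pa, ev_sub, ev_mul, ev_nat, ev_cL]
  rcases n with _ | n
  · rw [Afun_zero]; simp
  · rw [show n + 1 + 1 = n + 2 by ring, Afun_eq, Nat.add_sub_cancel, ev_sL, Nat.factorial_succ]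
    have h : ((-1:ℂ)) ^ (n * 2) = 1 := by rw [mul_comm, pow_mul]; simp
    push_cast
    ring_nf
    rw [h]; ring

lemma C_eq (n : ℕ) (w z : ℝ) :
    CfunR ((-1) ^ (n+1)) n w z = (-1) ^ n * ev (pb n) (z * w) (z ^ 2) (Real.pi / 2) := by
  rw [Cfun_eq, pb, ev_sL]
  have h : ((-1:ℂ)) ^ (n * 2) = 1 := by rw [mul_comm, pow_mul]; simp
  push_cast
  ring_nf
  rw [h]; ring

lemma ip_self_nonneg (x : Fin m → ℝ) : 0 ≤ ip x x := Finset.sum_nonneg fun i _ => mul_self_nonneg _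

lemma cs_ip (x y : Fin m → ℝ) : ip x y ^ 2 ≤ ip x x * ip y y := by
  have := Finset.sum_mul_sq_le_sq_mul_sq Finset.univ x y
  simpa [ip, sq] using this

lemma nrm_sq (x : Fin m → ℝ) : nrm x ^ 2 = ip x x := Real.sq_sqrt (ip_self_nonneg x)

/-- the kernel family -/
def MM (n : ℕ) (t : ℝ) (x y : Fin m → ℝ) : Cl m :=
  ev (pa n) (ip x y) (ip x x * ip y y) t • (1 : Cl m)
    + ev (pb n) (ip x y) (ip x x * ip y y) t • wedge m x y

lemma Kminus_eq (n : ℕ) (x y : Fin (2 * n + 2) → ℝ) :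
    Kminus (2 * n + 2) x y = ((-1 : ℂ) ^ n) • MM n (Real.pi / 2) x y := by
  have h1 : (((2 * n + 2 : ℕ) : ℝ) - 2) / 2 = (n : ℝ) := by push_cast; ring
  have h2 : Complex.I ^ (2 * n + 2) = (-1) ^ (n + 1) := by
    rw [show 2 * n + 2 = 2 * (n + 1) by ring, pow_mul, Complex.I_sq]
  have h3 : (nrm x * nrm y) * (ip x y / (nrm x * nrm y)) = ip x y := by
    by_cases h : nrm x * nrm y = 0
    · have h4 := cs_ip x y
      rw [← nrm_sq, ← nrm_sq, ← mul_pow, h] at h4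
      have : ip x y = 0 := by nlinarith
      rw [this]; simp
    · exact mul_div_cancel₀ _ h
  have h4 : (nrm x * nrm y) ^ 2 = ip x x * ip y y := by rw [mul_pow, nrm_sq, nrm_sq]
  rw [Kminus, h1, h2, AB_eq, C_eq, h3, h4, MM, smul_add, smul_smul, smul_smul]

/-! ### pointwise Clifford identities -/

lemma ip_comm (x y : Fin m → ℝ) : ip x y = ip y x := Finset.sum_congr rfl fun i _ => mul_comm _ _

lemma wedge_comm (x y : Fin m → ℝ) : wedge m y x = - wedge m x y := by
  rw [wedge_eq, wedge_eq, vec_mul_vec x y, ip_comm y x]; module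

lemma wedge_sq (x y : Fin m → ℝ) :
    wedge m x y * wedge m x y = ((ip x y : ℂ) ^ 2 - (ip x x : ℂ) * (ip y y : ℂ)) • (1 : Cl m) := by
  have h0 : vec m x * vec m y * (vec m x * vec m y) = -(((ip x x : ℂ) * (ip y y : ℂ)) • (1 : Cl m))
      - (2 * (ip x y : ℂ)) • (vec m x * vec m y) := by
    calc _ = vec m x * (vec m y * vec m x) * vec m y := by simp only [mul_assoc]
      _ = vec m x * (-(vec m x * vec m y) - (2 * (ip x y : ℂ)) • (1 : Cl m)) * vec m y := by
          rw [vec_mul_vec y x, ip_comm y x]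
      _ = -((vec m x * vec m x) * (vec m y * vec m y)) - (2 * (ip x y : ℂ)) • (vec m x * vec m y) := by
          simp only [mul_sub, sub_mul, mul_neg, neg_mul, mul_smul_comm, smul_mul_assoc, mul_one, mul_assoc]
      _ = _ := by
          rw [vec_sq, vec_sq]
          simp only [mul_neg, neg_mul, mul_smul_comm, smul_mul_assoc, mul_one, smul_neg, neg_neg, smul_smul]
          rw [mul_comm (ip y y : ℂ)]
  rw [wedge_eq]
  simp only [mul_add, add_mul, h0, mul_smul_comm, smul_mul_assoc, mul_one, one_mul]
  module

/-- the field `w_j` -/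
def wv (x : Fin m → ℝ) (j : Fin m) : Cl m := (1/2 : ℂ) • (vec m x * e m j - e m j * vec m x)
/-- derivative of the wedge -/
def wE (y : Fin m → ℝ) (j : Fin m) : Cl m := e m j * vec m y + (y j : ℂ) • (1 : Cl m)

lemma sum_e (y : Fin m → ℝ) : ∑ j, (y j : ℂ) • e m j = vec m y := rfl

lemma sum_wv (x y : Fin m → ℝ) : ∑ j, (y j : ℂ) • wv x j = wedge m x y := by
  have : ∑ j, (y j : ℂ) • wv x j = (1/2 : ℂ) • (vec m x * vec m y - vec m y * vec m x) := by
    simp only [wv]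
    rw [← sum_e y, Finset.mul_sum, Finset.sum_mul, ← Finset.sum_sub_distrib, Finset.smul_sum]
    refine Finset.sum_congr rfl fun j _ => ?_
    simp only [mul_smul_comm, smul_mul_assoc]
    module
  rw [this, wedge_eq, vec_mul_vec y x, ip_comm y x]
  module

lemma wedge_self (x : Fin m → ℝ) : wedge m x x = 0 := by
  rw [wedge_eq, vec_sq]; module

lemma sum_wE (x y : Fin m → ℝ) : ∑ j, (x j : ℂ) • wE y j = wedge m x y := by
  simp only [wE, smul_add, smul_smul, Finset.sum_add_distrib]
  rw [wedge_eq, ← sum_e x, Finset.sum_mul, ip]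
  push_cast
  rw [Finset.sum_smul]
  simp only [smul_mul_assoc]

lemma sum_e_e : ∑ j, e m j * e m j = -((m : ℂ) • (1 : Cl m)) := by
  simp only [e_sq, Finset.sum_const, Finset.card_univ, Fintype.card_fin, smul_neg]
  rw [← Nat.cast_smul_eq_nsmul ℂ]

lemma sum_e_vv_e (x y : Fin m → ℝ) : ∑ j, e m j * (vec m y * vec m x) * e m j
    = -(((m : ℂ) - 2) • (vec m y * vec m x)) - (2:ℂ) • (vec m x * vec m y) := by
  have : ∀ j ∈ Finset.univ, e m j * (vec m y * vec m x) * e m j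
      = -(vec m y * (e m j * vec m x * e m j)) - (2:ℂ) • (vec m x * ((y j : ℂ) • e m j)) := by
    intro j _
    have h : e m j * vec m y = -(vec m y * e m j) - (2 * (y j : ℂ)) • (1 : Cl m) := by
      rw [vec_mul_e]; module
    rw [← mul_assoc, h]
    simp only [mul_sub, sub_mul, mul_neg, neg_mul, mul_smul_comm, smul_mul_assoc, mul_one, one_mul, mul_assoc, smul_smul]
  rw [Finset.sum_congr rfl this, Finset.sum_sub_distrib, Finset.sum_neg_distrib, ← Finset.mul_sum,
    ← Finset.smul_sum, ← Finset.mul_sum, sum_e, sum_e_vec_e, mul_smul_comm]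

lemma sum_wE_wv (x y : Fin m → ℝ) : ∑ j, wE y j * wv x j
    = (((m : ℂ) - 1) * (ip x y : ℂ)) • (1 : Cl m) + ((m : ℂ) - 2) • wedge m x y := by
  have : ∀ j ∈ Finset.univ, wE y j * wv x j = (1/2 : ℂ) • (e m j * (vec m y * vec m x) * e m j)
      - (1/2:ℂ) • ((e m j * vec m y * e m j) * vec m x) + (y j : ℂ) • wv x j := by
    intro j _
    rw [wE, add_mul, smul_mul_assoc, one_mul]
    congr 1
    rw [wv]
    simp only [mul_sub, mul_smul_comm, mul_assoc, smul_sub]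
  rw [Finset.sum_congr rfl this, Finset.sum_add_distrib, Finset.sum_sub_distrib, ← Finset.smul_sum,
    ← Finset.smul_sum, ← Finset.sum_mul, sum_wv, sum_e_vv_e, sum_e_vec_e, smul_mul_assoc, wedge_eq,
    vec_mul_vec y x, ip_comm y x]
  module

lemma sum_wv_wE (x y : Fin m → ℝ) : ∑ j, wv x j * wE y j
    = (((m : ℂ) - 1) * (ip x y : ℂ)) • (1 : Cl m) - ((m : ℂ) - 2) • wedge m x y := by
  have : ∀ j ∈ Finset.univ, wv x j * wE y j = (1/2 : ℂ) • (vec m x * (e m j * e m j) * vec m y)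
      - (1/2:ℂ) • ((e m j * vec m x * e m j) * vec m y) + (y j : ℂ) • wv x j := by
    intro j _
    rw [wE, mul_add, mul_smul_comm, mul_one]
    congr 1
    rw [wv]
    simp only [sub_mul, smul_mul_assoc, mul_assoc, smul_sub]
  rw [Finset.sum_congr rfl this, Finset.sum_add_distrib, Finset.sum_sub_distrib, ← Finset.smul_sum,
    ← Finset.smul_sum, ← Finset.sum_mul, ← Finset.sum_mul, ← Finset.mul_sum, sum_wv, sum_e_vec_e, sum_e_e, wedge_eq]
  simp only [mul_neg, neg_mul, mul_smul_comm, smul_mul_assoc, mul_one, one_mul]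
  module

/-! generic kernels -/
def DD (p r : Pl) (t : ℝ) (x y : Fin m → ℝ) : Cl m :=
  ev p (ip x y) (ip x x * ip y y) t • (1 : Cl m)
    + ev r (ip x y) (ip x x * ip y y) t • wedge m x y

lemma MM_eq (n : ℕ) (t : ℝ) (x y : Fin m → ℝ) : MM n t x y = DD (pa n) (pb n) t x y := rfl
lemma MM_eq' (n : ℕ) (t : ℝ) (x y : Fin m → ℝ) : MM n t y x = DD (pa n) (-pb n) t x y := by
  rw [MM, DD, wedge_comm, ip_comm y x, mul_comm (ip y y), ev_neg]; module

/-- directional derivative in the first variable -/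
def DDj (p r : Pl) (t : ℝ) (x y : Fin m → ℝ) (j : Fin m) : Cl m :=
  (y j : ℂ) • DD (ds p) (ds r) t x y + (2 * (x j : ℂ) * (ip y y : ℂ)) • DD (dq p) (dq r) t x y
    + ev r (ip x y) (ip x x * ip y y) t • wE y j

def DDjj (p r : Pl) (t : ℝ) (x y : Fin m → ℝ) (j : Fin m) : Cl m :=
  (y j : ℂ) • DDj (ds p) (ds r) t x y j + (2 * (ip y y : ℂ)) • DD (dq p) (dq r) t x y
    + (2 * (x j : ℂ) * (ip y y : ℂ)) • DDj (dq p) (dq r) t x y j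
    + ((y j : ℂ) * ev (ds r) (ip x y) (ip x x * ip y y) t
        + 2 * (x j : ℂ) * (ip y y : ℂ) * ev (dq r) (ip x y) (ip x x * ip y y) t) • wE y j

lemma DDj_wv (p r : Pl) (t : ℝ) (x y : Fin m → ℝ) :
    ∑ j, DDj p r t x y j * wv x j
    = (ev (ds r) (ip x y) (ip x x * ip y y) t * ((ip x y : ℂ) ^ 2 - (ip x x : ℂ) * (ip y y : ℂ))
        + ev r (ip x y) (ip x x * ip y y) t * (((m : ℂ) - 1) * (ip x y : ℂ))) • (1 : Cl m)
      + (ev (ds p) (ip x y) (ip x x * ip y y) t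
        + ev r (ip x y) (ip x x * ip y y) t * ((m : ℂ) - 2)) • wedge m x y := by
  have : ∀ j ∈ Finset.univ, DDj p r t x y j * wv x j
    = DD (ds p) (ds r) t x y * ((y j : ℂ) • wv x j)
      + (2 * (ip y y : ℂ)) • (DD (dq p) (dq r) t x y * ((x j : ℂ) • wv x j))
      + ev r (ip x y) (ip x x * ip y y) t • (wE y j * wv x j) := by
    intro j _
    simp only [DDj, add_mul, smul_mul_assoc, mul_smul_comm]
    module
  rw [Finset.sum_congr rfl this, Finset.sum_add_distrib, Finset.sum_add_distrib, ← Finset.smul_sum,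
    ← Finset.smul_sum, ← Finset.mul_sum, ← Finset.mul_sum, sum_wv, sum_wv, wedge_self, sum_wE_wv,
    mul_zero, smul_zero, add_zero, DD, add_mul, smul_mul_assoc, smul_mul_assoc, one_mul, wedge_sq]
  module

lemma wv_DDj (p r : Pl) (t : ℝ) (x y : Fin m → ℝ) :
    ∑ j, wv x j * DDj p r t x y j
    = (ev (ds r) (ip x y) (ip x x * ip y y) t * ((ip x y : ℂ) ^ 2 - (ip x x : ℂ) * (ip y y : ℂ))
        + ev r (ip x y) (ip x x * ip y y) t * (((m : ℂ) - 1) * (ip x y : ℂ))) • (1 : Cl m)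
      + (ev (ds p) (ip x y) (ip x x * ip y y) t
        - ev r (ip x y) (ip x x * ip y y) t * ((m : ℂ) - 2)) • wedge m x y := by
  have : ∀ j ∈ Finset.univ, wv x j * DDj p r t x y j
    = ((y j : ℂ) • wv x j) * DD (ds p) (ds r) t x y
      + (2 * (ip y y : ℂ)) • (((x j : ℂ) • wv x j) * DD (dq p) (dq r) t x y)
      + ev r (ip x y) (ip x x * ip y y) t • (wv x j * wE y j) := by
    intro j _
    simp only [DDj, mul_add, smul_mul_assoc, mul_smul_comm]
    module
  rw [Finset.sum_congr rfl this, Finset.sum_add_distrib, Finset.sum_add_distrib, ← Finset.smul_sum,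
    ← Finset.smul_sum, ← Finset.sum_mul, ← Finset.sum_mul, sum_wv, sum_wv, wedge_self, sum_wv_wE,
    zero_mul, smul_zero, add_zero, DD, mul_add, mul_smul_comm, mul_smul_comm, mul_one, wedge_sq]
  module

/-- the evolution equations -/
lemma evol_M (n : ℕ) (t : ℝ) (x y : Fin (2*n+2) → ℝ) :
    DD (dt (pa n)) (dt (pb n)) t x y
      = Complex.I • (∑ j, DDj (pa n) (pb n) t x y j * wv x j) - (Complex.I * n) • DD (pa n) (pb n) t x y := by
  rw [DDj_wv, DD, DD, t_a, t_b]
  push_cast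
  module

lemma evol_N (n : ℕ) (t : ℝ) (x y : Fin (2*n+2) → ℝ) :
    DD (dt (pa n)) (dt (-pb n)) t x y
      = -(Complex.I • (∑ j, wv x j * DDj (pa n) (-pb n) t x y j)) - (Complex.I * n) • DD (pa n) (-pb n) t x y := by
  rw [wv_DDj, DD, DD]
  simp only [map_neg, ev_neg]
  rw [t_a, t_b]
  push_cast
  module

lemma helm (n : ℕ) (hm : m = 2 * n + 2) (t : ℝ) (x y : Fin m → ℝ) :
    ∑ j, DDjj (pa n) (pb n) t x y j = -((ip y y : ℂ) • DD (pa n) (pb n) t x y) := by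
  set p := pa n
  set r := pb n
  have e0 : ∀ j ∈ Finset.univ, DDjj p r t x y j
    = ((y j : ℂ) * y j) • DD (ds (ds p)) (ds (ds r)) t x y
      + (4 * (ip y y : ℂ) * ((x j : ℂ) * (y j:ℂ))) • DD (ds (dq p)) (ds (dq r)) t x y
      + (4 * (ip y y : ℂ) ^ 2 * ((x j : ℂ) * (x j:ℂ))) • DD (dq (dq p)) (dq (dq r)) t x y
      + (2 * (ip y y : ℂ)) • DD (dq p) (dq r) t x y
      + (2 * ev (ds r) (ip x y) (ip x x * ip y y) t) • ((y j : ℂ) • wE y j)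
      + (4 * (ip y y : ℂ) * ev (dq r) (ip x y) (ip x x * ip y y) t) • ((x j : ℂ) • wE y j) := by
    intro j _
    simp only [DDjj, DDj, ds_dq]
    module
  have ipc : ∀ x y : Fin m → ℝ, ∑ j, (x j : ℂ) * (y j : ℂ) = (ip x y : ℂ) := fun x y => by
    rw [ip]; push_cast; rfl
  rw [Finset.sum_congr rfl e0]
  simp only [Finset.sum_add_distrib]
  rw [← Finset.sum_smul, ← Finset.sum_smul, ← Finset.sum_smul, ← Finset.smul_sum, ← Finset.smul_sum, ← Finset.smul_sum,
    ← Finset.mul_sum, ← Finset.mul_sum, ipc, ipc, ipc, sum_wE, sum_wE, wedge_self, Finset.sum_const,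
    Finset.card_univ, Fintype.card_fin, ← Nat.cast_smul_eq_nsmul ℂ]
  have h1 := Hz_a n (ip x y) (ip x x * ip y y) t
  have h2 := Hz_b n (ip x y) (ip x x * ip y y) t
  simp only [Hz, ev_add, ev_mul, ev_four, ev_X, evG, ev_nat, ev_zero] at h1 h2
  push_cast at h1 h2
  have k1 : ev p (ip x y) (ip x x * ip y y) t = _ := eq_neg_of_add_eq_zero_right h1
  have k2 : ev r (ip x y) (ip x x * ip y y) t = _ := eq_neg_of_add_eq_zero_right h2
  have hmC : (m : ℂ) = 2 * n + 2 := by rw [hm]; push_cast; ring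
  conv_rhs => rw [DD, k1, k2]
  simp only [DD, p, r]
  rw [hmC]
  module

/-! ### derivatives of the kernels -/

abbrev X (m : ℕ) := Fin m → ℝ

def bj (j : Fin m) : X m := Pi.single j 1

lemma ev_fderiv (p : Pl) (t : ℝ) (u : ℝ × ℝ) :
    HasFDerivAt (fun v : ℝ × ℝ => ev p v.1 v.2 t)
      ((ContinuousLinearMap.toSpanSingleton ℝ (ev (ds p) u.1 u.2 t)).coprod
        (ContinuousLinearMap.toSpanSingleton ℝ (ev (dq p) u.1 u.2 t))) u := by
  have hc : ∀ p : Pl, Continuous fun v : ℝ × ℝ => ContinuousLinearMap.toSpanSingleton ℝ (ev p v.1 v.2 t) := by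
    intro p
    have h1 : Continuous fun v : ℝ × ℝ => ev p v.1 v.2 t :=
      (ev_cont p).comp (f := fun v : ℝ × ℝ => (v.1, v.2, t)) (by fun_prop)
    have h2 : Continuous fun z : ℂ => ContinuousLinearMap.toSpanSingleton ℝ z :=
      (ContinuousLinearMap.toSpanSingletonCLE (𝕜 := ℝ) (E := ℂ)).continuous
    exact h2.comp h1
  exact (hasStrictFDerivAt_uncurry_coprod (𝕜 := ℝ) (u := u) (f := fun s q => ev p s q t)
    (f₁ := fun s q => ContinuousLinearMap.toSpanSingleton ℝ (ev (ds p) s q t))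
    (f₂ := fun s q => ContinuousLinearMap.toSpanSingleton ℝ (ev (dq p) s q t))
    (Filter.Eventually.of_forall fun v => (ev_ds p v.1 v.2 t).hasFDerivAt)
    (Filter.Eventually.of_forall fun v => (ev_dq p v.1 v.2 t).hasFDerivAt)
    (hc (ds p)).continuousAt (hc (dq p)).continuousAt).hasFDerivAt

lemma ev_chain (p : Pl) (t : ℝ) {f g : ℝ → ℝ} {f' g' r : ℝ} (hf : HasDerivAt f f' r) (hg : HasDerivAt g g' r) :
    HasDerivAt (fun r => ev p (f r) (g r) t)
      ((f' : ℂ) * ev (ds p) (f r) (g r) t + (g' : ℂ) * ev (dq p) (f r) (g r) t) r := by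
  have h := (ev_fderiv p t (f r, g r)).comp_hasDerivAt r (hf.prodMk hg)
  refine h.congr_deriv ?_
  simp [ContinuousLinearMap.coprod_apply]

lemma ip_line (x y : X m) (j : Fin m) (r : ℝ) : ip (x + r • bj j) y = ip x y + r * y j := by
  simp only [ip, Pi.add_apply, Pi.smul_apply, smul_eq_mul, add_mul, Finset.sum_add_distrib, bj]
  congr 1
  rw [Finset.sum_eq_single j]
  · simp
  · intro i _ hi; simp [hi]
  · simp

lemma ip_bj (y : X m) (j : Fin m) : ip (bj j) y = y j := by
  have := ip_line 0 y j 1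
  simpa [ip] using this

lemma ip_line2 (x : X m) (j : Fin m) (r : ℝ) :
    ip (x + r • bj j) (x + r • bj j) = ip x x + (2 * x j) * r + r ^ 2 := by
  rw [ip_line, ip_comm, ip_line]
  simp [bj]; ring

lemma vec_line (x : X m) (j : Fin m) (r : ℝ) : vec m (x + r • bj j) = vec m x + (r:ℂ) • e m j := by
  simp only [vec, Pi.add_apply, Pi.smul_apply, smul_eq_mul, bj, Complex.ofReal_add, add_smul, Finset.sum_add_distrib]
  congr 1
  rw [Finset.sum_eq_single j]
  · simp
  · intro i _ hi; simp [hi]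
  · simp

lemma wedge_line (x y : X m) (j : Fin m) (r : ℝ) :
    wedge m (x + r • bj j) y = wedge m x y + r • wE y j := by
  rw [wedge_eq, wedge_eq, vec_line, ip_line, wE, rsmul_eq, add_mul, smul_mul_assoc]
  push_cast
  module

lemma wedge_ld (x y : X m) (j : Fin m) : HasLineDerivAt ℝ (fun x => wedge m x y) (wE y j) x (bj j) := by
  rw [HasLineDerivAt]
  simp only [wedge_line]
  have := ((hasDerivAt_id (0:ℝ)).smul_const (wE y j)).const_add (wedge m x y)
  simpa using this

lemma ev_ld (p : Pl) (t : ℝ) (x y : X m) (j : Fin m) :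
    HasLineDerivAt ℝ (fun x => ev p (ip x y) (ip x x * ip y y) t)
      ((y j : ℂ) * ev (ds p) (ip x y) (ip x x * ip y y) t
        + (2 * (x j : ℂ) * (ip y y : ℂ)) * ev (dq p) (ip x y) (ip x x * ip y y) t) x (bj j) := by
  rw [HasLineDerivAt]
  have h1 : HasDerivAt (fun r : ℝ => ip (x + r • bj j) y) (y j) 0 := by
    simp only [ip_line]
    simpa using ((hasDerivAt_id (0:ℝ)).mul_const (y j)).const_add (ip x y)
  have h2 : HasDerivAt (fun r : ℝ => ip (x + r • bj j) (x + r • bj j) * ip y y) (2 * x j * ip y y) 0 := by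
    simp only [ip_line2]
    refine HasDerivAt.mul_const ?_ _
    have : HasDerivAt (fun r : ℝ => ip x x + 2 * x j * r + r ^ 2) _ 0 := (((hasDerivAt_id (0:ℝ)).const_mul (2 * x j)).const_add (ip x x)).add ((hasDerivAt_id (0:ℝ)).pow 2)
    refine this.congr_deriv ?_
    simp
  refine (ev_chain p t h1 h2).congr_deriv ?_
  simp

lemma ld_smul {c : X m → ℂ} {f : X m → Cl m} {c' : ℂ} {f' : Cl m} {x v : X m}
    (hc : HasLineDerivAt ℝ c c' x v) (hf : HasLineDerivAt ℝ f f' x v) :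
    HasLineDerivAt ℝ (fun x => c x • f x) (c x • f' + c' • f x) x v := by
  rw [HasLineDerivAt] at *
  have : HasDerivAt (fun t : ℝ => c (x + t • v) • f (x + t • v)) _ 0 := HasDerivAt.smul hc hf
  refine this.congr_deriv ?_
  simp

lemma ld_add {f g : X m → Cl m} {f' g' : Cl m} {x v : X m}
    (hc : HasLineDerivAt ℝ f f' x v) (hf : HasLineDerivAt ℝ g g' x v) :
    HasLineDerivAt ℝ (fun x => f x + g x) (f' + g') x v := HasDerivAt.add hc hf

lemma ld_mul {f g : X m → Cl m} {f' g' : Cl m} {x v : X m}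
    (hf : HasLineDerivAt ℝ f f' x v) (hg : HasLineDerivAt ℝ g g' x v) :
    HasLineDerivAt ℝ (fun x => f x * g x) (f x * g' + f' * g x) x v := by
  rw [HasLineDerivAt] at *
  have : HasDerivAt (fun t : ℝ => f (x + t • v) * g (x + t • v)) _ 0 :=
    ContinuousLinearMap.hasDerivAt_of_bilinear (B := mulB m) (fun _ => hf) (fun _ => hg)
  refine this.congr_deriv ?_
  simp [mulB_apply]

lemma ld_const {E : Type*} [NormedAddCommGroup E] [NormedSpace ℝ E] (a : E) (x v : X m) :
    HasLineDerivAt ℝ (fun _ : X m => a) 0 x v := hasDerivAt_const _ _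

lemma coord_ld (x : X m) (c : ℂ) (j : Fin m) : HasLineDerivAt ℝ (fun x : X m => 2 * (x j : ℂ) * c) (2 * c) x (bj j) := by
  rw [HasLineDerivAt]
  have : ∀ r : ℝ, 2 * (((x + r • bj j) j : ℝ) : ℂ) * c = 2 * (x j : ℂ) * c + (r : ℂ) * (2 * c) := by
    intro r; simp [bj]; ring
  simp only [this]
  have h : HasDerivAt (fun r : ℝ => (r : ℂ)) 1 0 := Complex.ofRealCLM.hasDerivAt
  simpa using (h.mul_const (2 * c)).const_add (2 * (x j : ℂ) * c)

lemma DD_ld (p r : Pl) (t : ℝ) (x y : X m) (j : Fin m) :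
    HasLineDerivAt ℝ (fun x => DD p r t x y) (DDj p r t x y j) x (bj j) := by
  have h := ld_add (ld_smul (ev_ld p t x y j) (ld_const (1 : Cl m) x (bj j)))
    (ld_smul (ev_ld r t x y j) (wedge_ld x y j))
  refine HasDerivAt.congr_deriv h ?_
  simp only [DDj, DD]
  module

lemma DDj_ld (p r : Pl) (t : ℝ) (x y : X m) (j : Fin m) :
    HasLineDerivAt ℝ (fun x => DDj p r t x y j) (DDjj p r t x y j) x (bj j) := by
  have h := ld_add (ld_add (ld_smul (ld_const (y j : ℂ) x (bj j)) (DD_ld (ds p) (ds r) t x y j))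
    (ld_smul (coord_ld x (ip y y : ℂ) j) (DD_ld (dq p) (dq r) t x y j)))
    (ld_smul (ev_ld r t x y j) (ld_const (wE y j) x (bj j)))
  refine HasDerivAt.congr_deriv h ?_
  simp only [DDjj]
  module

lemma wv_ld (x : X m) (j : Fin m) : HasLineDerivAt ℝ (fun x => wv x j) 0 x (bj j) := by
  rw [HasLineDerivAt]
  have : ∀ r : ℝ, wv (x + r • bj j) j = wv x j := by
    intro r
    simp only [wv, vec_line, add_mul, mul_add, smul_mul_assoc, mul_smul_comm]
    congr 1; abel
  simp only [this]
  exact hasDerivAt_const _ _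

lemma DD_dt (p r : Pl) (t : ℝ) (x y : X m) :
    HasDerivAt (fun t => DD p r t x y) (DD (dt p) (dt r) t x y) t := by
  have h1 := (ev_dt p (ip x y) (ip x x * ip y y) t).smul_const (1 : Cl m)
  have h2 := (ev_dt r (ip x y) (ip x x * ip y y) t).smul_const (wedge m x y)
  exact h1.add h2

/-! ### growth classes -/

def GB {P E : Type*} [TopologicalSpace P] [NormedAddCommGroup E] (w : P → ℝ) (h : P → E) : Prop :=
  Continuous h ∧ ∃ (C : ℝ) (N : ℕ), 0 ≤ C ∧ ∀ p, ‖h p‖ ≤ C * w p ^ N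

section GBsec
variable {P : Type*} [TopologicalSpace P] {w : P → ℝ}

lemma GB.add {E : Type*} [NormedAddCommGroup E] (hw : ∀ p, 1 ≤ w p) {f g : P → E} (hf : GB w f) (hg : GB w g) :
    GB w (fun p => f p + g p) := by
  obtain ⟨cf, C, N, hC, hf⟩ := hf
  obtain ⟨cg, D, M, hD, hg⟩ := hg
  refine ⟨cf.add cg, C + D, N + M, by positivity, fun p => ?_⟩
  have := hw p
  calc _ ≤ ‖f p‖ + ‖g p‖ := norm_add_le _ _
    _ ≤ C * w p ^ N + D * w p ^ M := add_le_add (hf p) (hg p)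
    _ ≤ C * w p ^ (N + M) + D * w p ^ (N + M) := by
      gcongr <;> first | exact this | omega
    _ = _ := by ring

lemma GB.smul (hw : ∀ p, 1 ≤ w p) {f : P → ℂ} {g : P → Cl m} (hf : GB w f) (hg : GB w g) :
    GB w (fun p => f p • g p) := by
  obtain ⟨cf, C, N, hC, hf⟩ := hf
  obtain ⟨cg, D, M, hD, hg⟩ := hg
  refine ⟨cf.smul cg, C * D, N + M, by positivity, fun p => ?_⟩
  have := hw p
  rw [norm_smulC]
  calc _ ≤ (C * w p ^ N) * (D * w p ^ M) := mul_le_mul (hf p) (hg p) (norm_nonneg _) (by positivity)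
    _ = _ := by ring

lemma GB.cmul (hw : ∀ p, 1 ≤ w p) {f : P → ℂ} {g : P → ℂ} (hf : GB w f) (hg : GB w g) :
    GB w (fun p => f p * g p) := by
  obtain ⟨cf, C, N, hC, hf⟩ := hf
  obtain ⟨cg, D, M, hD, hg⟩ := hg
  refine ⟨cf.mul cg, C * D, N + M, by positivity, fun p => ?_⟩
  have := hw p
  rw [norm_mul]
  calc _ ≤ (C * w p ^ N) * (D * w p ^ M) := mul_le_mul (hf p) (hg p) (norm_nonneg _) (by positivity)
    _ = _ := by ring

lemma GB.mul (hw : ∀ p, 1 ≤ w p) {f : P → Cl m} {g : P → Cl m} (hf : GB w f) (hg : GB w g) :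
    GB w (fun p => f p * g p) := by
  obtain ⟨cf, C, N, hC, hf⟩ := hf
  obtain ⟨cg, D, M, hD, hg⟩ := hg
  obtain ⟨B, hB, hmul⟩ := norm_mul_le_cl (m := m)
  refine ⟨cf.mul cg, B * (C * D), N + M, by positivity, fun p => ?_⟩
  have := hw p
  calc _ ≤ B * ‖f p‖ * ‖g p‖ := hmul _ _
    _ = B * (‖f p‖ * ‖g p‖) := by ring
    _ ≤ B * ((C * w p ^ N) * (D * w p ^ M)) := by
      gcongr
      · exact hf p
      · exact hg p
    _ = _ := by ring

lemma GB.const {E : Type*} [NormedAddCommGroup E] (a : E) : GB w (fun _ => a) :=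
  ⟨continuous_const, ‖a‖, 0, norm_nonneg _, fun p => by simp⟩

lemma GB.sum {E ι : Type*} [NormedAddCommGroup E] [Fintype ι] (hw : ∀ p, 1 ≤ w p) {f : ι → P → E} (hf : ∀ i, GB w (f i)) :
    GB w (fun p => ∑ i, f i p) := by
  classical
  have : ∀ s : Finset ι, GB w (fun p => ∑ i ∈ s, f i p) := by
    intro s
    induction s using Finset.induction_on with
    | empty => simpa using GB.const (w := w) (0 : E)
    | insert a s ha ih =>
      simp only [Finset.sum_insert ha]
      exact GB.add hw (hf a) ih
  exact this _

lemma GB.of_lip {E : Type*} [NormedAddCommGroup E] {f : P → E} (hc : Continuous f) (C : ℝ) (hC : 0 ≤ C) (h : ∀ p, ‖f p‖ ≤ C * w p) :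
    GB w f := ⟨hc, C, 1, hC, fun p => by simpa using h p⟩

lemma GB.comp {Q E : Type*} [TopologicalSpace Q] [NormedAddCommGroup E] {v : Q → ℝ} {f : P → E} (hf : GB w f) (φ : Q → P)
    (hφ : Continuous φ) (hw : ∀ p, 1 ≤ w p) (D : ℝ) (hD : 0 ≤ D) (h : ∀ q, w (φ q) ≤ D * v q) : GB v (fun q => f (φ q)) := by
  obtain ⟨cf, C, N, hC, hf⟩ := hf
  refine ⟨cf.comp hφ, C * D ^ N, N, by positivity, fun q => (hf _).trans ?_⟩
  rw [mul_assoc, ← mul_pow]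
  have := hw (φ q)
  gcongr
  exact h q
end GBsec

/-! ### polynomial growth of the kernels -/

def wt (v : ℝ × X m × X m) : ℝ := (1 + ‖v.2.1‖) * (1 + ‖v.2.2‖)

lemma one_le_wt (v : ℝ × X m × X m) : 1 ≤ wt v := by
  have h1 := norm_nonneg v.2.1
  have h2 := norm_nonneg v.2.2
  unfold wt
  nlinarith [mul_nonneg h1 h2]

lemma x_le_wt (v : ℝ × X m × X m) : ‖v.2.1‖ ≤ wt v := by
  have h1 := norm_nonneg v.2.1
  have h2 := norm_nonneg v.2.2
  unfold wt
  nlinarith [mul_nonneg h1 h2]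

lemma y_le_wt (v : ℝ × X m × X m) : ‖v.2.2‖ ≤ wt v := by
  have h1 := norm_nonneg v.2.1
  have h2 := norm_nonneg v.2.2
  unfold wt
  nlinarith [mul_nonneg h1 h2]

lemma abs_ip_le (x y : X m) : |ip x y| ≤ m * (‖x‖ * ‖y‖) := by
  unfold ip
  calc _ ≤ ∑ i, |x i * y i| := Finset.abs_sum_le_sum_abs _ _
    _ ≤ ∑ i : Fin m, ‖x‖ * ‖y‖ := by
      refine Finset.sum_le_sum fun i _ => ?_
      rw [abs_mul]
      exact mul_le_mul (norm_le_pi_norm x i) (norm_le_pi_norm y i) (abs_nonneg _) (norm_nonneg _)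
    _ = _ := by simp

lemma ip_cont : Continuous fun v : X m × X m => ip v.1 v.2 := by
  unfold ip; fun_prop

lemma ev_cont' (p : Pl) : Continuous fun v : ℝ × X m × X m => ev p (ip v.2.1 v.2.2) (ip v.2.1 v.2.1 * ip v.2.2 v.2.2) v.1 := by
  refine (ev_cont p).comp (f := fun v : ℝ × X m × X m => (ip v.2.1 v.2.2, ip v.2.1 v.2.1 * ip v.2.2 v.2.2, v.1)) ?_
  unfold ip; fun_prop

lemma ev_GB (p : Pl) : GB (wt (m := m)) (fun v => ev p (ip v.2.1 v.2.2) (ip v.2.1 v.2.1 * ip v.2.2 v.2.2) v.1) := by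
  refine ⟨ev_cont' p, ?_⟩
  obtain ⟨K, N, hK, h⟩ := ev_bound p
  refine ⟨K * (1 + m) ^ N, N, by positivity, fun v => ?_⟩
  have hw := one_le_wt v
  have hm : (0:ℝ) ≤ m := by positivity
  have h1 := norm_nonneg v.2.1
  have h2 := norm_nonneg v.2.2
  have := h (ip v.2.1 v.2.2) (ip v.2.1 v.2.1 * ip v.2.2 v.2.2) v.1 ((1 + m) * wt v) (by nlinarith) (cs_ip _ _) ?_
  · rw [mul_assoc, ← mul_pow]; exact this
  · have a1 := (le_abs_self _).trans (abs_ip_le v.2.1 v.2.1)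
    have a2 := (le_abs_self _).trans (abs_ip_le v.2.2 v.2.2)
    calc _ ≤ (m * (‖v.2.1‖ * ‖v.2.1‖)) * (m * (‖v.2.2‖ * ‖v.2.2‖)) :=
          mul_le_mul a1 a2 (ip_self_nonneg _) (by positivity)
      _ = (m * (‖v.2.1‖ * ‖v.2.2‖)) ^ 2 := by ring
      _ ≤ _ := by
        unfold wt
        gcongr <;> linarith

lemma xj_GB (j : Fin m) : GB (wt (m := m)) (fun v => ((v.2.1 j : ℝ) : ℂ)) := by
  refine GB.of_lip (by fun_prop) 1 (by norm_num) fun v => ?_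
  rw [Complex.norm_real, one_mul]
  exact (norm_le_pi_norm v.2.1 j).trans (x_le_wt v)

lemma yj_GB (j : Fin m) : GB (wt (m := m)) (fun v => ((v.2.2 j : ℝ) : ℂ)) := by
  refine GB.of_lip (by fun_prop) 1 (by norm_num) fun v => ?_
  rw [Complex.norm_real, one_mul]
  exact (norm_le_pi_norm v.2.2 j).trans (y_le_wt v)

lemma ipxy_GB : GB (wt (m := m)) (fun v => ((ip v.2.1 v.2.2 : ℝ) : ℂ)) := by
  have := GB.sum one_le_wt fun j => GB.cmul one_le_wt (xj_GB (m := m) j) (yj_GB j)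
  simpa [ip] using this

lemma ipyy_GB : GB (wt (m := m)) (fun v => ((ip v.2.2 v.2.2 : ℝ) : ℂ)) := by
  have := GB.sum one_le_wt fun j => GB.cmul one_le_wt (yj_GB (m := m) j) (yj_GB j)
  simpa [ip] using this

lemma vecx_GB : GB (wt (m := m)) (fun v => vec m v.2.1) :=
  GB.sum one_le_wt fun j => GB.smul one_le_wt (xj_GB (m := m) j) (GB.const (e m j))

lemma vecy_GB : GB (wt (m := m)) (fun v => vec m v.2.2) :=
  GB.sum one_le_wt fun j => GB.smul one_le_wt (yj_GB (m := m) j) (GB.const (e m j))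

lemma wedge_GB : GB (wt (m := m)) (fun v => wedge m v.2.1 v.2.2) := by
  simp only [wedge_eq]
  exact GB.add one_le_wt (GB.mul one_le_wt vecx_GB vecy_GB) (GB.smul one_le_wt ipxy_GB (GB.const 1))

lemma wE_GB (j : Fin m) : GB (wt (m := m)) (fun v => wE v.2.2 j) := by
  simp only [wE]
  exact GB.add one_le_wt (GB.mul one_le_wt (GB.const _) vecy_GB) (GB.smul one_le_wt (yj_GB j) (GB.const 1))

lemma wv_GB (j : Fin m) : GB (wt (m := m)) (fun v => wv v.2.1 j) := by
  have : ∀ v : ℝ × X m × X m, wv v.2.1 j = (1/2:ℂ)•(vec m v.2.1*e m j + (-1:ℂ) • (e m j*vec m v.2.1)) := by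
    intro v; rw [wv]; module
  simp only [this]
  exact GB.smul one_le_wt (GB.const _) (GB.add one_le_wt (GB.mul one_le_wt vecx_GB (GB.const _))
    (GB.smul one_le_wt (GB.const _) (GB.mul one_le_wt (GB.const _) vecx_GB)))

lemma DD_GB (p r : Pl) : GB (wt (m := m)) (fun v => DD p r v.1 v.2.1 v.2.2) :=
  GB.add one_le_wt (GB.smul one_le_wt (ev_GB p) (GB.const 1)) (GB.smul one_le_wt (ev_GB r) wedge_GB)

lemma cj_GB (j : Fin m) : GB (wt (m := m)) (fun v => 2 * (v.2.1 j : ℂ) * (ip v.2.2 v.2.2 : ℂ)) :=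
  GB.cmul one_le_wt (GB.cmul one_le_wt (GB.const 2) (xj_GB j)) ipyy_GB

lemma DDj_GB (p r : Pl) (j : Fin m) : GB (wt (m := m)) (fun v => DDj p r v.1 v.2.1 v.2.2 j) := by
  simp only [DDj]
  exact GB.add one_le_wt (GB.add one_le_wt (GB.smul one_le_wt (yj_GB j) (DD_GB _ _))
    (GB.smul one_le_wt (cj_GB j) (DD_GB _ _))) (GB.smul one_le_wt (ev_GB r) (wE_GB j))

lemma DDjj_GB (p r : Pl) (j : Fin m) : GB (wt (m := m)) (fun v => DDjj p r v.1 v.2.1 v.2.2 j) := by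
  simp only [DDjj]
  exact GB.add one_le_wt (GB.add one_le_wt (GB.add one_le_wt (GB.smul one_le_wt (yj_GB j) (DDj_GB _ _ _))
    (GB.smul one_le_wt (GB.cmul one_le_wt (GB.const 2) ipyy_GB) (DD_GB _ _)))
    (GB.smul one_le_wt (cj_GB j) (DDj_GB _ _ _)))
    (GB.smul one_le_wt (GB.add one_le_wt (GB.cmul one_le_wt (yj_GB j) (ev_GB _))
      (GB.cmul one_le_wt (cj_GB j) (ev_GB _))) (wE_GB j))

/-! ### rapidly decaying functions -/

def w1 (x : X m) : ℝ := 1 + ‖x‖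
def w2 (v : ℝ × X m) : ℝ := 1 + ‖v.2‖

lemma one_le_w1 (x : X m) : 1 ≤ w1 x := by have := norm_nonneg x; unfold w1; linarith
lemma one_le_w2 (x : ℝ × X m) : 1 ≤ w2 x := by have := norm_nonneg x.2; unfold w2; linarith

lemma GB.fst2 {E : Type*} [NormedAddCommGroup E] {f : ℝ × X m × X m → E} (hf : GB wt f) (y : X m) :
    GB w2 (fun v : ℝ × X m => f (v.1, v.2, y)) :=
  hf.comp (fun v : ℝ × X m => (v.1, v.2, y)) (by fun_prop) one_le_wt (1 + ‖y‖) (by positivity)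
    (fun q => by simp only [wt, w2]; rw [mul_comm])

lemma GB.fst1 {E : Type*} [NormedAddCommGroup E] {f : ℝ × X m × X m → E} (hf : GB wt f) (t : ℝ) (y : X m) :
    GB w1 (fun x : X m => f (t, x, y)) :=
  hf.comp (fun x : X m => (t, x, y)) (by fun_prop) one_le_wt (1 + ‖y‖) (by positivity)
    (fun q => by simp only [wt, w1]; rw [mul_comm])

lemma GB.snd1 {E : Type*} [NormedAddCommGroup E] {f : ℝ × X m × X m → E} (hf : GB wt f) (t : ℝ) (x : X m) :
    GB w1 (fun y : X m => f (t, x, y)) :=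
  hf.comp (fun y : X m => (t, x, y)) (by fun_prop) one_le_wt (1 + ‖x‖) (by positivity)
    (fun q => by simp only [wt, w1]; rfl)

def RD {E : Type*} [NormedAddCommGroup E] (h : X m → E) : Prop :=
  Continuous h ∧ ∀ N : ℕ, ∃ C : ℝ, 0 ≤ C ∧ ∀ x, ‖h x‖ * w1 x ^ N ≤ C

lemma RD.of_bound {E F G : Type*} [NormedAddCommGroup E] [NormedAddCommGroup F] [NormedAddCommGroup G]
    {h : X m → E} {g : X m → F} {k : X m → G} (hh : RD h) (hg : GB w1 g) (hk : Continuous k)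
    (D : ℝ) (hD : 0 ≤ D) (hb : ∀ x, ‖k x‖ ≤ D * (‖h x‖ * ‖g x‖)) : RD k := by
  refine ⟨hk, fun N => ?_⟩
  obtain ⟨cg, B, M, hB, hg⟩ := hg
  obtain ⟨C, hC, h1⟩ := hh.2 (N + M)
  refine ⟨D * B * C, by positivity, fun x => ?_⟩
  have := one_le_w1 x
  calc ‖k x‖ * w1 x ^ N ≤ (D * (‖h x‖ * (B * w1 x ^ M))) * w1 x ^ N := by
        gcongr
        exact (hb x).trans (by gcongr; exact hg x)
    _ = D * B * (‖h x‖ * w1 x ^ (N + M)) := by ring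
    _ ≤ _ := by gcongr; exact h1 x

lemma RD.smulG {φ : X m → ℂ} {g : X m → Cl m} (h : RD φ) (hg : GB w1 g) : RD fun x => φ x • g x :=
  RD.of_bound h hg (h.1.smul hg.1) 1 (by norm_num) fun x => by rw [norm_smulC, one_mul]

lemma RD.smulR {φ : X m → ℂ} {g : X m → Cl m} (h : GB w1 φ) (hg : RD g) : RD fun x => φ x • g x :=
  RD.of_bound hg h (h.1.smul hg.1) 1 (by norm_num) fun x => by rw [norm_smulC, one_mul, mul_comm]

lemma RD.mulG {f g : X m → Cl m} (h : RD f) (hg : GB w1 g) : RD fun x => f x * g x := by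
  obtain ⟨B, hB, hmul⟩ := norm_mul_le_cl (m := m)
  exact RD.of_bound h hg (h.1.mul hg.1) B (by linarith) fun x => (hmul _ _).trans (le_of_eq (by ring))

lemma RD.Gmul {f g : X m → Cl m} (h : GB w1 f) (hg : RD g) : RD fun x => f x * g x := by
  obtain ⟨B, hB, hmul⟩ := norm_mul_le_cl (m := m)
  exact RD.of_bound hg h (h.1.mul hg.1) B (by linarith) fun x => (hmul _ _).trans (le_of_eq (by ring))

lemma RD.gb {E : Type*} [NormedAddCommGroup E] {f : X m → E} (h : RD f) : GB w1 f := by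
  obtain ⟨C, hC, hb⟩ := h.2 0
  exact ⟨h.1, C, 0, hC, fun x => by simpa using hb x⟩

lemma RD.of_le {E : Type*} [NormedAddCommGroup E] {f : X m → E} (hf : Continuous f) (h : ∀ N : ℕ, ∃ C : ℝ, ∀ x, ‖x‖ ^ N * ‖f x‖ ≤ C) : RD f := by
  refine ⟨hf, fun N => ?_⟩
  obtain ⟨C, hC⟩ := h N
  obtain ⟨D, hD⟩ := h 0
  have hD0 : 0 ≤ D := by
    have := hD 0
    simp only [pow_zero, one_mul] at this
    exact (norm_nonneg _).trans this
  have hC0 : 0 ≤ C := le_trans (by positivity) (hC 0)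
  refine ⟨2 ^ N * (C + D), by positivity, fun x => ?_⟩
  have hx := norm_nonneg x
  have h1 : w1 x ^ N ≤ 2 ^ N * (‖x‖ ^ N + 1) := by
    unfold w1
    rcases le_total ‖x‖ 1 with h | h
    · calc (1 + ‖x‖) ^ N ≤ 2 ^ N := by gcongr; linarith
        _ ≤ _ := le_mul_of_one_le_right (by positivity) (by have : 0 ≤ ‖x‖ ^ N := by positivity
                                                            linarith)
    · calc (1 + ‖x‖) ^ N ≤ (2 * ‖x‖) ^ N := by gcongr; linarith
        _ = 2 ^ N * ‖x‖ ^ N := mul_pow _ _ _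
        _ ≤ _ := by gcongr; linarith
  calc ‖f x‖ * w1 x ^ N ≤ ‖f x‖ * (2 ^ N * (‖x‖ ^ N + 1)) := by gcongr
    _ = 2 ^ N * (‖x‖ ^ N * ‖f x‖ + ‖x‖ ^ 0 * ‖f x‖) := by ring
    _ ≤ _ := by gcongr; exact hC x; exact hD x

lemma RD.schwartz {E : Type*} [NormedAddCommGroup E] [NormedSpace ℝ E] (f : SchwartzMap (X m) E) : RD f := by
  refine RD.of_le f.continuous fun N => ?_
  obtain ⟨C, hC⟩ := f.decay N 0
  exact ⟨C, fun x => by simpa using hC.2 x⟩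

lemma integrable_w1 : ∃ N : ℕ, Integrable (fun x : X m => (w1 x ^ N)⁻¹) := by
  refine ⟨m + 1, ?_⟩
  have := integrable_one_add_norm (E := X m) (μ := volume) (r := (m + 1 : ℝ)) (by simp)
  refine this.congr (Filter.Eventually.of_forall fun x => ?_)
  have h : 0 ≤ 1 + ‖x‖ := by positivity
  simp only [w1]
  rw [Real.rpow_neg h]
  norm_cast

lemma RD.integrable {E : Type*} [NormedAddCommGroup E] {f : X m → E} (h : RD f) [SecondCountableTopologyEither (X m) E] : Integrable f := by
  obtain ⟨N, hN⟩ := integrable_w1 (m := m)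
  obtain ⟨C, hC, hb⟩ := h.2 N
  refine (hN.const_mul C).mono' h.1.aestronglyMeasurable (Filter.Eventually.of_forall fun x => ?_)
  have := one_le_w1 x
  have hp : 0 < w1 x ^ N := by positivity
  rw [← div_eq_mul_inv, le_div_iff₀ hp]
  exact hb x

lemma RD.add {E : Type*} [NormedAddCommGroup E] {f g : X m → E} (hf : RD f) (hg : RD g) : RD fun x => f x + g x := by
  refine ⟨hf.1.add hg.1, fun N => ?_⟩
  obtain ⟨C, hC, h1⟩ := hf.2 N
  obtain ⟨D, hD, h2⟩ := hg.2 N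
  refine ⟨C + D, by positivity, fun x => ?_⟩
  have := one_le_w1 x
  calc _ ≤ (‖f x‖ + ‖g x‖) * w1 x ^ N := by gcongr; exact norm_add_le _ _
    _ = ‖f x‖ * w1 x ^ N + ‖g x‖ * w1 x ^ N := by ring
    _ ≤ _ := add_le_add (h1 x) (h2 x)

/-! ### differentiation under the integral -/

lemma dui {φ : X m → ℂ} (hφ : RD φ) {H H' : ℝ × X m → Cl m} (hH : GB w2 H) (hH' : GB w2 H')
    (hd : ∀ t x, HasDerivAt (fun t => H (t, x)) (H' (t, x)) t) (t₀ : ℝ) :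
    HasDerivAt (fun t => ∫ x, φ x • H (t, x)) (∫ x, φ x • H' (t₀, x)) t₀ := by
  have hs : ∀ t : ℝ, Continuous fun x : X m => (t, x) := fun t => by fun_prop
  obtain ⟨C, N, hC, hb⟩ := hH'.2
  have key := hasDerivAt_integral_of_dominated_loc_of_deriv_le (𝕜 := ℝ) (μ := (volume : Measure (X m)))
    (F := fun t x => φ x • H (t, x)) (F' := fun t x => φ x • H' (t, x)) (x₀ := t₀)
    (bound := fun x => ‖φ x • ((C * w1 x ^ N : ℝ) : ℂ)‖) (s := Set.univ) Filter.univ_mem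
    (Filter.Eventually.of_forall fun t => (hφ.1.smul (hH.1.comp (hs t))).aestronglyMeasurable)
    (RD.integrable (RD.smulG hφ (hH.comp (fun x => (t₀, x)) (hs t₀) one_le_w2 1 (by norm_num) (fun q => by simp [w1, w2]))))
    (hφ.1.smul (hH'.1.comp (hs t₀))).aestronglyMeasurable
    (Filter.Eventually.of_forall fun x t _ => ?_)
    ?_ (Filter.Eventually.of_forall fun x t _ => ?_)
  · exact key.2
  · have := one_le_w1 x
    rw [norm_smulC, norm_smul, Complex.norm_real, Real.norm_of_nonneg (by positivity)]
    gcongr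
    exact hb (t, x)
  · refine Integrable.norm (RD.integrable ?_)
    have hc : Continuous (w1 (m := m)) := by unfold w1; fun_prop
    refine RD.of_bound hφ (g := fun x => ((C * w1 x ^ N : ℝ) : ℂ)) ⟨by fun_prop, C, N, hC, fun x => ?_⟩ (hφ.1.smul (by fun_prop)) 1 (by norm_num) fun x => by rw [norm_smul, one_mul]
    have := one_le_w1 x
    rw [Complex.norm_real, Real.norm_of_nonneg (by positivity)]
  · exact (hd t x).const_smul (φ x)

/-! ### the core identity -/

lemma ibp {φ ψ : X m → ℂ} (hφ : RD φ) (hψ : RD ψ) {v : X m} (h1 : ∀ x, HasLineDerivAt ℝ φ (ψ x) x v)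
    {V V' : X m → Cl m} (hV : GB w1 V) (hV' : GB w1 V') (h2 : ∀ x, HasLineDerivAt ℝ V (V' x) x v) :
    ∫ x, φ x • V' x = - ∫ x, ψ x • V x := by
  have := integral_bilinear_hasLineDerivAt_right_eq_neg_left_of_integrable (μ := (volume : Measure (X m)))
    (f := φ) (f' := ψ) (g := V) (g' := V') (v := v) (B := (ContinuousLinearMap.lsmul ℝ ℂ : ℂ →L[ℝ] Cl m →L[ℝ] Cl m))
    (RD.integrable (RD.smulG hψ hV)) (RD.integrable (RD.smulG hφ hV')) (RD.integrable (RD.smulG hφ hV))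
    (fun x _ => h1 x) (fun x _ => h2 x)
  exact this

lemma sum_psi_wv (x : X m) (ψ : Fin m → ℂ) (h : ∀ i j, (x i : ℂ) * ψ j = (x j : ℂ) * ψ i) :
    ∑ j, ψ j • wv x j = 0 := by
  have h1 : ∀ j, ψ j • wv x j = (1/2:ℂ) • ∑ i, ((x i : ℂ) * ψ j) • (e m i * e m j - e m j * e m i) := by
    intro j
    rw [wv, vec, Finset.sum_mul, Finset.mul_sum, ← Finset.sum_sub_distrib, smul_comm, Finset.smul_sum]
    congr 1
    refine Finset.sum_congr rfl fun i _ => ?_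
    simp only [smul_mul_assoc, mul_smul_comm]
    module
  simp only [h1]
  rw [← Finset.smul_sum]
  have h2 : ∑ j, ∑ i, ((x i : ℂ) * ψ j) • (e m i * e m j - e m j * e m i)
     = - ∑ j, ∑ i, ((x i : ℂ) * ψ j) • (e m i * e m j - e m j * e m i) := by
    conv_lhs => rw [Finset.sum_comm]
    rw [← Finset.sum_neg_distrib]
    refine Finset.sum_congr rfl fun i _ => ?_
    rw [← Finset.sum_neg_distrib]
    refine Finset.sum_congr rfl fun j _ => ?_
    rw [h i j]
    module
  have h3 : (2:ℂ) • ∑ j, ∑ i, ((x i : ℂ) * ψ j) • (e m i * e m j - e m j * e m i) = 0 := by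
    rw [two_smul]; nth_rewrite 1 [h2]; simp
  have h4 := congrArg (fun z => ((1/4:ℂ)) • z) h3
  simp only [smul_smul, smul_zero] at h4
  norm_num at h4
  norm_num
  exact h4

variable {n : ℕ}

def Mf (n : ℕ) (x : X m) (v : ℝ × X m) : Cl m := DD (pa n) (pb n) (Real.pi - v.1) v.2 x
def Nf (n : ℕ) (y : X m) (v : ℝ × X m) : Cl m := DD (pa n) (-pb n) v.1 v.2 y

lemma GB.refl {f : ℝ × X m → Cl m} (h : GB w2 f) : GB w2 (fun v => f (Real.pi - v.1, v.2)) :=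
  h.comp (fun v : ℝ × X m => (Real.pi - v.1, v.2)) (by fun_prop) one_le_w2 1 (by norm_num) (fun q => by simp [w2])

lemma MN_hasDeriv (n : ℕ) (x y : X m) (ξ : X m) (t : ℝ) :
    HasDerivAt (fun t => Mf n x (t, ξ) * Nf n y (t, ξ))
      (Mf n x (t, ξ) * DD (dt (pa n)) (dt (-pb n)) t ξ y
        + (-1:ℂ) • (DD (dt (pa n)) (dt (pb n)) (Real.pi - t) ξ x * Nf n y (t, ξ))) t := by
  have h1 : HasDerivAt (fun t => Mf n x (t, ξ)) ((-1:ℝ) • DD (dt (pa n)) (dt (pb n)) (Real.pi - t) ξ x) t := by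
    have := (DD_dt (pa n) (pb n) (Real.pi - t) ξ x).scomp t ((hasDerivAt_id t).const_sub Real.pi)
    exact this
  have h2 : HasDerivAt (fun t => Nf n y (t, ξ)) (DD (dt (pa n)) (dt (-pb n)) t ξ y) t :=
    DD_dt (pa n) (-pb n) t ξ y
  have := ContinuousLinearMap.hasDerivAt_of_bilinear (B := mulB m) (fun _ => h1) (fun _ => h2)
  refine HasDerivAt.congr_deriv (f := fun t => Mf n x (t, ξ) * Nf n y (t, ξ)) this ?_
  simp only [mulB_apply, rsmul_eq, smul_mul_assoc]
  push_cast
  rfl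

lemma core_const (n : ℕ) {φ : X (2*n+2) → ℂ} {ψ : Fin (2*n+2) → X (2*n+2) → ℂ} (hφ : RD φ) (hψ : ∀ j, RD (ψ j))
    (hd : ∀ j x, HasLineDerivAt ℝ φ (ψ j x) x (bj j))
    (hr : ∀ x i j, (x i : ℂ) * ψ j x = (x j : ℂ) * ψ i x) (x y : X (2*n+2)) (t : ℝ) :
    HasDerivAt (fun t => ∫ ξ, φ ξ • (Mf n x (t, ξ) * Nf n y (t, ξ))) 0 t := by
  have gM : GB w2 (Mf n x) := GB.refl ((DD_GB (pa n) (pb n)).fst2 x)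
  have gN : GB w2 (Nf n y) := (DD_GB (pa n) (-pb n)).fst2 y
  have gM' : GB w2 (fun v : ℝ × X (2*n+2) => DD (dt (pa n)) (dt (pb n)) (Real.pi - v.1) v.2 x) :=
    GB.refl ((DD_GB (dt (pa n)) (dt (pb n))).fst2 x)
  have gN' : GB w2 (fun v : ℝ × X (2*n+2) => DD (dt (pa n)) (dt (-pb n)) v.1 v.2 y) :=
    ((DD_GB (dt (pa n)) (dt (-pb n))).fst2 y)
  have key := dui hφ (GB.mul one_le_w2 gM gN)
    (H' := fun v => Mf n x v * DD (dt (pa n)) (dt (-pb n)) v.1 v.2 y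
        + (-1:ℂ) • (DD (dt (pa n)) (dt (pb n)) (Real.pi - v.1) v.2 x * Nf n y v))
    (GB.add one_le_w2 (GB.mul one_le_w2 gM gN') (GB.smul one_le_w2 (GB.const _) (GB.mul one_le_w2 gM' gN)))
    (fun t ξ => MN_hasDeriv n x y ξ t) t
  refine key.congr_deriv ?_
  let V : Fin (2*n+2) → X (2*n+2) → Cl (2*n+2) := fun j ξ => Mf n x (t, ξ) * wv ξ j * Nf n y (t, ξ)
  let V' : Fin (2*n+2) → X (2*n+2) → Cl (2*n+2) := fun j ξ =>
    Mf n x (t, ξ) * wv ξ j * DDj (pa n) (-pb n) t ξ y j + DDj (pa n) (pb n) (Real.pi - t) ξ x j * wv ξ j * Nf n y (t, ξ)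
  have e1 : ∀ ξ : X (2*n+2), φ ξ • (Mf n x (t, ξ) * DD (dt (pa n)) (dt (-pb n)) t ξ y
        + (-1:ℂ) • (DD (dt (pa n)) (dt (pb n)) (Real.pi - t) ξ x * Nf n y (t, ξ)))
        = (-Complex.I) • ∑ j, φ ξ • V' j ξ := by
    intro ξ
    rw [evol_M, evol_N, ← Finset.smul_sum]
    simp only [V', Finset.sum_add_distrib, mul_assoc (Mf n x (t, ξ)), ← Finset.mul_sum, ← Finset.sum_mul]
    rw [show DD (pa n) (pb n) (Real.pi - t) ξ x = Mf n x (t, ξ) from rfl,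
      show DD (pa n) (-pb n) t ξ y = Nf n y (t, ξ) from rfl]
    simp only [mul_sub, sub_mul, mul_neg, mul_smul_comm, smul_mul_assoc]
    module
  have g1 : ∀ {f : ℝ × X (2*n+2) → Cl (2*n+2)}, GB w2 f → GB w1 (fun ξ => f (t, ξ)) := fun h =>
    h.comp (fun ξ => (t, ξ)) (by fun_prop) one_le_w2 1 (by norm_num) (fun q => by simp [w1, w2])
  have gw : ∀ j : Fin (2*n+2), GB w1 (fun ξ : X (2*n+2) => wv ξ j) := fun j => (wv_GB j).fst1 0 0
  have gV : ∀ j, GB w1 (V j) := fun j => GB.mul one_le_w1 (GB.mul one_le_w1 (g1 gM) (gw j)) (g1 gN)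
  have gV' : ∀ j, GB w1 (V' j) := fun j => GB.add one_le_w1
    (GB.mul one_le_w1 (GB.mul one_le_w1 (g1 gM) (gw j)) ((DDj_GB (pa n) (-pb n) j).fst1 t y))
    (GB.mul one_le_w1 (GB.mul one_le_w1 ((DDj_GB (pa n) (pb n) j).fst1 (Real.pi - t) x) (gw j)) (g1 gN))
  have dV : ∀ j ξ, HasLineDerivAt ℝ (V j) (V' j ξ) ξ (bj j) := by
    intro j ξ
    have := ld_mul (ld_mul (DD_ld (pa n) (pb n) (Real.pi - t) ξ x j) (wv_ld ξ j)) (DD_ld (pa n) (-pb n) t ξ y j)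
    refine HasDerivAt.congr_deriv this ?_
    simp only [mul_zero, zero_add]
    rfl
  simp only [e1]
  rw [integral_smul, integral_finsetSum _ (fun j _ => RD.integrable (RD.smulG hφ (gV' j)))]
  have e2 : ∀ j, ∫ ξ, φ ξ • V' j ξ = - ∫ ξ, ψ j ξ • V j ξ := fun j => ibp hφ (hψ j) (hd j) (gV j) (gV' j) (dV j)
  simp only [e2]
  rw [Finset.sum_neg_distrib, ← integral_finsetSum _ (fun j _ => RD.integrable (RD.smulG (hψ j) (gV j)))]
  have e3 : ∀ ξ, ∑ j, ψ j ξ • V j ξ = 0 := by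
    intro ξ
    have : ∑ j, ψ j ξ • V j ξ = Mf n x (t, ξ) * (∑ j, ψ j ξ • wv ξ j) * Nf n y (t, ξ) := by
      rw [Finset.mul_sum, Finset.sum_mul]
      refine Finset.sum_congr rfl fun j _ => ?_
      simp only [V, mul_smul_comm, smul_mul_assoc]
    rw [this, sum_psi_wv ξ _ (hr ξ)]
    simp
  simp [e3]

lemma ev_cL0 (t : ℝ) (ht : Real.sin t = 0) (n : ℕ) : ∀ s q : ℝ,
    ev (cL n) s q t = (-Complex.I * Real.cos t) ^ n * Complex.exp (-Complex.I * s * Real.cos t) := by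
  induction n with
  | zero =>
    intro s q
    have h0 : Phi 0 0 = 1 := by
      unfold Phi egf
      rw [tsum_eq_single 0 (fun j hj => by simp [hj])]
      simp [pc, dk]
    simp [cL, ev_X, evG, En, ht, h0]
  | succ n ih =>
    intro s q
    have h1 := ev_ds (cL n) s q t
    rw [cL_succ, show (fun s => ev (cL n) s q t) = _ from funext fun s => ih s q] at h1
    have h2 : HasDerivAt (fun s : ℝ => (-Complex.I * Real.cos t) ^ n * Complex.exp (-Complex.I * s * Real.cos t))
      ((-Complex.I * Real.cos t) ^ n * (Complex.exp (-Complex.I * s * Real.cos t) * (-Complex.I * 1 * Real.cos t))) s := by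
      have h : HasDerivAt (fun s : ℝ => (s:ℂ)) 1 s := Complex.ofRealCLM.hasDerivAt
      exact (((h.const_mul (-Complex.I)).mul_const (Real.cos t : ℂ)).cexp).const_mul _
    rw [h1.unique h2]; ring

lemma ev_sL0 (t : ℝ) (ht : Real.sin t = 0) (n : ℕ) : ∀ s q : ℝ, ev (sL n) s q t = 0 := by
  induction n with
  | zero =>
    intro s q
    simp [sL, ev_mul, ev_X, evG, ht]
  | succ n ih =>
    intro s q
    have h1 := ev_ds (sL n) s q t
    rw [sL_succ, show (fun s => ev (sL n) s q t) = _ from funext fun s => ih s q] at h1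
    exact h1.unique (hasDerivAt_const _ _)

lemma DD0 (t : ℝ) (ht : Real.sin t = 0) (n : ℕ) (x y : X m) : DD (pa n) (pb n) t x y
    = ((-Complex.I * Real.cos t) ^ n * Complex.exp (-Complex.I * ip x y * Real.cos t)) • (1 : Cl m) := by
  simp [DD, pa, pb, ev_sub, ev_mul, ev_nat, ev_sL0 t ht, ev_cL0 t ht]

lemma core (n : ℕ) {φ : X (2*n+2) → ℂ} {ψ : Fin (2*n+2) → X (2*n+2) → ℂ} (hφ : RD φ) (hψ : ∀ j, RD (ψ j))
    (hd : ∀ j x, HasLineDerivAt ℝ φ (ψ j x) x (bj j))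
    (hr : ∀ x i j, (x i : ℂ) * ψ j x = (x j : ℂ) * ψ i x) (x y : X (2*n+2)) :
    ∫ ξ, φ ξ • (Kminus (2*n+2) ξ x * Kminus (2*n+2) y ξ)
      = (∫ ξ, φ ξ * Complex.exp (Complex.I * (ip ξ x - ip ξ y : ℝ))) • (1 : Cl (2*n+2)) := by
  have hc := is_const_of_deriv_eq_zero (f := fun t => ∫ ξ, φ ξ • (Mf n x (t, ξ) * Nf n y (t, ξ)))
    (fun t => (core_const n hφ hψ hd hr x y t).differentiableAt)
    (fun t => (core_const n hφ hψ hd hr x y t).deriv) (Real.pi / 2) 0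
  have e1 : ∀ ξ, Kminus (2*n+2) ξ x * Kminus (2*n+2) y ξ = Mf n x (Real.pi/2, ξ) * Nf n y (Real.pi/2, ξ) := by
    intro ξ
    rw [Kminus_eq, Kminus_eq, MM_eq, MM_eq', smul_mul_smul_comm, ← pow_add, ← two_mul, pow_mul]
    simp [Mf, Nf, sub_half]
  have e2 : ∀ ξ, Mf n x (0, ξ) * Nf n y (0, ξ) = Complex.exp (Complex.I * (ip ξ x - ip ξ y : ℝ)) • (1 : Cl (2*n+2)) := by
    intro ξ
    have : Nf n y (0, ξ) = DD (pa n) (pb n) 0 y ξ := by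
      rw [← MM_eq, MM_eq']; rfl
    rw [this, Mf, DD0 _ (by simp), DD0 _ (by simp), smul_mul_smul_comm]
    rw [mul_one, mul_mul_mul_comm, ← mul_pow, ← Complex.exp_add, ip_comm y ξ]
    congr 1
    simp
    congr 1; ring
  simp only [e1, hc, e2, smul_smul]
  exact integral_smul_const _ _

/-! ### integral transforms with kernels of polynomial growth -/

lemma wt_eq (t : ℝ) (x y : X m) : wt (t, x, y) = w1 x * w1 y := rfl

lemma T_GB {κ : ℝ × X m × X m → Cl m} (hκ : GB wt κ) (t : ℝ) : ∃ N : ℕ, ∀ h : X m → Cl m, RD h →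
    Continuous (fun y => ∫ x, κ (t, x, y) * h x) ∧ ∃ C, 0 ≤ C ∧ ∀ y, ‖∫ x, κ (t, x, y) * h x‖ ≤ C * w1 y ^ N := by
  obtain ⟨cκ, C, N, hC, hb⟩ := hκ
  obtain ⟨B, hB, hmul⟩ := norm_mul_le_cl (m := m)
  refine ⟨N, fun h hh => ?_⟩
  have hc1 : Continuous (w1 (m := m)) := by unfold w1; fun_prop
  have hbd : ∀ x y, ‖κ (t, x, y) * h x‖ ≤ (B * C * (‖h x‖ * w1 x ^ N)) * w1 y ^ N := by
    intro x y
    have h1 := one_le_w1 x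
    have h2 := one_le_w1 y
    calc _ ≤ B * ‖κ (t, x, y)‖ * ‖h x‖ := hmul _ _
      _ ≤ B * (C * wt (t, x, y) ^ N) * ‖h x‖ := by gcongr; exact hb _
      _ = _ := by rw [wt_eq]; ring
  have hint : Integrable (fun x => B * C * (‖h x‖ * w1 x ^ N)) := by
    refine Integrable.const_mul (RD.integrable ?_) _
    refine RD.of_bound hh (g := fun x => w1 x ^ N) ⟨by fun_prop, 1, N, by norm_num, fun x => ?_⟩ (by have := hh.1; fun_prop) 1 (by norm_num) fun x => ?_
    · have := one_le_w1 x
      rw [Real.norm_of_nonneg (by positivity)]; simp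
    · simp
  refine ⟨?_, ∫ x, B * C * (‖h x‖ * w1 x ^ N), ?_, fun y => ?_⟩
  · rw [continuous_iff_continuousAt]
    intro y₀
    have hs : ∀ y : X m, Continuous fun x : X m => (t, x, y) := fun t => by fun_prop
    refine continuousAt_of_dominated (bound := fun x => (B * C * (‖h x‖ * w1 x ^ N)) * (w1 y₀ + 1) ^ N)
      (Filter.Eventually.of_forall fun y => ((cκ.comp (hs y)).mul hh.1).aestronglyMeasurable) ?_ (hint.mul_const _)
      (Filter.Eventually.of_forall fun x => ?_)
    · have : ∀ᶠ y in nhds y₀, w1 y < w1 y₀ + 1 := hc1.continuousAt.eventually_lt continuousAt_const (by simp)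
      filter_upwards [this] with y hy
      refine Filter.Eventually.of_forall fun x => (hbd x y).trans ?_
      have h1 := one_le_w1 x
      have h2 := one_le_w1 y
      gcongr
    · have : Continuous fun y => κ (t, x, y) * h x := (cκ.comp (f := fun y => (t, x, y)) (by fun_prop)).mul continuous_const
      exact this.continuousAt
  · refine integral_nonneg fun x => ?_
    have h1 := one_le_w1 x
    show 0 ≤ B * C * (‖h x‖ * w1 x ^ N)
    positivity
  · rw [← integral_mul_const]
    exact norm_integral_le_of_norm_le (hint.mul_const _) (Filter.Eventually.of_forall fun x => hbd x y)

lemma ibp2 {g g' : X m → Cl m} (hg : RD g) (hg' : RD g') {v : X m} (h1 : ∀ x, HasLineDerivAt ℝ g (g' x) x v)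
    {V V' : X m → Cl m} (hV : GB w1 V) (hV' : GB w1 V') (h2 : ∀ x, HasLineDerivAt ℝ V (V' x) x v) :
    ∫ x, V' x * g x = - ∫ x, V x * g' x := by
  have := integral_bilinear_hasLineDerivAt_right_eq_neg_left_of_integrable (μ := (volume : Measure (X m)))
    (f := V) (f' := V') (g := g) (g' := g') (v := v) (B := mulB m)
    (RD.integrable (RD.Gmul hV' hg)) (RD.integrable (RD.Gmul hV hg')) (RD.integrable (RD.Gmul hV hg))
    (fun x _ => h2 x) (fun x _ => h1 x)
  have h3 : ∫ x, V x * g' x = - ∫ x, V' x * g x := this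
  rw [h3, neg_neg]

open scoped LineDeriv in
lemma schwartz_ld {E : Type*} [NormedAddCommGroup E] [NormedSpace ℝ E] (g : SchwartzMap (X m) E) (v x : X m) : HasLineDerivAt ℝ g (LineDeriv.lineDerivOp v g x) x v := by
  rw [SchwartzMap.lineDerivOp_apply]
  exact (g.differentiableAt.hasFDerivAt.hasLineDerivAt v).differentiableAt.hasDerivAt

def Tt (n : ℕ) (t : ℝ) (h : X m → Cl m) (y : X m) : Cl m := ∫ x, DD (pa n) (pb n) t x y * h x

def lap (g : SchwartzMap (X m) (Cl m)) : SchwartzMap (X m) (Cl m) :=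
  ∑ j : Fin m, LineDeriv.lineDerivOp (bj j : X m) (LineDeriv.lineDerivOp (bj j : X m) g)

lemma Tt_lap (n : ℕ) (hm : m = 2*n+2) (t : ℝ) (g : SchwartzMap (X m) (Cl m)) (y : X m) :
    (ip y y : ℂ) • Tt n t g y = - Tt n t (lap g) y := by
  have gD : GB w1 (fun x : X m => DD (pa n) (pb n) t x y) := (DD_GB (pa n) (pb n)).fst1 t y
  have gDj : ∀ j, GB w1 (fun x : X m => DDj (pa n) (pb n) t x y j) := fun j => (DDj_GB (pa n) (pb n) j).fst1 t y
  have gDjj : ∀ j, GB w1 (fun x : X m => DDjj (pa n) (pb n) t x y j) := fun j => (DDjj_GB (pa n) (pb n) j).fst1 t y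
  have h1 : ∀ j, ∫ x, DDjj (pa n) (pb n) t x y j * g x
      = ∫ x, DD (pa n) (pb n) t x y * LineDeriv.lineDerivOp (bj j) (LineDeriv.lineDerivOp (bj j) g) x := by
    intro j
    rw [ibp2 (RD.schwartz g) (RD.schwartz _) (fun x => schwartz_ld g (bj j) x) (gDj j) (gDjj j) (fun x => DDj_ld _ _ t x y j),
      ibp2 (RD.schwartz _) (RD.schwartz _) (fun x => schwartz_ld _ (bj j) x) gD (gDj j) (fun x => DD_ld _ _ t x y j), neg_neg]
  have h2 : Tt n t (lap g) y = ∑ j, ∫ x, DDjj (pa n) (pb n) t x y j * g x := by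
    simp only [h1]
    rw [← integral_finsetSum _ (fun j _ => RD.integrable (RD.Gmul gD (RD.schwartz _))), Tt]
    congr 1
    funext x
    rw [lap, ← Finset.mul_sum]
    congr 1
    simp [SchwartzMap.sum_apply]
  rw [h2, ← integral_finsetSum _ (fun j _ => RD.integrable (RD.Gmul (gDjj j) (RD.schwartz _)))]
  simp only [← Finset.sum_mul]
  simp only [helm n hm]
  rw [Tt, ← integral_smul, ← integral_neg]
  congr 1
  funext x
  rw [neg_mul, neg_neg, smul_mul_assoc]

lemma norm_sq_le_ip (y : X m) : ‖y‖ ^ 2 ≤ ip y y := by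
  have h : ‖y‖ ≤ Real.sqrt (ip y y) := by
    refine (pi_norm_le_iff_of_nonneg (Real.sqrt_nonneg _)).2 fun i => ?_
    rw [Real.norm_eq_abs, ← Real.sqrt_sq_eq_abs]
    refine Real.sqrt_le_sqrt ?_
    rw [sq, ip]
    exact Finset.single_le_sum (f := fun i => y i * y i) (fun i _ => mul_self_nonneg _) (Finset.mem_univ i)
  calc _ ≤ Real.sqrt (ip y y) ^ 2 := by gcongr
    _ = _ := Real.sq_sqrt (ip_self_nonneg _)

lemma Tt_RD (n : ℕ) (hm : m = 2*n+2) (t : ℝ) (g : SchwartzMap (X m) (Cl m)) : RD (Tt n t g) := by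
  obtain ⟨N, hN⟩ := T_GB (DD_GB (m := m) (pa n) (pb n)) t
  have hk : ∀ (k : ℕ) (g : SchwartzMap (X m) (Cl m)), ∃ C, 0 ≤ C ∧ ∀ y, (‖y‖^2) ^ k * ‖Tt n t g y‖ ≤ C * w1 y ^ N := by
    intro k
    induction k with
    | zero =>
      intro g
      obtain ⟨C, hC, h⟩ := (hN g (RD.schwartz g)).2
      exact ⟨C, hC, fun y => by simpa [Tt] using h y⟩
    | succ k ih =>
      intro g
      obtain ⟨C, hC, h⟩ := ih (lap g)
      refine ⟨C, hC, fun y => le_trans ?_ (h y)⟩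
      have h1 : ‖Tt n t (lap g) y‖ = ip y y * ‖Tt n t g y‖ := by
        rw [← norm_neg, ← Tt_lap n hm, norm_smulC, Complex.norm_real, Real.norm_of_nonneg (ip_self_nonneg _)]
      rw [h1, pow_succ, mul_assoc]
      gcongr
      exact norm_sq_le_ip y
  refine ⟨(hN g (RD.schwartz g)).1, fun M => ?_⟩
  obtain ⟨C, hC, h⟩ := hk (M + N) g
  obtain ⟨D, hD, h'⟩ := hk 0 g
  refine ⟨2 ^ (2 * (M + N)) * (C + D), by positivity, fun y => ?_⟩
  have hy := norm_nonneg y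
  have hw := one_le_w1 y
  have h1 : w1 y ^ (2 * (M + N)) ≤ 2 ^ (2 * (M + N)) * ((‖y‖^2) ^ (M + N) + 1) := by
    rw [← pow_mul]
    unfold w1
    rcases le_total ‖y‖ 1 with h | h
    · calc (1 + ‖y‖) ^ (2 * (M + N)) ≤ 2 ^ (2 * (M + N)) := by gcongr; linarith
        _ ≤ _ := le_mul_of_one_le_right (by positivity) (by have : 0 ≤ ‖y‖ ^ (2 * (M + N)) := by positivity
                                                            linarith)
    · calc (1 + ‖y‖) ^ (2 * (M + N)) ≤ (2 * ‖y‖) ^ (2 * (M + N)) := by gcongr; linarith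
        _ = 2 ^ (2 * (M + N)) * ‖y‖ ^ (2 * (M + N)) := mul_pow _ _ _
        _ ≤ _ := by gcongr; linarith
  have h2 : ‖Tt n t g y‖ * w1 y ^ M * w1 y ^ N ≤ (2 ^ (2 * (M + N)) * (C + D)) * w1 y ^ N := by
    calc ‖Tt n t g y‖ * w1 y ^ M * w1 y ^ N = ‖Tt n t g y‖ * w1 y ^ (M + N) := by ring
      _ ≤ ‖Tt n t g y‖ * w1 y ^ (2 * (M + N)) := by gcongr; omega
      _ ≤ ‖Tt n t g y‖ * (2 ^ (2 * (M + N)) * ((‖y‖^2) ^ (M + N) + 1)) := by gcongr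
      _ = 2 ^ (2 * (M + N)) * ((‖y‖^2) ^ (M + N) * ‖Tt n t g y‖ + (‖y‖^2) ^ 0 * ‖Tt n t g y‖) := by ring
      _ ≤ 2 ^ (2 * (M + N)) * (C * w1 y ^ N + D * w1 y ^ N) := mul_le_mul_of_nonneg_left (add_le_add (h y) (h' y)) (by positivity)
      _ = _ := by ring
  exact le_of_mul_le_mul_right h2 (by positivity)

/-! ### the kernel, Fubini -/

lemma K_GB (n : ℕ) : GB (wt (m := 2*n+2)) (fun v => Kminus (2*n+2) v.2.1 v.2.2) := by
  simp only [Kminus_eq, MM_eq]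
  refine GB.smul one_le_wt (GB.const _) ?_
  have h := GB.comp (v := wt (m := 2*n+2)) (DD_GB (m := 2*n+2) (pa n) (pb n))
    (fun v : ℝ × X (2*n+2) × X (2*n+2) => (Real.pi/2, v.2.1, v.2.2)) (by fun_prop) one_le_wt 1 (by norm_num)
    (fun q => by simp [wt])
  exact h

lemma int_mul {f : X m → Cl m} (hf : Integrable f) (c : Cl m) : (∫ x, f x) * c = ∫ x, f x * c := by
  have := ((mulB m).flip c).integral_comp_comm hf
  simpa [mulB_apply] using this.symm

lemma mul_int {f : X m → Cl m} (hf : Integrable f) (c : Cl m) : c * (∫ x, f x) = ∫ x, c * f x := by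
  have := ((mulB m) c).integral_comp_comm hf
  simpa [mulB_apply] using this.symm

lemma K1 (n : ℕ) (y : X (2*n+2)) : GB w1 (fun x => Kminus (2*n+2) x y) := (K_GB n).fst1 0 y
lemma K2 (n : ℕ) (x : X (2*n+2)) : GB w1 (fun y => Kminus (2*n+2) x y) := (K_GB n).snd1 0 x

lemma fub_int (n : ℕ) {a b : X (2*n+2) → Cl (2*n+2)} (ha : RD a) (hb : RD b) (x : X (2*n+2)) :
    Integrable (Function.uncurry fun y ξ : X (2*n+2) => Kminus (2*n+2) ξ x * (Kminus (2*n+2) y ξ * a ξ) * b y)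
      ((volume : Measure (X (2*n+2))).prod volume) := by
  obtain ⟨cκ, C, N, hC, hk⟩ := K_GB n
  obtain ⟨B, hB, hmul⟩ := norm_mul_le_cl (m := 2*n+2)
  have hc1 : Continuous (w1 (m := 2*n+2)) := by unfold w1; fun_prop
  have hRD : ∀ {h : X (2*n+2) → Cl (2*n+2)} (M : ℕ), RD h → Integrable (fun x => ‖h x‖ * w1 x ^ M) := by
    intro h M hh
    refine RD.integrable (RD.of_bound hh (g := fun x => w1 x ^ M) ⟨by fun_prop, 1, M, by norm_num, fun x => ?_⟩ (by have := hh.1; fun_prop) 1 (by norm_num) fun x => ?_)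
    · have := one_le_w1 x
      rw [Real.norm_of_nonneg (by positivity)]; simp
    · simp
  have hi := ((hRD N hb).mul_prod (hRD (2 * N) ha)).const_mul (B ^ 3 * C ^ 2 * w1 x ^ N)
  refine hi.mono' ?_ (Filter.Eventually.of_forall fun p => ?_)
  · refine Continuous.aestronglyMeasurable ?_
    have c1 : Continuous fun p : X (2*n+2) × X (2*n+2) => Kminus (2*n+2) p.2 x :=
      cκ.comp (f := fun p : X (2*n+2) × X (2*n+2) => ((0:ℝ), p.2, x)) (by fun_prop)
    have c2 : Continuous fun p : X (2*n+2) × X (2*n+2) => Kminus (2*n+2) p.1 p.2 :=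
      cκ.comp (f := fun p : X (2*n+2) × X (2*n+2) => ((0:ℝ), p.1, p.2)) (by fun_prop)
    exact (c1.mul (c2.mul (ha.1.comp continuous_snd))).mul (hb.1.comp continuous_fst)
  · obtain ⟨y, ξ⟩ := p
    have h1 := one_le_w1 x
    have h2 := one_le_w1 y
    have h3 := one_le_w1 ξ
    have k1 := hk (0, ξ, x)
    have k2 := hk (0, y, ξ)
    rw [wt_eq] at k1 k2
    simp only at k1 k2
    show ‖Kminus (2*n+2) ξ x * (Kminus (2*n+2) y ξ * a ξ) * b y‖ ≤ B ^ 3 * C ^ 2 * w1 x ^ N * (‖b y‖ * w1 y ^ N * (‖a ξ‖ * w1 ξ ^ (2 * N)))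
    calc _ ≤ B * ‖Kminus (2*n+2) ξ x * (Kminus (2*n+2) y ξ * a ξ)‖ * ‖b y‖ := hmul _ _
      _ ≤ B * (B * ‖Kminus (2*n+2) ξ x‖ * ‖Kminus (2*n+2) y ξ * a ξ‖) * ‖b y‖ := by gcongr; exact hmul _ _
      _ ≤ B * (B * ‖Kminus (2*n+2) ξ x‖ * (B * ‖Kminus (2*n+2) y ξ‖ * ‖a ξ‖)) * ‖b y‖ := by gcongr; exact hmul _ _
      _ ≤ B * (B * (C * (w1 ξ * w1 x) ^ N) * (B * (C * (w1 y * w1 ξ) ^ N) * ‖a ξ‖)) * ‖b y‖ := by gcongr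
      _ = _ := by ring

lemma fub (n : ℕ) {a b : X (2*n+2) → Cl (2*n+2)} (ha : RD a) (hb : RD b) (x : X (2*n+2)) :
    ∫ y, (∫ ξ, Kminus (2*n+2) ξ x * (Kminus (2*n+2) y ξ * a ξ)) * b y
      = ∫ ξ, Kminus (2*n+2) ξ x * (∫ y, Kminus (2*n+2) y ξ * (a ξ * b y)) := by
  have h1 : ∀ y, (∫ ξ, Kminus (2*n+2) ξ x * (Kminus (2*n+2) y ξ * a ξ)) * b y
      = ∫ ξ, Kminus (2*n+2) ξ x * (Kminus (2*n+2) y ξ * a ξ) * b y := fun y =>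
    int_mul (RD.integrable (RD.Gmul (K1 n x) (RD.Gmul (K2 n y) ha))) _
  have h2 : ∀ ξ, Kminus (2*n+2) ξ x * (∫ y, Kminus (2*n+2) y ξ * (a ξ * b y))
      = ∫ y, Kminus (2*n+2) ξ x * (Kminus (2*n+2) y ξ * a ξ) * b y := fun ξ => by
    rw [mul_int (RD.integrable (RD.Gmul (K1 n ξ) (RD.Gmul (GB.const _) hb)))]
    simp only [mul_assoc]
  simp only [h1, h2]
  exact integral_integral_swap (fub_int n ha hb x)

/-! ### Gaussians -/

def Ga (a : ℝ) (ξ : X m) : ℂ := ((Real.exp (-(a * ip ξ ξ)) : ℝ) : ℂ)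

lemma Ga_norm (a : ℝ) (ξ : X m) : ‖Ga a ξ‖ = Real.exp (-(a * ip ξ ξ)) := by
  rw [Ga, Complex.norm_real, Real.norm_of_nonneg (Real.exp_nonneg _)]

lemma Ga_le (a : ℝ) (ha : 0 ≤ a) (ξ : X m) : ‖Ga a ξ‖ ≤ 1 := by
  rw [Ga_norm, Real.exp_le_one_iff]
  have := ip_self_nonneg ξ
  nlinarith [mul_nonneg ha this]

lemma Ga_cont (a : ℝ) : Continuous (Ga a : X m → ℂ) := by unfold Ga ip; fun_prop

lemma Ga_RD {a : ℝ} (ha : 0 < a) : RD (Ga a : X m → ℂ) := by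
  refine RD.of_le (Ga_cont a) fun N => ⟨1 + (N.factorial : ℝ) / a ^ N, fun x => ?_⟩
  have hx := norm_nonneg x
  have h1 : ‖x‖ ^ N ≤ 1 + (‖x‖ ^ 2) ^ N := by
    rcases le_total ‖x‖ 1 with h | h
    · have := pow_le_one₀ (n := N) hx h
      have : 0 ≤ (‖x‖ ^ 2) ^ N := by positivity
      linarith
    · have : ‖x‖ ^ N ≤ (‖x‖ ^ 2) ^ N := by
        gcongr; nlinarith
      linarith
  have h2 := Real.pow_div_factorial_le_exp (a * ip x x) (mul_nonneg ha.le (ip_self_nonneg x)) N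
  have h3 := norm_sq_le_ip x
  have h4 : (‖x‖ ^ 2) ^ N * ‖Ga a x‖ ≤ (N.factorial : ℝ) / a ^ N := by
    rw [Ga_norm, Real.exp_neg, ← div_eq_mul_inv, div_le_div_iff₀ (Real.exp_pos _) (by positivity)]
    rw [div_le_iff₀ (by positivity)] at h2
    calc (‖x‖ ^ 2) ^ N * a ^ N ≤ (ip x x) ^ N * a ^ N := by gcongr
      _ = (a * ip x x) ^ N := by rw [mul_pow]; ring
      _ ≤ _ := by rw [mul_comm (N.factorial:ℝ)]; exact h2
  calc ‖x‖ ^ N * ‖Ga a x‖ ≤ (1 + (‖x‖ ^ 2) ^ N) * ‖Ga a x‖ := by gcongr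
    _ = ‖Ga a x‖ + (‖x‖ ^ 2) ^ N * ‖Ga a x‖ := by ring
    _ ≤ _ := add_le_add (Ga_le a ha.le x) h4

lemma Ga_ld (a : ℝ) (x : X m) (j : Fin m) : HasLineDerivAt ℝ (Ga a) ((-2 * a * x j : ℝ) * Ga a x) x (bj j) := by
  rw [HasLineDerivAt]
  simp only [Ga, ip_line2]
  have h1 : HasDerivAt (fun r : ℝ => ip x x + 2 * x j * r + r ^ 2) (2 * x j) 0 := by
    have : HasDerivAt (fun r : ℝ => ip x x + 2 * x j * r + r ^ 2) _ 0 := (((hasDerivAt_id (0:ℝ)).const_mul (2 * x j)).const_add (ip x x)).add ((hasDerivAt_id (0:ℝ)).pow 2)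
    refine this.congr_deriv ?_
    simp
  have h2 := (((h1.const_mul a).fun_neg).exp).ofReal_comp
  refine h2.congr_deriv ?_
  simp
  ring

lemma gauss_int (n : ℕ) {a : ℝ} (ha : 0 < a) (x y : X (2*n+2)) :
    ∫ ξ, Ga a ξ * Complex.exp (Complex.I * (ip ξ x - ip ξ y : ℝ))
      = ((Real.pi / a : ℝ) : ℂ) ^ (n + 1) * Ga (1 / (4 * a)) (y - x) := by
  have h := GaussianFourier.integral_cexp_neg_mul_sum_add (b := (a : ℂ)) (by simpa using ha)
    (fun i => Complex.I * ((x i - y i : ℝ) : ℂ))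
  have e1 : ∀ ξ : X (2*n+2), Ga a ξ * Complex.exp (Complex.I * (ip ξ x - ip ξ y : ℝ))
      = Complex.exp (-(a:ℂ) * ∑ i, (ξ i : ℂ) ^ 2 + ∑ i, Complex.I * ((x i - y i : ℝ) : ℂ) * ξ i) := by
    intro ξ
    rw [Ga, Complex.ofReal_exp, ← Complex.exp_add]
    congr 1
    simp only [ip]
    rw [← Finset.sum_sub_distrib]
    push_cast
    rw [neg_mul]
    congr 1
    · simp only [sq]
    · rw [Finset.mul_sum]
      refine Finset.sum_congr rfl fun i _ => ?_
      ring
  simp only [e1]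
  rw [h]
  congr 1
  · have : ((Fintype.card (Fin (2*n+2)) : ℂ) / 2) = ((n + 1 : ℕ) : ℂ) := by
      simp; ring
    rw [this, Complex.cpow_natCast]
    push_cast; rfl
  · rw [Ga, Complex.ofReal_exp]
    congr 1
    simp only [mul_pow, Complex.I_sq, ip, Pi.sub_apply]
    push_cast
    rw [← Finset.mul_sum]
    have : ∑ i, ((x i : ℂ) - y i) ^ 2 = ∑ i, ((y i : ℂ) - x i) * (y i - x i) :=
      Finset.sum_congr rfl fun i _ => by ring
    rw [this]
    ring

lemma gauss_core (n : ℕ) {a : ℝ} (ha : 0 < a) (x y : X (2*n+2)) :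
    ∫ ξ, Ga a ξ • (Kminus (2*n+2) ξ x * Kminus (2*n+2) y ξ)
      = (((Real.pi / a : ℝ) : ℂ) ^ (n + 1) * Ga (1 / (4 * a)) (y - x)) • (1 : Cl (2*n+2)) := by
  rw [← gauss_int n ha, core n (Ga_RD ha) (ψ := fun j x => (-2 * a * x j : ℝ) * Ga a x) ?_ (fun j x => Ga_ld a x j) ?_]
  · intro j
    have hg : GB (w1 (m := 2*n+2)) (fun x => ((-2 * a * x j : ℝ) : ℂ)) := by
      refine GB.of_lip (by fun_prop) (2 * a) (by positivity) fun x => ?_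
      rw [Complex.norm_real, Real.norm_eq_abs, abs_mul, abs_mul]
      have h1 : |x j| ≤ w1 x := (norm_le_pi_norm x j).trans (by unfold w1; linarith)
      rw [abs_of_pos ha]
      norm_num
      gcongr
    exact RD.of_bound (Ga_RD ha) hg (hg.1.mul (Ga_cont a)) 1 (by norm_num) (fun x => by rw [norm_mul, one_mul, mul_comm])
  · intro x i j
    push_cast; ring

/-! ### inversion -/

def cc (m : ℕ) : ℝ := (2*Real.pi) ^ (-(m:ℝ)/2)

lemma cc_eq (n : ℕ) : cc (2*n+2) = ((2*Real.pi) ^ (n+1))⁻¹ := by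
  unfold cc
  have : (-((2*n+2 : ℕ):ℝ)/2) = -((n+1 : ℕ) : ℝ) := by push_cast; ring
  rw [this, Real.rpow_neg (by positivity), Real.rpow_natCast]

lemma Fm_cc (h : X m → Cl m) (y : X m) : Fm m h y = (cc m : ℂ) • ∫ x, Kminus m x y * h x := rsmul_eq _ _

def Tk (m : ℕ) (h : X m → Cl m) (y : X m) : Cl m := ∫ x, Kminus m x y * h x

lemma Tk_cont (n : ℕ) {h : X (2*n+2) → Cl (2*n+2)} (hh : RD h) : Continuous (Tk (2*n+2) h) := by
  obtain ⟨N, hN⟩ := T_GB (K_GB n) 0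
  exact (hN h hh).1

lemma gauss_reg (n : ℕ) {h : X (2*n+2) → Cl (2*n+2)} (hh : RD h) (x : X (2*n+2)) {δ : ℝ} (hδ : 0 < δ) :
    ∫ ξ, Ga (δ^2/2) ξ • (Kminus (2*n+2) ξ x * Tk (2*n+2) h ξ)
      = ((2*Real.pi) ^ (n+1) : ℝ) • ∫ v, Ga (1/2) v • h (x + δ • v) := by
  have ha : 0 < δ^2/2 := by positivity
  have h1 := fub n (a := fun ξ => Ga (δ^2/2) ξ • (1 : Cl (2*n+2))) (RD.smulG (Ga_RD ha) (GB.const 1)) hh x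
  have h2 : ∀ ξ, Kminus (2*n+2) ξ x * (∫ y, Kminus (2*n+2) y ξ * (Ga (δ^2/2) ξ • (1 : Cl (2*n+2)) * h y))
      = Ga (δ^2/2) ξ • (Kminus (2*n+2) ξ x * Tk (2*n+2) h ξ) := by
    intro ξ
    simp only [smul_mul_assoc, mul_smul_comm, one_mul]
    rw [integral_smul, mul_smul_comm]; rfl
  have h3 : ∀ y, (∫ ξ, Kminus (2*n+2) ξ x * (Kminus (2*n+2) y ξ * Ga (δ^2/2) ξ • (1 : Cl (2*n+2)))) * h y
      = ((Real.pi / (δ^2/2) : ℝ) : ℂ) ^ (n + 1) • (Ga (1 / (4 * (δ^2/2))) (y - x) • h y) := by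
    intro y
    simp only [mul_smul_comm, mul_one]
    rw [gauss_core n ha, smul_mul_assoc, one_mul, smul_smul]
  simp only [h2, h3] at h1
  rw [← h1, integral_smul]
  have h4 := Measure.integral_comp_smul_of_nonneg (μ := (volume : Measure (X (2*n+2))))
    (fun u => Ga (1 / (4 * (δ^2/2))) u • h (x + u)) δ (hR := hδ.le)
  have h5 := integral_sub_right_eq_self (μ := (volume : Measure (X (2*n+2)))) (fun u => Ga (1 / (4 * (δ^2/2))) u • h (x + u)) x
  simp only [add_sub_cancel] at h5
  have h6 : ∀ v : X (2*n+2), Ga (1 / (4 * (δ^2/2))) (δ • v) = Ga (1/2) v := by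
    intro v
    have : ip (δ • v) (δ • v) = δ^2 * ip v v := by
      simp only [ip, Pi.smul_apply, smul_eq_mul, Finset.mul_sum]
      exact Finset.sum_congr rfl fun i _ => by ring
    simp only [Ga, this]
    congr 3
    field_simp
    ring
  simp only [h6] at h4
  rw [h4, h5, smul_smul, rsmul_eq]
  congr 1
  rw [← Complex.ofReal_pow]
  congr 1
  simp only [Module.finrank_fintype_fun_eq_card, Fintype.card_fin]
  rw [show 2 * n + 2 = 2 * (n+1) by ring, pow_mul, ← inv_pow, ← mul_pow]
  congr 1
  field_simp

lemma gauss_one (n : ℕ) : ∫ v : X (2*n+2), Ga (1/2) v = (((2*Real.pi) ^ (n+1) : ℝ) : ℂ) := by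
  have := gauss_int n (a := 1/2) (by norm_num) 0 0
  simp only [sub_self, Complex.ofReal_zero, mul_zero, Complex.exp_zero, mul_one] at this
  rw [this]
  have h0 : Ga (1 / (4 * (1/2))) (0 : X (2*n+2)) = 1 := by simp [Ga, ip]
  rw [h0, mul_one]
  push_cast
  congr 1
  field_simp

lemma inversion (n : ℕ) {h : X (2*n+2) → Cl (2*n+2)} (hh : RD h) (hF : RD (Tk (2*n+2) h)) (x : X (2*n+2)) :
    Tk (2*n+2) (Tk (2*n+2) h) x = (((2*Real.pi) ^ (n+1))^2 : ℝ) • h x := by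
  let d : ℕ → ℝ := fun k => 1 / ((k:ℝ) + 1)
  have hd : ∀ k, 0 < d k := fun k => by simp only [d]; positivity
  have hd0 : Filter.Tendsto d Filter.atTop (nhds 0) := tendsto_one_div_add_atTop_nhds_zero_nat
  have gK := RD.Gmul (K1 n x) hF
  have l1 : Filter.Tendsto (fun k => ∫ ξ, Ga ((d k)^2/2) ξ • (Kminus (2*n+2) ξ x * Tk (2*n+2) h ξ)) Filter.atTop
      (nhds (∫ ξ, Kminus (2*n+2) ξ x * Tk (2*n+2) h ξ)) := by
    refine tendsto_integral_of_dominated_convergence (fun ξ => ‖Kminus (2*n+2) ξ x * Tk (2*n+2) h ξ‖)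
      (fun k => ((Ga_cont _).smul gK.1).aestronglyMeasurable) gK.integrable.norm
      (fun k => Filter.Eventually.of_forall fun ξ => ?_) (Filter.Eventually.of_forall fun ξ => ?_)
    · rw [norm_smulC]
      exact mul_le_of_le_one_left (norm_nonneg _) (Ga_le _ (by positivity) _)
    · have c1 : Continuous fun r : ℝ => Ga (r^2/2) ξ • (Kminus (2*n+2) ξ x * Tk (2*n+2) h ξ) := by
        have : Continuous fun r : ℝ => Ga (r^2/2) ξ := by unfold Ga; fun_prop
        exact this.smul continuous_const
      have := (c1.tendsto 0).comp hd0
      have e0 : Ga ((0:ℝ)^2/2) ξ = 1 := by simp [Ga]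
      rw [e0, one_smul] at this
      exact this
  have l2 : Filter.Tendsto (fun k => ∫ v : X (2*n+2), Ga (1/2) v • h (x + d k • v)) Filter.atTop
      (nhds (∫ v : X (2*n+2), Ga (1/2) v • h x)) := by
    obtain ⟨C, hC, hb⟩ := hh.2 0
    simp only [pow_zero, mul_one] at hb
    have hc : ∀ k, Continuous fun v : X (2*n+2) => h (x + d k • v) := fun k =>
      hh.1.comp (continuous_const.add (continuous_const_smul (d k)))
    have hG := Ga_RD (m := 2*n+2) (a := 1/2) (by norm_num)
    refine tendsto_integral_of_dominated_convergence (fun ξ => ‖Ga (1/2) ξ‖ * C)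
      (fun k => ((Ga_cont _).smul (hc k)).aestronglyMeasurable) (hG.integrable.norm.mul_const C)
      (fun k => Filter.Eventually.of_forall fun ξ => ?_) (Filter.Eventually.of_forall fun ξ => ?_)
    · rw [norm_smulC]
      gcongr
      exact hb _
    · have c1 : Continuous fun r : ℝ => Ga (1/2) ξ • h (x + r • ξ) := 
by
        have c2 : Continuous fun r : ℝ => x + r • ξ := by fun_prop
        exact Continuous.smul (f := fun _ : ℝ => Ga (1/2) ξ) continuous_const (hh.1.comp c2)
      have := (c1.tendsto 0).comp hd0
      rw [zero_smul, add_zero] at this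
      exact this
  have l3 := l2.const_smul (((2*Real.pi) ^ (n+1) : ℝ))
  simp only [← gauss_reg n hh x (hd _)] at l3
  have := tendsto_nhds_unique l1 l3
  rw [Tk, this, integral_smul_const, gauss_one, rsmul_eq, rsmul_eq, smul_smul]
  push_cast
  rw [← sq]

lemma Fm_inv (n : ℕ) {h : X (2*n+2) → Cl (2*n+2)} (hh : RD h) (hF : RD (Fm (2*n+2) h)) (x : X (2*n+2)) :
    Fm (2*n+2) (Fm (2*n+2) h) x = h x := by
  have hc : (cc (2*n+2) : ℂ) ≠ 0 := by
    rw [cc_eq]; simp [Real.pi_ne_zero]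
  have e1 : ∀ y, Fm (2*n+2) h y = (cc (2*n+2) : ℂ) • Tk (2*n+2) h y := Fm_cc h
  have hT : RD (Tk (2*n+2) h) := by
    have : Tk (2*n+2) h = fun y => ((cc (2*n+2) : ℂ))⁻¹ • Fm (2*n+2) h y := by
      funext y; rw [e1, smul_smul, inv_mul_cancel₀ hc, one_smul]
    rw [this]
    exact RD.smulR (GB.const _) hF
  rw [Fm_cc]
  simp only [e1, mul_smul_comm]
  rw [integral_smul]
  have := inversion n hh hT x
  rw [Tk] at this
  rw [this, rsmul_eq, smul_smul, smul_smul, cc_eq]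
  have : (((2*Real.pi) ^ (n+1) : ℝ) : ℂ) ≠ 0 := by
    norm_cast; positivity
  push_cast at this ⊢
  rw [show ((2 * (Real.pi:ℂ)) ^ (n + 1))⁻¹ * ((2 * (Real.pi:ℂ)) ^ (n + 1))⁻¹ * ((2 * (Real.pi:ℂ)) ^ (n + 1)) ^ 2 = 1 by
    field_simp]
  exact one_smul _ _

/-! ### facts on the kernel and the transform -/

lemma Fm_Tt (n : ℕ) (h : X (2*n+2) → Cl (2*n+2)) (y : X (2*n+2)) :
    Fm (2*n+2) h y = ((cc (2*n+2) : ℂ) * (-1)^n) • Tt n (Real.pi/2) h y := by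
  rw [Fm_cc, Tt, mul_smul]
  congr 1
  rw [← integral_smul]
  refine integral_congr_ae (Filter.Eventually.of_forall fun x => ?_)
  simp only [Kminus_eq, MM_eq, smul_mul_assoc]

lemma Fm_schwartz (n : ℕ) (g : SchwartzMap (X (2*n+2)) (Cl (2*n+2))) : RD (Fm (2*n+2) g) := by
  have := RD.smulR (GB.const ((cc (2*n+2) : ℂ) * (-1)^n)) (Tt_RD n rfl (Real.pi/2) g)
  rwa [show Fm (2*n+2) g = _ from funext fun y => Fm_Tt n g y]

lemma Fm_cont (n : ℕ) {h : X (2*n+2) → Cl (2*n+2)} (hh : RD h) : Continuous (Fm (2*n+2) h) := by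
  have := (Tk_cont n hh).const_smul (cc (2*n+2) : ℂ)
  rwa [show Fm (2*n+2) h = _ from funext fun y => Fm_cc h y]

lemma pa_zero (n : ℕ) : ev (pa n) 0 0 (Real.pi/2) = (-1)^n := by
  have hd : ∀ t : ℝ, HasDerivAt (fun t : ℝ => ev (pa n) 0 0 t * Complex.exp (Complex.I * n * t)) 0 t := by
    intro t
    have h1 := ev_dt (pa n) 0 0 t
    have h : HasDerivAt (fun s : ℝ => (s:ℂ)) 1 t := Complex.ofRealCLM.hasDerivAt
    have h2 := h1.mul ((h.const_mul (Complex.I * n)).cexp)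
    refine h2.congr_deriv ?_
    rw [t_a]
    push_cast
    ring
  have hc := is_const_of_deriv_eq_zero (fun t => (hd t).differentiableAt) (fun t => (hd t).deriv) (Real.pi / 2) 0
  have e0 : ev (pa n) 0 0 0 = (-Complex.I)^n := by
    simp [pa, ev_sub, ev_mul, ev_nat, ev_sL0 0 (by simp), ev_cL0 0 (by simp)]
  have e1 : Complex.exp (Complex.I * n * ((Real.pi/2 : ℝ))) = Complex.I^n := by
    rw [show Complex.I * n * ((Real.pi/2 : ℝ):ℂ) = n * (Real.pi/2 * Complex.I) by push_cast; ring, Complex.exp_nat_mul,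
      Complex.exp_pi_div_two_mul_I]
  simp only [e0, e1] at hc
  simp only [Complex.ofReal_zero, mul_zero, Complex.exp_zero, mul_one] at hc
  have h3 : Complex.I^n * (-Complex.I)^n = 1 := by rw [← mul_pow]; simp
  calc ev (pa n) 0 0 (Real.pi/2) = ev (pa n) 0 0 (Real.pi/2) * (Complex.I^n * (-Complex.I)^n) := by rw [h3, mul_one]
    _ = (-Complex.I)^n * (-Complex.I)^n := by rw [← mul_assoc, hc]
    _ = _ := by rw [← mul_pow]; simp

lemma K_zero (n : ℕ) (ξ : X (2*n+2)) : Kminus (2*n+2) 0 ξ = 1 := by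
  have h1 : ip (0 : X (2*n+2)) ξ = 0 := by simp [ip]
  have h2 : ip (0 : X (2*n+2)) 0 = 0 := by simp [ip]
  have h3 : wedge (2*n+2) 0 ξ = 0 := by simp [wedge]
  rw [Kminus_eq, MM, h1, h2, h3, zero_mul, pa_zero, smul_zero, add_zero, smul_smul, ← mul_pow]
  simp

lemma cconj_K (n : ℕ) (x y : X (2*n+2)) : cconj (Kminus (2*n+2) x y) = Kminus (2*n+2) x y := by
  have hr : ∀ (k : ℕ) (s q : ℝ), ∃ r : ℝ, ev (cL k) s q (Real.pi/2) = r := fun k s q => ⟨_, ev_cL k s q⟩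
  have hs : ∀ (k : ℕ) (s q : ℝ), ∃ r : ℝ, ev (sL k) s q (Real.pi/2) = r := fun k s q => ⟨_, ev_sL k s q⟩
  have hp : ∀ s q : ℝ, (starRingEnd ℂ) (ev (pa n) s q (Real.pi/2)) = ev (pa n) s q (Real.pi/2) := by
    intro s q
    obtain ⟨a, ha⟩ := hr n s q
    obtain ⟨b, hb⟩ := hs (n-1) s q
    simp [pa, ev_sub, ev_mul, ev_nat, ha, hb]
  have hq : ∀ s q : ℝ, (starRingEnd ℂ) (ev (pb n) s q (Real.pi/2)) = ev (pb n) s q (Real.pi/2) := by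
    intro s q
    obtain ⟨b, hb⟩ := hs n s q
    simp [pb, hb]
  have he : ∀ (j k : Fin (2*n+2)) S, (starRingEnd ℂ) ((e (2*n+2) j * e (2*n+2) k) S) = (e (2*n+2) j * e (2*n+2) k) S := by
    intro j k S
    rw [mul_coeff, map_sum]
    refine Finset.sum_congr rfl fun T _ => ?_
    simp only [map_mul, map_pow, map_neg, map_one, e_coeff]
    have hep : ∀ t u : Fin (2*n+2), (starRingEnd ℂ) (eps t u) = eps t u := fun t u => by unfold eps; split_ifs <;> simp
    split_ifs <;> simp [sg, hep]
  have hsum : ∀ {ι : Type} (s : Finset ι) (f : ι → Cl (2*n+2)) S, (∑ i ∈ s, f i) S = ∑ i ∈ s, (f i) S := by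
    intro ι s f S
    classical
    induction s using Finset.induction_on with
    | empty => simp [zero_coeff]
    | insert a s ha ih => rw [Finset.sum_insert ha, Finset.sum_insert ha, add_coeff, ih]
  have hw : ∀ S, (starRingEnd ℂ) ((wedge (2*n+2) x y) S) = (wedge (2*n+2) x y) S := by
    intro S
    simp only [wedge, hsum, map_sum]
    refine Finset.sum_congr rfl fun j _ => Finset.sum_congr rfl fun k _ => ?_
    split_ifs
    · rw [smul_coeff, map_mul, he, Complex.conj_ofReal]
    · simp [zero_coeff]
  apply Cl_ext
  intro S
  show (starRingEnd ℂ) ((Kminus (2*n+2) x y) S) = _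
  rw [Kminus_eq, MM]
  simp only [smul_coeff, add_coeff, map_mul, map_add, hp, hq, hw, map_pow, map_neg, map_one, one_coeff]
  split_ifs <;> simp

/-! ### radial functions -/

structure RadD (φ : X m → ℂ) (ψ : Fin m → X m → ℂ) : Prop where
  rd : RD φ
  rdd : ∀ j, RD (ψ j)
  ld : ∀ j x, HasLineDerivAt ℝ φ (ψ j x) x (bj j)
  rot : ∀ x i j, (x i : ℂ) * ψ j x = (x j : ℂ) * ψ i x

def Eh (h : X m → ℂ) (y : X m) : ℂ := ∫ x, h x * Complex.exp (Complex.I * (ip x y : ℝ))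

lemma RadD.core {n : ℕ} {φ : X (2*n+2) → ℂ} {ψ : Fin (2*n+2) → X (2*n+2) → ℂ} (h : RadD φ ψ) (x y : X (2*n+2)) :
    ∫ ξ, φ ξ • (Kminus (2*n+2) ξ x * Kminus (2*n+2) y ξ) = Eh φ (x - y) • (1 : Cl (2*n+2)) := by
  rw [CliffordFourier.core n h.rd h.rdd h.ld h.rot x y, Eh]
  congr 1
  refine integral_congr_ae (Filter.Eventually.of_forall fun ξ => ?_)
  have : ip ξ (x - y) = ip ξ x - ip ξ y := by
    simp [ip, mul_sub, Finset.sum_sub_distrib]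
  simp only [this]

lemma RadD.Fm {n : ℕ} {φ : X (2*n+2) → ℂ} {ψ : Fin (2*n+2) → X (2*n+2) → ℂ} (h : RadD φ ψ) (z : X (2*n+2)) :
    Fm (2*n+2) (fun x => φ x • (1 : Cl (2*n+2))) z = ((cc (2*n+2) : ℂ) * Eh φ z) • (1 : Cl (2*n+2)) := by
  have := h.core z 0
  rw [sub_zero] at this
  rw [Fm_cc, mul_smul, ← this]
  congr 1
  refine integral_congr_ae (Filter.Eventually.of_forall fun ξ => ?_)
  simp only [K_zero, mul_smul_comm, mul_one]

lemma RD.ofReal {f : X m → ℝ} (h : RD f) : RD fun x => (f x : ℂ) :=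
  ⟨Complex.continuous_ofReal.comp h.1, fun N => by
    obtain ⟨C, hC, hb⟩ := h.2 N
    exact ⟨C, hC, fun x => by simpa using hb x⟩⟩

lemma ld_ofReal {f : X m → ℝ} {a : ℝ} {x v : X m} (h : HasLineDerivAt ℝ f a x v) :
    HasLineDerivAt ℝ (fun x => (f x : ℂ)) (a : ℂ) x v := HasDerivAt.ofReal_comp h

lemma rot_of_rad (f₀ : ℝ → ℝ) (f : SchwartzMap (X m) ℝ) (hrad : ∀ x, f x = f₀ (nrm x)) (x : X m) (i j : Fin m) :
    x i * fderiv ℝ f x (bj j) = x j * fderiv ℝ f x (bj i) := by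
  by_cases hij : i = j
  · subst hij; rfl
  let γ : ℝ → X m := fun θ => x + (((Real.cos θ - 1) * x i - Real.sin θ * x j) • (bj i : X m)
    + ((Real.cos θ - 1) * x j + Real.sin θ * x i) • (bj j : X m))
  have hγ : HasDerivAt γ (((-Real.sin 0) * x i - Real.cos 0 * x j) • (bj i : X m)
    + ((-Real.sin 0) * x j + Real.cos 0 * x i) • (bj j : X m)) 0 := by
    have hc := (Real.hasDerivAt_cos 0).sub_const 1
    have hs := Real.hasDerivAt_sin 0
    exact ((((hc.mul_const (x i)).sub (hs.mul_const (x j))).smul_const (bj i : X m)).add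
      (((hc.mul_const (x j)).add (hs.mul_const (x i))).smul_const (bj j : X m))).const_add x
  have hip : ∀ θ, ip (γ θ) (γ θ) = ip x x := by
    intro θ
    have hg : γ θ = x + ((Real.cos θ - 1) * x i - Real.sin θ * x j) • (bj i : X m)
      + ((Real.cos θ - 1) * x j + Real.sin θ * x i) • (bj j : X m) := by simp only [γ, add_assoc]
    rw [hg, ip_line2, ip_line2]
    have hb : (bj i : X m) j = 0 := by simp [bj, Ne.symm hij]
    simp only [Pi.add_apply, Pi.smul_apply, hb, smul_zero, add_zero]
    have := Real.sin_sq_add_cos_sq θ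
    linear_combination ((x i)^2 + (x j)^2) * this
  have hconst : ∀ θ, f (γ θ) = f x := fun θ => by rw [hrad, hrad, nrm, hip, nrm]
  have h0 : γ 0 = x := by simp [γ]
  have h1 : HasFDerivAt f (fderiv ℝ f x) (γ 0) := by rw [h0]; exact f.differentiableAt.hasFDerivAt
  have h2 := h1.comp_hasDerivAt 0 hγ
  have h3 : HasDerivAt (f ∘ γ) 0 0 := by
    rw [show (f ∘ γ) = fun _ => f x from funext hconst]
    exact hasDerivAt_const _ _
  have h4 := h2.unique h3
  simp only [map_add, map_smul, smul_eq_mul, Real.sin_zero, Real.cos_zero] at h4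
  linarith

lemma radD_of_rad (f₀ : ℝ → ℝ) (f : SchwartzMap (X m) ℝ) (hrad : ∀ x, f x = f₀ (nrm x)) :
    RadD (fun x => (f x : ℂ)) (fun j x => ((fderiv ℝ f x (bj j) : ℝ) : ℂ)) where
  rd := RD.ofReal (RD.schwartz f)
  rdd j := RD.ofReal (RD.schwartz (LineDeriv.lineDerivOp (bj j : X m) f))
  ld j x := ld_ofReal (schwartz_ld f (bj j) x)
  rot x i j := by exact_mod_cast rot_of_rad f₀ f hrad x i j

lemma expE_norm (r : ℝ) : ‖Complex.exp (Complex.I * (r : ℝ))‖ = 1 := by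
  rw [mul_comm]; exact Complex.norm_exp_ofReal_mul_I r

lemma ip_cont' (y : X m) : Continuous fun x : X m => ip x y := by unfold ip; fun_prop

lemma expE_GB (y : X m) : GB w1 (fun x : X m => Complex.exp (Complex.I * (ip x y : ℝ))) :=
  ⟨by have := ip_cont' y; fun_prop, 1, 0, by norm_num, fun x => by rw [expE_norm]; simp⟩

lemma xj_GB1 (j : Fin m) : GB w1 (fun x : X m => (x j : ℂ)) := (xj_GB j).fst1 0 0

lemma expE_ld (y : X m) (i : Fin m) (x : X m) :
    HasLineDerivAt ℝ (fun x : X m => Complex.exp (Complex.I * (ip x y : ℝ)))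
      (Complex.I * y i * Complex.exp (Complex.I * (ip x y : ℝ))) x (bj i) := by
  rw [HasLineDerivAt]
  simp only [ip_line]
  have h : HasDerivAt (fun r : ℝ => ((ip x y + r * y i : ℝ) : ℂ)) ((1 * y i : ℝ) : ℂ) 0 :=
    HasDerivAt.ofReal_comp (((hasDerivAt_id (0:ℝ)).mul_const (y i)).const_add _)
  refine HasDerivAt.congr_deriv (h.const_mul Complex.I).cexp ?_
  simp; ring

lemma xj_ld (i j : Fin m) (x : X m) :
    HasLineDerivAt ℝ (fun x : X m => (x j : ℂ)) (((bj i : X m) j : ℝ) : ℂ) x (bj i) := by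
  rw [HasLineDerivAt]
  have h : HasDerivAt (fun r : ℝ => ((x j + r * (bj i : X m) j : ℝ) : ℂ)) ((1 * (bj i : X m) j : ℝ) : ℂ) 0 :=
    HasDerivAt.ofReal_comp (((hasDerivAt_id (0:ℝ)).mul_const _).const_add _)
  refine HasDerivAt.congr_deriv (f := fun r : ℝ => (((x + r • (bj i : X m)) j : ℝ) : ℂ)) h ?_
  simp

lemma one_coe (z w : ℂ) (h : z • (1 : Cl m) = w • (1 : Cl m)) : z = w := by
  have := congrFun h (∅ : Finset (Fin m))
  have h1 := smul_coeff z (1 : Cl m) ∅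
  have h2 := smul_coeff w (1 : Cl m) ∅
  rw [h1, h2, one_coeff] at this
  simpa using this

lemma RadD.Eh_rot {φ : X m → ℂ} {ψ : Fin m → X m → ℂ} (h : RadD φ ψ) (y : X m) (i j : Fin m) :
    (y i : ℂ) * Eh (fun x => (x j : ℂ) * φ x) y = (y j : ℂ) * Eh (fun x => (x i : ℂ) * φ x) y := by
  have key : ∀ i j : Fin m, ((((bj i : X m) j : ℝ) : ℂ) * Eh φ y + Complex.I * y i * Eh (fun x => (x j : ℂ) * φ x) y) • (1 : Cl m)
      = - (Eh (fun x => (x j : ℂ) * ψ i x) y) • (1 : Cl m) := by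
    intro i j
    have gV : GB w1 (fun x : X m => (x j : ℂ) • (Complex.exp (Complex.I * (ip x y : ℝ)) • (1 : Cl m))) :=
      GB.smul one_le_w1 (xj_GB1 j) (GB.smul one_le_w1 (expE_GB y) (GB.const 1))
    have gV' : GB w1 (fun x : X m => (((((bj i : X m) j : ℝ) : ℂ) + Complex.I * y i * x j) * Complex.exp (Complex.I * (ip x y : ℝ))) • (1 : Cl m)) :=
      GB.smul one_le_w1 (GB.cmul one_le_w1 (GB.add one_le_w1 (GB.const _) (GB.cmul one_le_w1 (GB.const _) (xj_GB1 j))) (expE_GB y)) (GB.const 1)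
    have := ibp h.rd (h.rdd i) (h.ld i) gV gV' (by
      intro x
      have := ld_smul (xj_ld i j x) (ld_smul (expE_ld y i x) (ld_const (1 : Cl m) x (bj i)))
      refine HasDerivAt.congr_deriv this ?_
      module)
    have i1 : Integrable fun x : X m => φ x * Complex.exp (Complex.I * (ip x y : ℝ)) :=
      (RD.of_bound h.rd (expE_GB y) (h.rd.1.mul (expE_GB y).1) 1 (by norm_num) fun x => by simp).integrable
    have i2 : Integrable fun x : X m => (x j : ℂ) * φ x * Complex.exp (Complex.I * (ip x y : ℝ)) :=
      (RD.of_bound h.rd (GB.cmul one_le_w1 (xj_GB1 j) (expE_GB y)) (((xj_GB1 j).1.mul h.rd.1).mul (expE_GB y).1) 1 (by norm_num) fun x => by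
        simp only [Pi.mul_apply, norm_mul]; apply le_of_eq; ring).integrable
    have e1 : ∀ x : X m, φ x • (((((bj i : X m) j : ℝ) : ℂ) + Complex.I * y i * x j) * Complex.exp (Complex.I * (ip x y : ℝ))) • (1 : Cl m)
       = ((((bj i : X m) j : ℝ) : ℂ) * (φ x * Complex.exp (Complex.I * (ip x y : ℝ))) + Complex.I * y i * ((x j : ℂ) * φ x * Complex.exp (Complex.I * (ip x y : ℝ)))) • (1 : Cl m) := by
      intro x; module
    have e2 : ∀ x : X m, ψ i x • (x j : ℂ) • (Complex.exp (Complex.I * (ip x y : ℝ)) • (1 : Cl m))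
       = ((x j : ℂ) * ψ i x * Complex.exp (Complex.I * (ip x y : ℝ))) • (1 : Cl m) := by
      intro x; module
    simp only [e1, e2] at this
    rw [integral_smul_const, integral_smul_const, integral_add (i1.const_mul _) (i2.const_mul _),
      integral_const_mul, integral_const_mul] at this
    rw [neg_smul]
    exact this
  have a1 := one_coe _ _ (key i j)
  have a2 := one_coe _ _ (key j i)
  have a3 : (fun x : X m => (x j : ℂ) * ψ i x) = fun x => (x i : ℂ) * ψ j x := funext fun x => (h.rot x i j).symm
  rw [a3] at a1
  have a4 : (((bj i : X m) j : ℝ) : ℂ) = (((bj j : X m) i : ℝ) : ℂ) := by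
    simp only [bj, Pi.single_apply, eq_comm]
  rw [a4] at a1
  have a5 : Complex.I * ((y i : ℂ) * Eh (fun x => (x j : ℂ) * φ x) y - (y j : ℂ) * Eh (fun x => (x i : ℂ) * φ x) y) = 0 := by
    linear_combination a1 - a2
  exact sub_eq_zero.1 ((mul_eq_zero.1 a5).resolve_left Complex.I_ne_zero)

/-! ### Fourier side -/

def oneS (h : SchwartzMap (X m) ℝ) : SchwartzMap (X m) (Cl m) :=
  SchwartzMap.postcompCLM (ContinuousLinearMap.toSpanSingleton ℝ (1 : Cl m)) h

lemma oneS_apply (h : SchwartzMap (X m) ℝ) (x : X m) : oneS h x = (h x : ℂ) • (1 : Cl m) := rsmul_eq _ _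

lemma Eh_RD (n : ℕ) (h : SchwartzMap (X (2*n+2)) ℝ) : RD (Eh fun x : X (2*n+2) => (h x : ℂ)) := by
  have hT := RD.smulR (GB.const ((-Complex.I)^n)) (Tt_RD n rfl Real.pi (oneS h))
  have e1 : ∀ y, (-Complex.I)^n • Tt n Real.pi (oneS h) y = (Eh (fun x : X (2*n+2) => (h x : ℂ)) y) • (1 : Cl (2*n+2)) := by
    intro y
    have e2 : ∀ x, DD (pa n) (pb n) Real.pi x y * oneS h x
        = (Complex.I ^ n * ((h x : ℂ) * Complex.exp (Complex.I * (ip x y : ℝ)))) • (1 : Cl (2*n+2)) := by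
      intro x
      rw [DD0 _ (by simp), oneS_apply, smul_mul_smul_comm, mul_one]
      congr 1
      simp
      ring
    simp only [Tt, e2]
    rw [integral_smul_const, integral_const_mul, smul_smul, ← mul_assoc, ← mul_pow]
    simp [Eh]
  rw [show (fun y => (-Complex.I)^n • Tt n Real.pi (oneS h) y) = _ from funext e1] at hT
  have hval : ∀ z : ℂ, (z • (1 : Cl (2*n+2))) ∅ = z := fun z => by
    have := smul_coeff z (1 : Cl (2*n+2)) ∅
    rw [this, one_coeff]; simp
  have hle : ∀ z : ℂ, ‖z‖ ≤ ‖z • (1 : Cl (2*n+2))‖ := fun z => by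
    have := norm_le_pi_norm (z • (1 : Cl (2*n+2)) : Finset (Fin (2*n+2)) → ℂ) ∅
    calc ‖z‖ = ‖(z • (1 : Cl (2*n+2))) ∅‖ := by rw [hval]
      _ ≤ _ := this
  refine ⟨?_, fun N => ?_⟩
  · have hc : Continuous fun a : Cl (2*n+2) => a ∅ := continuous_apply (A := fun _ : Finset (Fin (2*n+2)) => ℂ) ∅
    have := hc.comp hT.1
    refine this.congr fun y => hval _
  · obtain ⟨C, hC, hb⟩ := hT.2 N
    refine ⟨C, hC, fun x => le_trans ?_ (hb x)⟩
    have := one_le_w1 x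
    gcongr
    exact hle _

def xS (j : Fin m) (h : SchwartzMap (X m) ℝ) : SchwartzMap (X m) ℝ := SchwartzMap.smulLeftCLM ℝ (fun x : X m => x j) h

lemma xS_apply (j : Fin m) (h : SchwartzMap (X m) ℝ) (x : X m) : xS j h x = x j * h x :=
  SchwartzMap.smulLeftCLM_apply_apply (ContinuousLinearMap.proj (R := ℝ) (φ := fun _ : Fin m => ℝ) j).hasTemperateGrowth h x

lemma Eh_ld {h : X m → ℂ} (hh : RD h) (j : Fin m) (y : X m) :
    HasLineDerivAt ℝ (Eh h) (Complex.I * Eh (fun x => (x j : ℂ) * h x) y) y (bj j) := by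
  have hw2 : ∀ {f : X m → ℂ}, GB w1 f → GB w2 (fun v : ℝ × X m => f v.2) := fun hf =>
    hf.comp (fun v : ℝ × X m => v.2) (by fun_prop) one_le_w1 1 (by norm_num) (fun q => by simp [w1, w2])
  have ge : GB w2 (fun v : ℝ × X m => Complex.exp (Complex.I * ((ip v.2 y + v.1 * v.2 j : ℝ) : ℂ))) :=
    ⟨by have := (ip_cont' y).comp (continuous_snd (X := ℝ))
        have h2 : Continuous fun v : ℝ × X m => ip v.2 y := this
        fun_prop, 1, 0, by norm_num, fun x => by rw [expE_norm]; simp⟩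
  have key := dui hh (GB.smul one_le_w2 ge (GB.const (1 : Cl m)))
    (GB.smul one_le_w2 (GB.cmul one_le_w2 (GB.cmul one_le_w2 (GB.const Complex.I) (hw2 (xj_GB1 j))) ge) (GB.const (1 : Cl m)))
    (by
      intro t x
      have h : HasDerivAt (fun r : ℝ => ((ip x y + r * x j : ℝ) : ℂ)) ((1 * x j : ℝ) : ℂ) t :=
        HasDerivAt.ofReal_comp (((hasDerivAt_id t).mul_const (x j)).const_add _)
      have h2 := ((h.const_mul Complex.I).cexp).smul_const (1 : Cl m)
      refine HasDerivAt.congr_deriv h2 ?_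
      push_cast
      module) 0
  have hval : ∀ z : ℂ, (z • (1 : Cl m)) ∅ = z := fun z => by
    have := smul_coeff z (1 : Cl m) ∅
    rw [this, one_coeff]; simp
  have e1 : ∀ t : ℝ, ∫ x : X m, h x • Complex.exp (Complex.I * ((ip x y + t * x j : ℝ) : ℂ)) • (1 : Cl m)
      = Eh h (y + t • bj j) • (1 : Cl m) := by
    intro t
    simp only [smul_smul]
    rw [integral_smul_const, Eh]
    congr 2
    funext x
    rw [ip_comm x (y + t • bj j), ip_line, ip_comm x y]
  have e2 : ∫ x : X m, h x • (Complex.I * (x j : ℂ) * Complex.exp (Complex.I * ((ip x y + 0 * x j : ℝ) : ℂ))) • (1 : Cl m)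
      = (Complex.I * Eh (fun x => (x j : ℂ) * h x) y) • (1 : Cl m) := by
    simp only [smul_smul]
    rw [integral_smul_const, Eh, ← integral_const_mul]
    congr 2
    funext x
    rw [zero_mul, add_zero]; ring
  simp only [e1, e2] at key
  have k2 : HasDerivAt (fun t : ℝ => (Eh h (y + t • bj j) • (1 : Cl m)) ∅)
    (((Complex.I * Eh (fun x => (x j : ℂ) * h x) y) • (1 : Cl m)) ∅) 0 :=
    (hasDerivAt_pi (𝕜 := ℝ) (E' := fun _ : Finset (Fin m) => ℂ)).1 key ∅
  simp only [hval] at k2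
  exact k2

lemma hat_RadD (n : ℕ) (f : SchwartzMap (X (2*n+2)) ℝ) {ψ : Fin (2*n+2) → X (2*n+2) → ℂ}
    (h : RadD (fun x => (f x : ℂ)) ψ) :
    RadD (fun y => (cc (2*n+2) : ℂ) * Eh (fun x : X (2*n+2) => (f x : ℂ)) y)
      (fun j y => (cc (2*n+2) : ℂ) * (Complex.I * Eh (fun x => (x j : ℂ) * (f x : ℂ)) y)) where
  rd := RD.of_bound (Eh_RD n f) (GB.const (cc (2*n+2) : ℂ)) (continuous_const.mul (Eh_RD n f).1) 1 (by norm_num)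
    fun x => by rw [norm_mul, one_mul, mul_comm]
  rdd j := by
    have e : (fun x : X (2*n+2) => (x j : ℂ) * (f x : ℂ)) = fun x => ((xS j f x : ℝ) : ℂ) := by
      funext x; rw [xS_apply]; push_cast; rfl
    rw [e]
    exact RD.of_bound (Eh_RD n (xS j f)) (GB.const ((cc (2*n+2) : ℂ) * Complex.I)) (continuous_const.mul (continuous_const.mul (Eh_RD n (xS j f)).1)) 1 (by norm_num)
      fun x => by simp only [Pi.mul_apply, norm_mul, one_mul]; apply le_of_eq; ring
  ld j x := HasDerivAt.const_mul (cc (2*n+2) : ℂ) (Eh_ld h.rd j x)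
  rot x i j := by
    have := h.Eh_rot x i j
    linear_combination ((cc (2*n+2) : ℂ) * Complex.I) * this

/-! ### the theorem -/

lemma tau_eq (n : ℕ) (a : X (2*n+2) → Cl (2*n+2)) (y x : X (2*n+2)) :
    tau (2*n+2) a y x = (cc (2*n+2) : ℂ) • ∫ ξ, Kminus (2*n+2) ξ x * (Kminus (2*n+2) y ξ * Fm (2*n+2) a ξ) := by
  refine (rsmul_eq _ _).trans ?_
  simp only [cconj_K]
  rfl

lemma conv_eq (n : ℕ) {a b : X (2*n+2) → Cl (2*n+2)} (ha : RD (Fm (2*n+2) a)) (hb : RD b) (x : X (2*n+2)) :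
    conv (2*n+2) a b x = Fm (2*n+2) (fun ξ => (cc (2*n+2) : ℂ) • ∫ y, Kminus (2*n+2) y ξ * (Fm (2*n+2) a ξ * b y)) x := by
  refine (rsmul_eq _ _).trans ?_
  rw [Fm_cc]
  refine congrArg (fun z => (cc (2*n+2) : ℂ) • z) ?_
  simp only [tau_eq, smul_mul_assoc, mul_smul_comm]
  rw [integral_smul, integral_smul, fub n ha hb x]

lemma w1_sub (x y : X m) : w1 x ≤ w1 (x - y) * w1 y := by
  have h : ‖x‖ ≤ ‖x - y‖ + ‖y‖ := by simpa using norm_add_le (x - y) y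
  simp only [w1]
  nlinarith [norm_nonneg (x - y), norm_nonneg y]

lemma RD_conv {a : X m → ℂ} {b : X m → Cl m} (ha : RD a) (hb : RD b) {k : X m → Cl m} (hk : Continuous k)
    (c : ℂ) (he : ∀ x, k x = c • ∫ y, a (x - y) • b y) : RD k := by
  refine ⟨hk, fun N => ?_⟩
  obtain ⟨C, hC, h1⟩ := ha.2 N
  have gw : GB w1 (fun y : X m => w1 y ^ N) := ⟨by unfold w1; fun_prop, 1, N, by norm_num, fun y => by
    have := one_le_w1 y
    rw [Real.norm_of_nonneg (by positivity), one_mul]⟩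
  have hI : Integrable fun y : X m => ‖b y‖ * w1 y ^ N :=
    (RD.of_bound hb gw (hb.1.norm.mul gw.1) 1 (by norm_num) fun y => by
      rw [Pi.mul_apply, norm_mul, norm_norm, one_mul]).integrable
  refine ⟨‖c‖ * (C * ∫ y : X m, ‖b y‖ * w1 y ^ N), ?_, fun x => ?_⟩
  · have : 0 ≤ ∫ y : X m, ‖b y‖ * w1 y ^ N := integral_nonneg fun y => by
      have := one_le_w1 y
      positivity
    positivity
  · have hx := one_le_w1 x
    have hxp : 0 < w1 x ^ N := by positivity
    rw [he, norm_smulC, mul_assoc]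
    refine mul_le_mul_of_nonneg_left ?_ (norm_nonneg _)
    rw [← le_div_iff₀ hxp]
    have : ‖∫ y, a (x - y) • b y‖ ≤ ∫ y, (C / w1 x ^ N) * (‖b y‖ * w1 y ^ N) := by
      refine norm_integral_le_of_norm_le (hI.const_mul _) (Filter.Eventually.of_forall fun y => ?_)
      rw [norm_smulC]
      have h2 := h1 (x - y)
      have h3 : w1 x ^ N ≤ w1 (x - y) ^ N * w1 y ^ N := by
        rw [← mul_pow]
        exact pow_le_pow_left₀ (by linarith) (w1_sub x y) N
      have hy := one_le_w1 y
      have hxy := one_le_w1 (x - y)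
      rw [div_mul_eq_mul_div, le_div_iff₀ hxp]
      calc ‖a (x - y)‖ * ‖b y‖ * w1 x ^ N ≤ ‖a (x - y)‖ * ‖b y‖ * (w1 (x - y) ^ N * w1 y ^ N) := by gcongr
        _ = (‖a (x - y)‖ * w1 (x - y) ^ N) * (‖b y‖ * w1 y ^ N) := by ring
        _ ≤ C * (‖b y‖ * w1 y ^ N) := by gcongr
    refine this.trans (le_of_eq ?_)
    rw [integral_const_mul]; ring

lemma main_aux (n : ℕ) (f₀ : ℝ → ℝ) (f : SchwartzMap (X (2*n+2)) ℝ) (hrad : ∀ x, f x = f₀ (nrm x))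
    (g : SchwartzMap (X (2*n+2)) (Cl (2*n+2))) :
    (∀ x : X (2*n+2), Fm (2*n+2) (conv (2*n+2) (fun v => (f v : ℂ) • (1 : Cl (2*n+2))) (fun v => g v)) x
        = Fm (2*n+2) (fun v => (f v : ℂ) • (1 : Cl (2*n+2))) x * Fm (2*n+2) (fun v => g v) x) ∧
    (∀ x : X (2*n+2), conv (2*n+2) (fun v => (f v : ℂ) • (1 : Cl (2*n+2))) (fun v => g v) x
        = conv (2*n+2) (fun v => g v) (fun v => (f v : ℂ) • (1 : Cl (2*n+2))) x) := by
  have hR := radD_of_rad f₀ f hrad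
  have hH := hat_RadD n f hR
  have hFf := fun z => hR.Fm z
  set φ : X (2*n+2) → ℂ := fun y => (cc (2*n+2) : ℂ) * Eh (fun x : X (2*n+2) => (f x : ℂ)) y with hφ
  set F : X (2*n+2) → Cl (2*n+2) := fun v => (f v : ℂ) • (1 : Cl (2*n+2)) with hF
  have hFf' : Fm (2*n+2) F = fun z => φ z • (1 : Cl (2*n+2)) := funext hFf
  have rF : RD F := RD.smulG hR.rd (GB.const 1)
  have rFF : RD (Fm (2*n+2) F) := by rw [hFf']; exact RD.smulG hH.rd (GB.const 1)
  have rg : RD (fun v => g v) := RD.schwartz g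
  have rGg : RD (Fm (2*n+2) (fun v => g v)) := Fm_schwartz n g
  have rh : RD fun ξ => φ ξ • Fm (2*n+2) (fun v => g v) ξ := RD.smulG hH.rd rGg.gb
  have c1 : ∀ x, conv (2*n+2) F (fun v => g v) x = Fm (2*n+2) (fun ξ => φ ξ • Fm (2*n+2) (fun v => g v) ξ) x := by
    intro x
    rw [conv_eq n rFF rg]
    congr 1
    funext ξ
    simp only [hFf', smul_mul_assoc, mul_smul_comm, one_mul]
    rw [integral_smul, smul_comm, Fm_cc]
  have c2 : ∀ x, conv (2*n+2) (fun v => g v) F x = Fm (2*n+2) (fun ξ => φ ξ • Fm (2*n+2) (fun v => g v) ξ) x := by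
    intro x
    rw [conv_eq n rGg rF]
    congr 1
    funext ξ
    have e1 : ∀ y, Kminus (2*n+2) y ξ * (Fm (2*n+2) (fun v => g v) ξ * F y)
        = (Kminus (2*n+2) y ξ * F y) * Fm (2*n+2) (fun v => g v) ξ := by
      intro y
      simp only [hF, mul_smul_comm, smul_mul_assoc, mul_one]
    simp only [e1]
    rw [← int_mul (RD.Gmul (K1 n ξ) rF).integrable, ← smul_mul_assoc, ← Fm_cc, hFf', smul_mul_assoc, one_mul]
  refine ⟨fun x => ?_, fun x => by rw [c1, c2]⟩
  have hinv : ∀ z, Fm (2*n+2) (Fm (2*n+2) F) z = F z := fun z => Fm_inv n rF rFF z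
  have htau : ∀ y x, tau (2*n+2) F y x = (f (x - y) : ℂ) • (1 : Cl (2*n+2)) := by
    intro y x
    rw [tau_eq]
    simp only [hFf', mul_smul_comm, mul_one]
    rw [hH.core x y, smul_smul, ← hH.Fm, ← hFf', hinv]
  have hconv : conv (2*n+2) F (fun v => g v) = Fm (2*n+2) (fun ξ => φ ξ • Fm (2*n+2) (fun v => g v) ξ) := funext c1
  have rc : RD (Fm (2*n+2) (fun ξ => φ ξ • Fm (2*n+2) (fun v => g v) ξ)) := by
    refine RD_conv hR.rd rg (Fm_cont n rh) (cc (2*n+2) : ℂ) fun x => ?_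
    rw [← c1]
    refine (rsmul_eq _ _).trans ?_
    simp only [htau, smul_mul_assoc, one_mul]
    rfl
  rw [hconv, Fm_inv n rh rc, hFf', smul_mul_assoc, one_mul]

lemma main_aux' (m : ℕ) (hme : Even m) (hm : 2 ≤ m)
    (f₀ : ℝ → ℝ) (f : SchwartzMap (Fin m → ℝ) ℝ) (hrad : ∀ x, f x = f₀ (nrm x))
    (g : SchwartzMap (Fin m → ℝ) (Cl m)) :
    (∀ x : Fin m → ℝ,
      Fm m (conv m (fun v => f v • (1 : Cl m)) (fun v => g v)) x
        = Fm m (fun v => f v • (1 : Cl m)) x * Fm m (fun v => g v) x) ∧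
    (∀ x : Fin m → ℝ,
      conv m (fun v => f v • (1 : Cl m)) (fun v => g v) x
        = conv m (fun v => g v) (fun v => f v • (1 : Cl m)) x) := by
  obtain ⟨k, hk⟩ := hme
  obtain ⟨n, rfl⟩ : ∃ n, m = 2*n+2 := ⟨k - 1, by omega⟩
  have e : (fun v => f v • (1 : Cl (2*n+2))) = fun v => (f v : ℂ) • (1 : Cl (2*n+2)) := funext fun v => rsmul_eq _ _
  rw [e]
  exact main_aux n f₀ f hrad g

end Aux

/-- For even `m`, if `f` is a real-valued radial Schwartz function then, for every
Clifford-algebra-valued Schwartz function `g`,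
`F_-(f *_{Cl} g) = (F_- f) · (F_- g)` and `f *_{Cl} g = g *_{Cl} f`. -/
theorem convolution_radial (m : ℕ) (hme : Even m) (hm : 2 ≤ m)
    (f₀ : ℝ → ℝ) (f : SchwartzMap (Fin m → ℝ) ℝ) (hrad : ∀ x, f x = f₀ (nrm x))
    (g : SchwartzMap (Fin m → ℝ) (Cl m)) :
    (∀ x : Fin m → ℝ,
      Fm m (conv m (fun v => f v • (1 : Cl m)) (fun v => g v)) x
        = Fm m (fun v => f v • (1 : Cl m)) x * Fm m (fun v => g v) x) ∧
    (∀ x : Fin m → ℝ,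
      conv m (fun v => f v • (1 : Cl m)) (fun v => g v) x
        = conv m (fun v => g v) (fun v => f v • (1 : Cl m)) x) := by
  exact main_aux' m hme hm f₀ f hrad g

end CliffordFourier
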